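/- Fix an integer t ≥ 2 and let n ≥ 2263. If exp(2/p_n) · f(n) < ζ(t), where f(n) := 1 + 1.1253/(log p_n · log log N_n), then R_t(N_n) < e^γ, where R_t(x) := Ψ_t(x)/(x log log x). -/

import Mathlib

open Finset Filter

/-- Generalized Dedekind psi function `Ψ_t(n) = n ∏_{p ∣ n} (1 + 1/p + ⋯ + 1/p^(t-1))`. -/
noncomputable def Psi (t n : ℕ) : ℝ :=
  (n : ℝ) * ∏ p ∈ n.primeFactors, ∑ i ∈ Finset.range t, (1 : ℝ) / (p : ℝ) ^ i

/-- The primorial `N_n = ∏_{k=1}^n p_k`, the product of the first `n` primes. -/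
noncomputable def primorialAt (n : ℕ) : ℕ := ∏ k ∈ Finset.range n, Nat.nth Nat.Prime k

/-- The `n`-th prime `p_n` (so `nthPrime 1 = 2`). -/
noncomputable def nthPrime (n : ℕ) : ℕ := Nat.nth Nat.Prime (n - 1)

/-- The ratio `R_t(x) = Ψ_t(x) / (x log log x)`. -/
noncomputable def Rt (t n : ℕ) : ℝ := Psi t n / ((n : ℝ) * Real.log (Real.log n))

/-- The Riemann zeta value `ζ(t) = ∑_{n ≥ 1} n^{-t}` at an integer argument. -/
noncomputable def zetaNat (t : ℕ) : ℝ := ∑' k : ℕ, 1 / ((k : ℝ) + 1) ^ t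

section Hadamard

open Complex Metric

/-- One point version of dividing out a zero of an entire function. -/
lemma exists_entire_factor {f : ℂ → ℂ} (hf : Differentiable ℂ f) (h0 : f 0 ≠ 0) {ρ : ℂ}
    (hρ : ρ ≠ 0) :
    ∃ g : ℂ → ℂ, Differentiable ℂ g ∧
      (∀ z, f z = (1 - z / ρ) ^ analyticOrderNatAt f ρ * g z) ∧ g ρ ≠ 0 := by
  have hfa : AnalyticAt ℂ f ρ := hf.analyticAt ρ
  obtain ⟨p, hp⟩ := hfa
  have hne : p ≠ 0 := by
    intro hp0
    rw [hp0] at hp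
    have h1 : ∀ᶠ z in nhds ρ, f z = 0 := hp.eventually_eq_zero
    have h2 : f = 0 :=
      AnalyticOnNhd.eq_of_eventuallyEq (fun z _ => hf.analyticAt z) (fun z _ => analyticAt_const) h1
    exact h0 (by simp [h2])
  have key := hp.eq_pow_order_mul_iterate_dslope
  have hdiff : ∀ n : ℕ, Differentiable ℂ ((Function.swap dslope ρ)^[n] f) := by
    intro n
    induction n with
    | zero => simpa using hf
    | succ n ih =>
      rw [Function.iterate_succ_apply']
      have := (Complex.differentiableOn_dslope (s := Set.univ) (c := ρ) Filter.univ_mem).2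
        ih.differentiableOn
      exact differentiableOn_univ.1 this
  have hn0 := hp.iterate_dslope_fslope_ne_zero hne
  have hord : analyticOrderNatAt f ρ = p.order := by
    have : analyticOrderAt f ρ = p.order := by
      rw [(hf.analyticAt ρ).analyticOrderAt_eq_natCast]
      exact ⟨_, (hdiff p.order).analyticAt ρ, hn0, Eventually.of_forall key⟩
    simp [analyticOrderNatAt, this]
  refine ⟨fun z => (-ρ) ^ p.order * (Function.swap dslope ρ)^[p.order] f z,
    (hdiff p.order).const_mul _, fun z => ?_, ?_⟩
  · rw [hord, key z, smul_eq_mul, ← mul_assoc, ← mul_pow]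
    congr 2
    field_simp
    ring
  · exact mul_ne_zero (pow_ne_zero _ (neg_ne_zero.2 hρ)) hn0

lemma exists_entire_quotient {f : ℂ → ℂ} (hf : Differentiable ℂ f) (h0 : f 0 ≠ 0) (Z : Finset ℂ)
    (hZ : ∀ ρ ∈ Z, ρ ≠ 0) :
    ∃ g : ℂ → ℂ, Differentiable ℂ g ∧
      (∀ z, f z = (∏ ρ ∈ Z, (1 - z / ρ) ^ analyticOrderNatAt f ρ) * g z) ∧
      ∀ ρ ∈ Z, g ρ ≠ 0 := by
  classical
  induction Z using Finset.induction_on with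
  | empty => exact ⟨f, hf, by simp, by simp⟩
  | insert a Z ha ih =>
    obtain ⟨g, hg, hfg, hgZ⟩ := ih fun ρ h => hZ ρ (mem_insert_of_mem h)
    have ha0 : a ≠ 0 := hZ a (mem_insert_self _ _)
    have hg0 : g 0 ≠ 0 := by
      intro h
      apply h0
      rw [hfg 0, h, mul_zero]
    obtain ⟨k, hk, hgk, hka⟩ := exists_entire_factor hg hg0 ha0
    have hP : Differentiable ℂ
        (fun z : ℂ => ∏ ρ ∈ Z, (1 - z / ρ) ^ analyticOrderNatAt f ρ) := by
      fun_prop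
    have hord : analyticOrderNatAt f a = analyticOrderNatAt g a := by
      have h1 : f = (fun z : ℂ => ∏ ρ ∈ Z, (1 - z / ρ) ^ analyticOrderNatAt f ρ) * g := by
        ext z; exact hfg z
      have h2 : analyticOrderAt (fun z : ℂ => ∏ ρ ∈ Z, (1 - z / ρ) ^ analyticOrderNatAt f ρ) a
          = 0 := by
        rw [(hP.analyticAt a).analyticOrderAt_eq_zero]
        refine Finset.prod_ne_zero_iff.2 fun ρ hρ => pow_ne_zero _ ?_
        have hρ0 := hZ ρ (mem_insert_of_mem hρ)
        have : a ≠ ρ := fun h => ha (h ▸ hρ)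
        rw [sub_ne_zero]
        intro h
        apply this
        field_simp at h
        exact h.symm
      have h3 : analyticOrderAt f a = analyticOrderAt g a := by
        conv_lhs => rw [h1]
        rw [analyticOrderAt_mul (hP.analyticAt a) (hg.analyticAt a), h2, zero_add]
      simp [analyticOrderNatAt, h3]
    refine ⟨k, hk, fun z => ?_, ?_⟩
    · rw [prod_insert ha, hfg z, hgk z, hord]
      ring
    · intro ρ hρ
      rcases mem_insert.1 hρ with rfl | h
      · exact hka
      · intro hk0
        exact hgZ ρ h (by rw [hgk, hk0, mul_zero])

/-- Counting zeros by the maximum principle. -/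
lemma sum_order_le {f : ℂ → ℂ} (hf : Differentiable ℂ f) (h0 : f 0 = 1) (Z : Finset ℂ)
    {R B : ℝ} (hR : 0 < R) (hZ : ∀ ρ ∈ Z, ρ ≠ 0 ∧ ‖ρ‖ ≤ R)
    (hB : ∀ z, ‖z‖ = 4 * R → ‖f z‖ ≤ Real.exp B) :
    (∑ ρ ∈ Z, (analyticOrderNatAt f ρ : ℝ)) ≤ B := by
  obtain ⟨g, hg, hfg, hgZ⟩ := exists_entire_quotient hf (by simp [h0]) Z fun ρ h => (hZ ρ h).1
  set N := ∑ ρ ∈ Z, analyticOrderNatAt f ρ with hN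
  have hbd : ∀ z ∈ frontier (ball (0 : ℂ) (4 * R)), ‖g z‖ ≤ Real.exp B / 3 ^ N := by
    intro z hz
    rw [frontier_ball _ (by positivity), mem_sphere_zero_iff_norm] at hz
    have h1 := hB z hz
    rw [hfg z, norm_mul, norm_prod] at h1
    have h2 : (3 : ℝ) ^ N ≤ ∏ ρ ∈ Z, ‖(1 - z / ρ) ^ analyticOrderNatAt f ρ‖ := by
      rw [hN, ← Finset.prod_pow_eq_pow_sum]
      refine Finset.prod_le_prod (fun _ _ => by positivity) fun ρ hρ => ?_
      rw [norm_pow]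
      refine pow_le_pow_left₀ (by norm_num) ?_ _
      have h3 : 4 ≤ ‖z / ρ‖ := by
        rw [norm_div, hz, le_div_iff₀ (norm_pos_iff.2 (hZ ρ hρ).1)]
        nlinarith [(hZ ρ hρ).2]
      have h4 := norm_sub_norm_le (z / ρ) 1
      rw [norm_one, norm_sub_rev] at h4
      linarith
    rw [le_div_iff₀ (by positivity)]
    calc ‖g z‖ * 3 ^ N ≤ ‖g z‖ * ∏ ρ ∈ Z, ‖(1 - z / ρ) ^ analyticOrderNatAt f ρ‖ := by gcongr
      _ ≤ _ := by rw [mul_comm]; exact h1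
  have hg0 : ‖g 0‖ ≤ Real.exp B / 3 ^ N :=
    Complex.norm_le_of_forall_mem_frontier_norm_le isBounded_ball hg.diffContOnCl hbd
      (subset_closure (mem_ball_self (by positivity)))
  have hg1 : g 0 = 1 := by
    have := hfg 0
    simpa [h0] using this.symm
  rw [hg1, norm_one, le_div_iff₀ (by positivity), one_mul] at hg0
  have h3 : Real.exp (N : ℝ) ≤ Real.exp B := by
    refine le_trans ?_ hg0
    rw [← Real.exp_one_pow]
    gcongr
    exact Real.exp_one_lt_three.le
  have := Real.exp_le_exp.1 h3
  rw [hN] at this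
  push_cast at this
  exact this

/-- The logarithmic derivative of a zero free function on a disc varies slowly. -/
lemma logDeriv_sub_le {g : ℂ → ℂ} (hg : Differentiable ℂ g) (h0 : g 0 = 1) {R B : ℝ}
    (hR : 0 < R) (hB0 : 0 < B) (hz : ∀ z ∈ ball (0 : ℂ) R, g z ≠ 0)
    (hB : ∀ z ∈ ball (0 : ℂ) R, ‖g z‖ ≤ Real.exp B) {s : ℂ} (hs : ‖s‖ ≤ R / 8) :
    ‖logDeriv g s - logDeriv g 0‖ ≤ 64 * B / R ^ 2 * ‖s‖ := by
  have hld : DifferentiableOn ℂ (logDeriv g) (ball 0 R) := by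
    intro z hzR
    refine DifferentiableAt.differentiableWithinAt ?_
    exact ((hg.analyticAt z).deriv.differentiableAt).div (hg z) (hz z hzR)
  obtain ⟨L, hL⟩ := hld.isExactOn_ball
  have hmem0 : (0 : ℂ) ∈ ball (0 : ℂ) R := mem_ball_self hR
  have hexp : ∀ z ∈ ball (0 : ℂ) R, g z = Complex.exp (L z - L 0) := by
    intro z hzR
    have hd : ∀ w ∈ ball (0 : ℂ) R,
        HasDerivWithinAt (fun w => g w * Complex.exp (-(L w))) 0 (ball (0 : ℂ) R) w := by
      intro w hw
      have h1 := (hg w).hasDerivAt.mul ((hL w hw).neg.cexp)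
      refine HasDerivAt.hasDerivWithinAt (h1.congr_deriv ?_)
      rw [logDeriv_apply]
      have := hz w hw
      field_simp
      simp
    have hc := (convex_ball (0 : ℂ) R).is_const_of_fderivWithin_eq_zero (𝕜 := ℂ)
      (f := fun w => g w * Complex.exp (-(L w)))
      (fun w hw => (hd w hw).differentiableWithinAt)
      (fun w hw => by
        ext
        have h2 := (hd w hw).derivWithin (isOpen_ball.uniqueDiffWithinAt hw)
        exact h2) hzR hmem0
    simp only [h0, one_mul] at hc
    rw [sub_eq_add_neg, Complex.exp_add, ← hc]
    rw [mul_left_comm, ← Complex.exp_add, add_neg_cancel, Complex.exp_zero, mul_one]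
  set K : ℂ → ℂ := fun z => L z - L 0 with hK
  have hKd : ∀ z ∈ ball (0 : ℂ) R, HasDerivAt K (logDeriv g z) z := fun z hzR =>
    (hL z hzR).sub_const _
  have hKbd : ∀ z, ‖z‖ ≤ R / 2 → ‖K z‖ ≤ 2 * B := by
    intro z hzR
    have h1 := Complex.borelCaratheodory_zero (f := K) (M := B) (R := R) (z := z) hB0
      (fun w hw => (hKd w hw).differentiableAt.differentiableWithinAt)
      (fun w hw => by
        have h2 := hB w hw
        rw [hexp w hw, Complex.norm_exp, Real.exp_le_exp] at h2
        exact h2) hR (by rw [mem_ball_zero_iff]; linarith) (by simp [hK])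
    refine h1.trans ?_
    rw [div_le_iff₀ (by linarith)]
    nlinarith
  have hld1 : ∀ z, ‖z‖ ≤ R / 4 → ‖logDeriv g z‖ ≤ 8 * B / R := by
    intro z hzR
    have hsub : ∀ w, dist w z ≤ R / 4 → ‖w‖ ≤ R / 2 := by
      intro w hw
      rw [dist_eq_norm] at hw
      have := norm_add_le (w - z) z
      rw [sub_add_cancel] at this
      linarith
    have h1 := Complex.norm_deriv_le_of_forall_mem_sphere_norm_le (f := K) (c := z) (R := R / 4)
      (C := 2 * B) (by positivity)
      (DifferentiableOn.diffContOnCl fun w hw => by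
        rw [closure_ball _ (by positivity), mem_closedBall] at hw
        refine (hKd w ?_).differentiableAt.differentiableWithinAt
        rw [mem_ball_zero_iff]
        linarith [hsub w hw])
      (fun w hw => hKbd w (hsub w (mem_sphere.1 hw).le))
    rw [(hKd z (by rw [mem_ball_zero_iff]; linarith)).deriv] at h1
    refine h1.trans (le_of_eq ?_)
    field_simp
    norm_num
  have hld2 : ∀ z ∈ closedBall (0 : ℂ) (R / 8), ‖deriv (logDeriv g) z‖ ≤ 64 * B / R ^ 2 := by
    intro z hzR
    rw [mem_closedBall_zero_iff] at hzR
    have hsub : ∀ w, dist w z ≤ R / 8 → ‖w‖ ≤ R / 4 := by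
      intro w hw
      rw [dist_eq_norm] at hw
      have := norm_add_le (w - z) z
      rw [sub_add_cancel] at this
      linarith
    have h1 := Complex.norm_deriv_le_of_forall_mem_sphere_norm_le (f := logDeriv g) (c := z)
      (R := R / 8) (C := 8 * B / R) (by positivity)
      (DifferentiableOn.diffContOnCl fun w hw => by
        rw [closure_ball _ (by positivity), mem_closedBall] at hw
        refine (hld.differentiableAt (isOpen_ball.mem_nhds ?_)).differentiableWithinAt
        rw [mem_ball_zero_iff]
        linarith [hsub w hw])
      (fun w hw => hld1 w (hsub w (mem_sphere.1 hw).le))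
    refine h1.trans (le_of_eq ?_)
    field_simp
    norm_num
  have := (convex_closedBall (0 : ℂ) (R / 8)).norm_image_sub_le_of_norm_deriv_le
    (f := logDeriv g) (x := 0) (y := s) (C := 64 * B / R ^ 2)
    (fun w hw => hld.differentiableAt (isOpen_ball.mem_nhds (by
      rw [mem_closedBall_zero_iff] at hw
      rw [mem_ball_zero_iff]
      linarith))) hld2 (mem_closedBall_self (by positivity)) (by simpa using hs)
  simpa using this

/-- An entire function of growth order at most `3/2`. -/
def GrowthThreeHalves (f : ℂ → ℂ) (C : ℝ) : Prop :=
  ∀ z, ‖f z‖ ≤ Real.exp (C * (1 + ‖z‖) ^ (3 / 2 : ℝ))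

lemma analyticOrderAt_ne_top_of_entire {f : ℂ → ℂ} (hf : Differentiable ℂ f) (h0 : f 0 = 1)
    (ρ : ℂ) : analyticOrderAt f ρ ≠ ⊤ := by
  intro h
  rw [analyticOrderAt_eq_top] at h
  have h2 : f = 0 :=
    AnalyticOnNhd.eq_of_eventuallyEq (fun z _ => hf.analyticAt z) (fun z _ => analyticAt_const) h
  simp [h2] at h0

lemma order_pos_iff {f : ℂ → ℂ} (hf : Differentiable ℂ f) (h0 : f 0 = 1) (ρ : ℂ) :
    analyticOrderNatAt f ρ ≠ 0 ↔ f ρ = 0 := by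
  have h1 := analyticOrderAt_ne_top_of_entire hf h0 ρ
  rw [← (hf.analyticAt ρ).analyticOrderAt_ne_zero, ← Nat.cast_analyticOrderNatAt h1]
  simp

lemma sum_order_le_growth {f : ℂ → ℂ} (hf : Differentiable ℂ f) (h0 : f 0 = 1) {C : ℝ}
    (hC : GrowthThreeHalves f C) (Z : Finset ℂ) {R : ℝ} (hR : 0 < R) (hZ : ∀ ρ ∈ Z, ‖ρ‖ ≤ R) :
    (∑ ρ ∈ Z, (analyticOrderNatAt f ρ : ℝ)) ≤ C * (1 + 4 * R) ^ (3 / 2 : ℝ) := by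
  classical
  have hz : analyticOrderNatAt f 0 = 0 := by
    by_contra h
    rw [← ne_eq, order_pos_iff hf h0, h0] at h
    exact one_ne_zero h
  have h1 : (∑ ρ ∈ Z, (analyticOrderNatAt f ρ : ℝ))
      = ∑ ρ ∈ Z.erase 0, (analyticOrderNatAt f ρ : ℝ) := by
    rw [Finset.sum_erase]
    simp [hz]
  rw [h1]
  refine sum_order_le hf h0 _ hR (fun ρ hρ => ?_) fun z hzz => ?_
  · exact ⟨(mem_erase.1 hρ).1, hZ ρ (mem_erase.1 hρ).2⟩
  · have := hC z
    rwa [hzz] at this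

lemma finite_zeros_closedBall {f : ℂ → ℂ} (hf : Differentiable ℂ f) (h0 : f 0 = 1) {C : ℝ}
    (hC : GrowthThreeHalves f C) (R : ℝ) : {ρ : ℂ | f ρ = 0 ∧ ‖ρ‖ ≤ R}.Finite := by
  by_contra hinf
  obtain ⟨N, hN⟩ := exists_nat_gt (C * (1 + 4 * (|R| + 1)) ^ (3 / 2 : ℝ))
  obtain ⟨Z, hZ, hcard⟩ := Set.Infinite.exists_subset_card_eq hinf N
  have h1 := sum_order_le_growth hf h0 hC Z (R := |R| + 1) (by positivity) fun ρ hρ => by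
    have := (hZ hρ).2
    linarith [le_abs_self R]
  have h2 : (N : ℝ) ≤ ∑ ρ ∈ Z, (analyticOrderNatAt f ρ : ℝ) := by
    rw [← hcard, Finset.card_eq_sum_ones]
    push_cast
    refine Finset.sum_le_sum fun ρ hρ => ?_
    have := (order_pos_iff hf h0 ρ).2 (hZ hρ).1
    exact_mod_cast Nat.one_le_iff_ne_zero.2 this
  linarith

lemma summable_order_div {f : ℂ → ℂ} (hf : Differentiable ℂ f) (h0 : f 0 = 1) {C : ℝ}
    (hC : GrowthThreeHalves f C) :
    Summable fun ρ : ℂ => (analyticOrderNatAt f ρ : ℝ) / (1 + ‖ρ‖ ^ 2) := by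
  classical
  have hC0 : 0 ≤ C := by
    have := hC 0
    simp only [h0, norm_one, norm_zero, add_zero, Real.one_rpow, mul_one] at this
    exact Real.exp_le_exp.1 (by simpa using this)
  have hgeo : Summable fun k : ℕ => 4 * C * 5 ^ (3 / 2 : ℝ) * ((2 : ℝ) ^ (-(1 / 2) : ℝ)) ^ k := by
    refine Summable.mul_left _ (summable_geometric_of_lt_one (by positivity) ?_)
    exact Real.rpow_lt_one_of_one_lt_of_neg (by norm_num) (by norm_num)
  refine summable_of_sum_le (c := ∑' k : ℕ, 4 * C * 5 ^ (3 / 2 : ℝ) * ((2 : ℝ) ^ (-(1 / 2) : ℝ)) ^ k)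
    (fun ρ => by positivity) fun Z => ?_
  have hK : ∀ ρ : ℂ, ∃ k : ℕ, ‖ρ‖ ≤ 2 ^ k ∧ 1 / (1 + ‖ρ‖ ^ 2) ≤ 4 * (1 / 4) ^ k := by
    intro ρ
    have hex : ∃ k : ℕ, ‖ρ‖ ≤ 2 ^ k := by
      obtain ⟨k, hk⟩ := pow_unbounded_of_one_lt ‖ρ‖ (one_lt_two (α := ℝ))
      exact ⟨k, hk.le⟩
    refine ⟨Nat.find hex, Nat.find_spec hex, ?_⟩
    rcases hk : Nat.find hex with _ | j
    · rw [div_le_iff₀ (by positivity)]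
      simp
      nlinarith [sq_nonneg ‖ρ‖]
    · have hj : ¬ ‖ρ‖ ≤ 2 ^ j := Nat.find_min hex (by omega)
      push Not at hj
      have h4 : (4 : ℝ) ^ j ≤ ‖ρ‖ ^ 2 := by
        have : (4 : ℝ) ^ j = (2 ^ j) ^ 2 := by
          rw [← pow_mul, mul_comm, pow_mul]; norm_num
        rw [this]
        gcongr
      have h5 : (4 : ℝ) * (1 / 4) ^ (j + 1) = 1 / 4 ^ j := by
        rw [pow_succ, one_div_pow]; field_simp
      rw [h5]
      exact one_div_le_one_div_of_le (by positivity) (by linarith)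
  choose k hk1 hk2 using hK
  have hcount : ∀ j : ℕ, ∑ ρ ∈ Z with k ρ = j, (analyticOrderNatAt f ρ : ℝ)
      ≤ C * (1 + 4 * 2 ^ j) ^ (3 / 2 : ℝ) := fun j =>
    sum_order_le_growth hf h0 hC _ (by positivity) fun ρ hρ => by
      rw [← (mem_filter.1 hρ).2]; exact hk1 ρ
  calc ∑ ρ ∈ Z, (analyticOrderNatAt f ρ : ℝ) / (1 + ‖ρ‖ ^ 2)
      = ∑ j ∈ Z.image k, ∑ ρ ∈ Z with k ρ = j, (analyticOrderNatAt f ρ : ℝ) / (1 + ‖ρ‖ ^ 2) :=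
        (Finset.sum_fiberwise_of_maps_to (fun ρ hρ => mem_image_of_mem k hρ) _).symm
    _ ≤ ∑ j ∈ Z.image k, 4 * C * 5 ^ (3 / 2 : ℝ) * ((2 : ℝ) ^ (-(1 / 2) : ℝ)) ^ j := by
        refine Finset.sum_le_sum fun j _ => ?_
        calc ∑ ρ ∈ Z with k ρ = j, (analyticOrderNatAt f ρ : ℝ) / (1 + ‖ρ‖ ^ 2)
            ≤ ∑ ρ ∈ Z with k ρ = j, (analyticOrderNatAt f ρ : ℝ) * (4 * (1 / 4) ^ j) := by
              refine Finset.sum_le_sum fun ρ hρ => ?_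
              rw [div_eq_mul_one_div, ← (mem_filter.1 hρ).2]
              exact mul_le_mul_of_nonneg_left (hk2 ρ) (by positivity)
          _ = (∑ ρ ∈ Z with k ρ = j, (analyticOrderNatAt f ρ : ℝ)) * (4 * (1 / 4) ^ j) := by
              rw [Finset.sum_mul]
          _ ≤ C * (5 * 2 ^ j) ^ (3 / 2 : ℝ) * (4 * (1 / 4) ^ j) := by
              refine mul_le_mul_of_nonneg_right ((hcount j).trans ?_) (by positivity)
              have : (1 : ℝ) ≤ 2 ^ j := one_le_pow₀ (by norm_num)
              gcongr
              linarith
          _ = _ := by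
              rw [Real.mul_rpow (by norm_num) (by positivity), ← Real.rpow_natCast 2 j,
                ← Real.rpow_mul (by norm_num), ← Real.rpow_natCast (1 / 4) j,
                ← Real.rpow_natCast (2 ^ (-(1 / 2) : ℝ)) j, ← Real.rpow_mul (by norm_num)]
              have : (1 / 4 : ℝ) = 2 ^ (-2 : ℝ) := by
                rw [Real.rpow_neg (by norm_num)]; norm_num
              rw [this, ← Real.rpow_mul (by norm_num)]
              have h3 : (2 : ℝ) ^ (-(1 / 2) * (j : ℝ))
                  = 2 ^ ((j : ℝ) * (3 / 2)) * 2 ^ (-2 * (j : ℝ)) := by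
                rw [← Real.rpow_add (by norm_num)]; congr 1; ring
              rw [h3]; ring
    _ ≤ _ := hgeo.sum_le_tsum _ fun _ _ => by positivity

/-- Partial fraction expansion of the logarithmic derivative (Hadamard). -/
theorem hasSum_logDeriv {f : ℂ → ℂ} (hf : Differentiable ℂ f) (h0 : f 0 = 1) {C : ℝ}
    (hC : GrowthThreeHalves f C) {s : ℂ} (hs : f s ≠ 0) :
    HasSum (fun ρ : ℂ => (analyticOrderNatAt f ρ : ℂ) * (1 / (s - ρ) + 1 / ρ))
      (logDeriv f s - logDeriv f 0) := by
  classical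
  set m : ℂ → ℕ := fun ρ => analyticOrderNatAt f ρ with hm
  have hmz : ∀ ρ, f ρ ≠ 0 → m ρ = 0 := fun ρ h => by
    by_contra h1
    exact h ((order_pos_iff hf h0 ρ).1 h1)
  have hC0 : 0 ≤ C := by
    have := hC 0
    simp only [h0, norm_one, norm_zero, add_zero, Real.one_rpow, mul_one] at this
    exact Real.exp_le_exp.1 (by simpa using this)
  set a : ℂ → ℂ := fun ρ => (m ρ : ℂ) * (1 / (s - ρ) + 1 / ρ) with ha
  have hsum : Summable a := by
    refine Summable.of_norm_bounded_eventually
      (g := fun ρ : ℂ => (4 * ‖s‖) * ((m ρ : ℝ) / (1 + ‖ρ‖ ^ 2)))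
      ((summable_order_div hf h0 hC).mul_left _) ?_
    have hfin := finite_zeros_closedBall hf h0 hC (2 * ‖s‖ + 1)
    filter_upwards [hfin.compl_mem_cofinite] with ρ hρ
    by_cases hz : f ρ = 0
    · have h1 : 2 * ‖s‖ + 1 < ‖ρ‖ := by
        by_contra h; exact hρ ⟨hz, not_lt.1 h⟩
      have hρ0 : ρ ≠ 0 := by
        intro h; rw [h, norm_zero] at h1; linarith [norm_nonneg s]
      have h2 : ‖ρ‖ / 2 ≤ ‖s - ρ‖ := by
        have := norm_sub_norm_le ρ s
        rw [norm_sub_rev] at this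
        linarith
      have hsρ : s - ρ ≠ 0 := by
        intro h; rw [h, norm_zero] at h2; linarith [norm_nonneg s]
      have h3 : 1 / (s - ρ) + 1 / ρ = s / (ρ * (s - ρ)) := by field_simp; ring
      simp only [ha, h3, norm_mul, norm_div, RCLike.norm_natCast]
      rw [mul_comm (4 * ‖s‖), div_mul_eq_mul_div, mul_div_assoc]
      gcongr ?_ * ?_
      rw [div_le_div_iff₀ (by positivity) (by positivity)]
      have hn := norm_nonneg s
      have h4 : (1 + ‖ρ‖ ^ 2) ≤ 4 * (‖ρ‖ * ‖s - ρ‖) := by nlinarith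
      nlinarith
    · simp [ha, hmz ρ hz]
  have hfin : ∀ R : ℝ, {ρ : ℂ | f ρ = 0 ∧ ‖ρ‖ ≤ R}.Finite := finite_zeros_closedBall hf h0 hC
  set Z : ℕ → Finset ℂ := fun k => (hfin k).toFinset with hZ
  have hZm : ∀ k ρ, ρ ∈ Z k ↔ f ρ = 0 ∧ ‖ρ‖ ≤ k := fun k ρ => by simp [hZ]
  have hlim1 : Tendsto (fun k => ∑ ρ ∈ Z k, a ρ) atTop (nhds (∑' ρ, a ρ)) := by
    have : ∀ k, ∑ ρ ∈ Z k, a ρ = ∑' ρ, (Z k : Set ℂ).indicator a ρ := fun k => by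
      rw [tsum_eq_sum (s := Z k)]
      · exact Finset.sum_congr rfl fun ρ hρ => by simp [hρ]
      · intro ρ hρ; simp [hρ]
    simp_rw [this]
    refine tendsto_tsum_of_dominated_convergence (bound := fun ρ => ‖a ρ‖) hsum.norm ?_ ?_
    · intro ρ
      obtain ⟨N, hN⟩ := exists_nat_ge ‖ρ‖
      refine tendsto_const_nhds.congr' ?_
      filter_upwards [eventually_ge_atTop N] with k hk
      by_cases hz : f ρ = 0
      · rw [Set.indicator_of_mem]
        simp only [Finset.mem_coe, hZm]
        exact ⟨hz, hN.trans (by exact_mod_cast hk)⟩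
      · have : a ρ = 0 := by simp [ha, hmz ρ hz]
        by_cases h : ρ ∈ (Z k : Set ℂ)
        · rw [Set.indicator_of_mem h]
        · rw [Set.indicator_of_notMem h, this]
    · exact Eventually.of_forall fun k ρ => norm_indicator_le_norm_self _ _
  have hlim2 : Tendsto (fun k => ∑ ρ ∈ Z k, a ρ) atTop
      (nhds (logDeriv f s - logDeriv f 0)) := by
    rw [tendsto_iff_norm_sub_tendsto_zero]
    have hbound : ∀ᶠ k : ℕ in atTop, ‖∑ ρ ∈ Z k, a ρ - (logDeriv f s - logDeriv f 0)‖
        ≤ 64 * ((C + 1) * (4 * k) ^ (3 / 2 : ℝ)) / (k : ℝ) ^ 2 * ‖s‖ := by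
      obtain ⟨N, hN⟩ := exists_nat_ge (8 * ‖s‖)
      filter_upwards [eventually_ge_atTop N, eventually_ge_atTop 1] with k hkN hk1
      have hk1' : (1 : ℝ) ≤ k := by exact_mod_cast hk1
      have hkN' : 8 * ‖s‖ ≤ k := hN.trans (by exact_mod_cast hkN)
      have hZ0 : ∀ ρ ∈ Z k, ρ ≠ 0 := fun ρ hρ h => by
        rw [hZm, h, h0] at hρ; exact one_ne_zero hρ.1
      obtain ⟨g, hg, hfg, hgZ⟩ := exists_entire_quotient hf (by simp [h0]) (Z k) hZ0
      have hg0 : g 0 = 1 := by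
        have := hfg 0
        simpa [h0] using this.symm
      have hgne : ∀ z ∈ ball (0 : ℂ) k, g z ≠ 0 := by
        intro z hz hgz
        have : z ∈ Z k := (hZm k z).2 ⟨by rw [hfg, hgz, mul_zero], (mem_ball_zero_iff.1 hz).le⟩
        exact hgZ z this hgz
      have hk0 : (0 : ℝ) < k := by linarith
      have hgb : ∀ z ∈ ball (0 : ℂ) k, ‖g z‖ ≤ Real.exp ((C + 1) * (4 * k) ^ (3 / 2 : ℝ)) := by
        intro z hz
        refine Complex.norm_le_of_forall_mem_frontier_norm_le (U := ball (0 : ℂ) (2 * k))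
          isBounded_ball hg.diffContOnCl (fun w hw => ?_)
          (subset_closure (ball_subset_ball (by linarith) hz))
        rw [frontier_ball _ (by positivity), mem_sphere_zero_iff_norm] at hw
        have h1 := hC w
        rw [hfg w, norm_mul, norm_prod] at h1
        have h2 : (1 : ℝ) ≤ ∏ ρ ∈ Z k, ‖(1 - w / ρ) ^ analyticOrderNatAt f ρ‖ := by
          rw [← Finset.prod_const_one (s := Z k) (M := ℝ)]
          refine Finset.prod_le_prod (fun _ _ => zero_le_one) fun ρ hρ => ?_
          rw [norm_pow]
          refine one_le_pow₀ ?_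
          have h3 : 2 ≤ ‖w / ρ‖ := by
            rw [norm_div, hw, le_div_iff₀ (norm_pos_iff.2 (hZ0 ρ hρ))]
            nlinarith [((hZm k ρ).1 hρ).2]
          have h4 := norm_sub_norm_le (w / ρ) 1
          rw [norm_one, norm_sub_rev] at h4
          linarith
        calc ‖g w‖ ≤ (∏ ρ ∈ Z k, ‖(1 - w / ρ) ^ analyticOrderNatAt f ρ‖) * ‖g w‖ :=
              le_mul_of_one_le_left (norm_nonneg _) h2
          _ ≤ _ := h1
          _ ≤ _ := by
            rw [Real.exp_le_exp, hw]
            gcongr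
            · linarith
            · linarith
      have hsk : s ∈ ball (0 : ℂ) k := by
        rw [mem_ball_zero_iff]; linarith [norm_nonneg s]
      have h5 := logDeriv_sub_le hg hg0 hk0 (by positivity) hgne hgb (s := s) (by linarith)
      have hld : ∀ z ∈ ball (0 : ℂ) k, f z ≠ 0 →
          logDeriv f z = ∑ ρ ∈ Z k, (m ρ : ℂ) * (1 / (z - ρ)) + logDeriv g z := by
        intro z hz hfz
        have hP : ∀ ρ ∈ Z k, (1 - z / ρ) ^ analyticOrderNatAt f ρ ≠ 0 := by
          have := hfz
          rw [hfg z] at this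
          exact Finset.prod_ne_zero_iff.1 (left_ne_zero_of_mul this)
        have h6 : logDeriv f z = logDeriv (fun z => (∏ ρ ∈ Z k,
            (1 - z / ρ) ^ analyticOrderNatAt f ρ) * g z) z := by
          congr 1; ext w; exact hfg w
        rw [h6, logDeriv_mul (f := fun z => ∏ ρ ∈ Z k, (1 - z / ρ) ^ analyticOrderNatAt f ρ) z
          (Finset.prod_ne_zero_iff.2 hP) (hgne z hz) (by fun_prop) (hg z),
          logDeriv_prod (f := fun ρ z => (1 - z / ρ) ^ analyticOrderNatAt f ρ) hP
            (fun ρ _ => by fun_prop)]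
        congr 1
        refine Finset.sum_congr rfl fun ρ hρ => ?_
        have hρ0 := hZ0 ρ hρ
        have hzρ : z - ρ ≠ 0 := by
          intro h
          rw [sub_eq_zero] at h
          exact hfz (h ▸ ((hZm k ρ).1 hρ).1)
        have hd : HasDerivAt (fun z : ℂ => 1 - z / ρ) (-(1 / ρ)) z := by
          simpa using ((hasDerivAt_id z).div_const ρ).const_sub 1
        rw [logDeriv_fun_pow hd.differentiableAt, logDeriv_apply, hd.deriv]
        have : 1 - z / ρ = -((z - ρ) / ρ) := by field_simp; ring
        rw [this]
        congr 1
        field_simp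
      have h7 := hld s hsk hs
      have h8 := hld 0 (mem_ball_self hk0) (by simp [h0])
      have h9 : ∑ ρ ∈ Z k, a ρ - (logDeriv f s - logDeriv f 0)
          = -(logDeriv g s - logDeriv g 0) := by
        rw [h7, h8]
        simp only [ha, mul_add, Finset.sum_add_distrib]
        have : ∑ ρ ∈ Z k, (m ρ : ℂ) * (1 / (0 - ρ)) = -∑ ρ ∈ Z k, (m ρ : ℂ) * (1 / ρ) := by
          rw [← Finset.sum_neg_distrib]
          refine Finset.sum_congr rfl fun ρ _ => ?_
          rw [zero_sub, div_neg]; ring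
        rw [this]; ring
      rw [h9, norm_neg]
      exact h5
    refine squeeze_zero' (Eventually.of_forall fun _ => norm_nonneg _) hbound ?_
    have h10 : Tendsto (fun k : ℕ => (k : ℝ) ^ (-(1 / 2) : ℝ)) atTop (nhds 0) :=
      (tendsto_rpow_neg_atTop (by norm_num : (0 : ℝ) < 1 / 2)).comp tendsto_natCast_atTop_atTop
    have h11 := h10.const_mul (64 * ((C + 1) * 4 ^ (3 / 2 : ℝ)) * ‖s‖)
    rw [mul_zero] at h11
    refine h11.congr' ?_
    filter_upwards [eventually_gt_atTop 0] with k hk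
    have hk0 : (0 : ℝ) < k := by exact_mod_cast hk
    have : (k : ℝ) ^ (-(1 / 2) : ℝ) = (k : ℝ) ^ (3 / 2 : ℝ) / (k : ℝ) ^ 2 := by
      rw [← Real.rpow_natCast, ← Real.rpow_sub hk0]; norm_num
    rw [this, Real.mul_rpow (by norm_num) hk0.le]
    ring
  rw [← tendsto_nhds_unique hlim1 hlim2]
  exact hsum.hasSum

end Hadamard

section Xi

open Complex

/-- The entire function `s (s - 1) Λ(s)`, where `Λ` is the completed zeta function. -/
noncomputable def xiFun (s : ℂ) : ℂ := 1 - s * (1 - s) * completedRiemannZeta₀ s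

lemma differentiable_xiFun : Differentiable ℂ xiFun := by
  have := differentiable_completedZeta₀
  unfold xiFun
  fun_prop

lemma xiFun_zero : xiFun 0 = 1 := by simp [xiFun]

lemma xiFun_one : xiFun 1 = 1 := by simp [xiFun]

lemma xiFun_one_sub (s : ℂ) : xiFun (1 - s) = xiFun s := by
  simp only [xiFun, completedRiemannZeta₀_one_sub]
  ring

lemma xiFun_eq {s : ℂ} (hs : s ≠ 0) (hs1 : s ≠ 1) :
    xiFun s = s * (s - 1) * completedRiemannZeta s := by
  have : 1 - s ≠ 0 := sub_ne_zero.2 hs1.symm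
  rw [completedRiemannZeta_eq, xiFun]
  field_simp
  ring

lemma norm_Gamma_le {s : ℂ} (hs : 0 < s.re) : ‖Complex.Gamma s‖ ≤ Real.Gamma s.re := by
  rw [Complex.Gamma_eq_integral hs, Complex.GammaIntegral, Real.Gamma_eq_integral hs]
  refine (MeasureTheory.norm_integral_le_integral_norm _).trans (le_of_eq ?_)
  refine MeasureTheory.setIntegral_congr_fun measurableSet_Ioi fun x hx => ?_
  simp only [norm_mul]
  rw [Complex.norm_cpow_eq_rpow_re_of_pos hx]
  rw [Complex.norm_real, Real.norm_of_nonneg (Real.exp_pos _).le]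
  simp

lemma Gamma_le_exp {x : ℝ} (hx : 1 ≤ x) : Real.Gamma x ≤ Real.exp (2 * (x + 1) ^ (3 / 2 : ℝ)) := by
  have hx0 : 0 < x := by linarith
  set N := ⌈x⌉₊ with hN
  have hNx : x ≤ N := Nat.le_ceil x
  have hNx1 : (N : ℝ) ≤ x + 1 := (Nat.ceil_lt_add_one hx0.le).le
  have hN1 : (1 : ℝ) ≤ N := hx.trans hNx
  have h1 : Real.Gamma x ≤ Real.Gamma (x + 1) := by
    rw [Real.Gamma_add_one hx0.ne']
    exact le_mul_of_one_le_left (Real.Gamma_pos_of_pos hx0).le hx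
  have h2 : Real.Gamma (x + 1) ≤ Real.Gamma (N + 1) :=
    Real.Gamma_strictMonoOn_Ici.monotoneOn (by simp; linarith) (by simp; linarith) (by linarith)
  have h3 : Real.Gamma (N + 1) ≤ (N : ℝ) ^ N := by
    rw [Real.Gamma_nat_eq_factorial]
    exact_mod_cast Nat.factorial_le_pow N
  have h4 : (N : ℝ) ^ N ≤ Real.exp (2 * (N : ℝ) ^ (3 / 2 : ℝ)) := by
    rw [← Real.exp_log (show (0 : ℝ) < N by linarith), ← Real.exp_nat_mul,
      Real.exp_log (by linarith), Real.exp_le_exp]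
    have h5 : Real.log N ≤ 2 * (N : ℝ) ^ (1 / 2 : ℝ) := by
      have := Real.log_le_rpow_div (x := N) (by linarith) (show (0 : ℝ) < 1 / 2 by norm_num)
      linarith
    have h6 : (N : ℝ) ^ (3 / 2 : ℝ) = N * (N : ℝ) ^ (1 / 2 : ℝ) := by
      rw [← Real.rpow_one_add' (by linarith) (by norm_num)]; norm_num
    rw [h6]
    nlinarith
  refine h1.trans (h2.trans (h3.trans (h4.trans ?_)))
  gcongr

lemma exists_norm_zeta_le : ∃ Z : ℝ, 0 ≤ Z ∧ ∀ s : ℂ, 2 ≤ s.re → ‖riemannZeta s‖ ≤ Z := by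
  have hs2 : Summable fun n : ℕ => 1 / ((n : ℝ) + 1) ^ 2 := by
    have := (summable_nat_add_iff (f := fun n : ℕ => 1 / (n : ℝ) ^ 2) 1).2
      (Real.summable_one_div_nat_pow.2 one_lt_two)
    simpa using this
  refine ⟨∑' n : ℕ, 1 / ((n : ℝ) + 1) ^ 2, tsum_nonneg fun _ => by positivity, fun s hs => ?_⟩
  rw [zeta_eq_tsum_one_div_nat_add_one_cpow (by linarith)]
  refine tsum_of_norm_bounded hs2.hasSum fun n => ?_
  have hn : (0 : ℝ) < (n : ℝ) + 1 := by positivity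
  have h1 : ‖((n : ℂ) + 1) ^ s‖ = ((n : ℝ) + 1) ^ s.re := by
    rw [← Complex.norm_cpow_eq_rpow_re_of_pos hn]; push_cast; rfl
  rw [norm_div, norm_one, h1]
  refine one_div_le_one_div_of_le (by positivity) ?_
  rw [← Real.rpow_natCast]
  exact Real.rpow_le_rpow_of_exponent_le (by linarith) (by exact_mod_cast hs)

lemma exists_norm_completedZeta₀_le :
    ∃ K : ℝ, 0 ≤ K ∧ ∀ s : ℂ, 1 / 2 ≤ s.re → s.re ≤ 2 → ‖completedRiemannZeta₀ s‖ ≤ K := by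
  set P := HurwitzZeta.hurwitzEvenFEPair 0
  have hconv : ∀ s : ℂ, MellinConvergent P.f_modif s := fun s =>
    (P.isStrongFEPair_toStrongFEPair.hasMellin s).1
  have hInt : ∀ s : ℂ, MeasureTheory.IntegrableOn
      (fun t : ℝ => t ^ (s.re - 1) * ‖P.f_modif t‖) (Set.Ioi 0) := fun s => by
    refine (MeasureTheory.IntegrableOn.congr_fun (hconv s).norm ?_ measurableSet_Ioi)
    intro t ht
    simp only [norm_smul]
    rw [Complex.norm_cpow_eq_rpow_re_of_pos ht]
    simp
  have hi := (hInt (1 / 4 : ℝ)).add (hInt (1 : ℝ))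
  refine ⟨∫ t in Set.Ioi (0 : ℝ), (t ^ (((1 / 4 : ℝ) : ℂ).re - 1) * ‖P.f_modif t‖
    + t ^ (((1 : ℝ) : ℂ).re - 1) * ‖P.f_modif t‖), ?_, fun s hs1 hs2 => ?_⟩
  · refine MeasureTheory.setIntegral_nonneg measurableSet_Ioi fun t ht => ?_
    have : (0 : ℝ) < t := ht
    positivity
  have hdef : completedRiemannZeta₀ s = mellin P.f_modif (s / 2) / 2 := rfl
  rw [hdef, norm_div, mellin]
  have h1 : ‖∫ t in Set.Ioi (0 : ℝ), (t : ℂ) ^ (s / 2 - 1) • P.f_modif t‖ ≤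
      ∫ t in Set.Ioi (0 : ℝ), (t ^ (((1 / 4 : ℝ) : ℂ).re - 1) * ‖P.f_modif t‖
    + t ^ (((1 : ℝ) : ℂ).re - 1) * ‖P.f_modif t‖) := by
    refine MeasureTheory.norm_integral_le_of_norm_le hi ?_
    refine (MeasureTheory.ae_restrict_iff' measurableSet_Ioi).2 (Eventually.of_forall fun t ht => ?_)
    have ht0 : (0 : ℝ) < t := ht
    rw [norm_smul, Complex.norm_cpow_eq_rpow_re_of_pos ht]
    have hre : (s / 2 - 1).re = s.re / 2 - 1 := by simp
    rw [hre]
    simp only [Complex.ofReal_re]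
    rw [← add_mul]
    refine mul_le_mul_of_nonneg_right ?_ (norm_nonneg _)
    rcases le_total t 1 with h | h
    · have := Real.rpow_le_rpow_of_exponent_ge ht0 h (show (1 / 4 : ℝ) - 1 ≤ s.re / 2 - 1 by linarith)
      have h0 : 0 ≤ t ^ ((1 : ℝ) - 1) := by positivity
      exact this.trans (le_add_of_nonneg_right h0)
    · have := Real.rpow_le_rpow_of_exponent_le h (show s.re / 2 - 1 ≤ (1 : ℝ) - 1 by linarith)
      have h0 : 0 ≤ t ^ ((1 / 4 : ℝ) - 1) := by positivity
      exact this.trans (le_add_of_nonneg_left h0)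
  have h2 := norm_nonneg (∫ t in Set.Ioi (0 : ℝ), (t : ℂ) ^ (s / 2 - 1) • P.f_modif t)
  have h3 : ‖(2 : ℂ)‖ = 2 := by simp
  rw [h3]
  linarith

lemma completedZeta_eq_Gammaℝ_mul {s : ℂ} (hs : s ≠ 0) (h : Gammaℝ s ≠ 0) :
    completedRiemannZeta s = Gammaℝ s * riemannZeta s := by
  rw [riemannZeta_def_of_ne_zero hs]
  field_simp

lemma exists_growth_xiFun : ∃ C : ℝ, GrowthThreeHalves xiFun C := by
  obtain ⟨Z, hZ0, hZ⟩ := exists_norm_zeta_le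
  obtain ⟨K, hK0, hK⟩ := exists_norm_completedZeta₀_le
  have hw2 : ∀ w : ℝ, 1 ≤ w → w ^ 2 ≤ Real.exp (2 * w ^ (3 / 2 : ℝ)) := by
    intro w hw
    have h1 : w ≤ w ^ (3 / 2 : ℝ) := by
      conv_lhs => rw [← Real.rpow_one w]
      exact Real.rpow_le_rpow_of_exponent_le hw (by norm_num)
    have h2 : w ≤ Real.exp (w ^ (3 / 2 : ℝ)) := by
      have := Real.add_one_le_exp (w ^ (3 / 2 : ℝ))
      linarith
    calc w ^ 2 ≤ Real.exp (w ^ (3 / 2 : ℝ)) ^ 2 := by gcongr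
      _ = _ := by rw [← Real.exp_nat_mul]; norm_cast
  set D := 1 + K + Z with hD
  have hright : ∀ s : ℂ, 1 / 2 ≤ s.re →
      ‖xiFun s‖ ≤ Real.exp ((D + 4) * (1 + ‖s‖) ^ (3 / 2 : ℝ)) := by
    intro s hs
    set w := 1 + ‖s‖ with hw
    have hw1 : 1 ≤ w := by linarith [norm_nonneg s]
    have hw32 : 1 ≤ w ^ (3 / 2 : ℝ) := Real.one_le_rpow hw1 (by norm_num)
    have hsw : ‖s‖ ≤ w := by linarith
    have hsw1 : ‖1 - s‖ ≤ w := by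
      have := norm_sub_le (1 : ℂ) s
      rw [norm_one] at this
      exact this
    have hmain : ‖xiFun s‖ ≤ D * w ^ 2 * Real.exp (2 * w ^ (3 / 2 : ℝ)) := by
      rcases le_total s.re 2 with h2 | h2
      · have h3 := hK s hs h2
        have h4 : ‖xiFun s‖ ≤ 1 + w * w * K := by
          rw [xiFun]
          refine (norm_sub_le _ _).trans ?_
          rw [norm_one, norm_mul, norm_mul]
          gcongr
        have h5 : 1 ≤ Real.exp (2 * w ^ (3 / 2 : ℝ)) := Real.one_le_exp (by positivity)
        have h6 : 1 + w * w * K ≤ D * w ^ 2 := by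
          rw [hD]; nlinarith [mul_nonneg hZ0 (sq_nonneg w)]
        calc _ ≤ _ := h4
          _ ≤ D * w ^ 2 * 1 := by linarith
          _ ≤ _ := by gcongr
      · have hs0 : s ≠ 0 := by rintro rfl; rw [Complex.zero_re] at h2; linarith
        have hs1 : s ≠ 1 := by rintro rfl; rw [Complex.one_re] at h2; linarith
        have hG : Gammaℝ s ≠ 0 := Gammaℝ_ne_zero_of_re_pos (by linarith)
        rw [xiFun_eq hs0 hs1, completedZeta_eq_Gammaℝ_mul hs0 hG, Gammaℝ_def]
        have h3 := hZ s h2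
        have hre2 : (s / 2).re = s.re / 2 := by simp
        have h4 : ‖Complex.Gamma (s / 2)‖ ≤ Real.exp (2 * w ^ (3 / 2 : ℝ)) := by
          have h5 := norm_Gamma_le (s := s / 2) (by rw [hre2]; linarith)
          have h6 := Gamma_le_exp (x := (s / 2).re) (by rw [hre2]; linarith)
          refine h5.trans (h6.trans ?_)
          rw [hre2]
          have := Complex.re_le_norm s
          gcongr
          linarith
        have h7 : ‖(Real.pi : ℂ) ^ (-s / 2)‖ ≤ 1 := by
          rw [Complex.norm_cpow_eq_rpow_re_of_pos Real.pi_pos]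
          refine Real.rpow_le_one_of_one_le_of_nonpos (by linarith [Real.pi_gt_three]) ?_
          simp
          linarith
        rw [norm_mul, norm_mul, norm_mul, norm_mul, ← norm_neg (s - 1), neg_sub]
        calc ‖s‖ * ‖1 - s‖ * (‖(Real.pi : ℂ) ^ (-s / 2)‖ * ‖Complex.Gamma (s / 2)‖ * ‖riemannZeta s‖)
            ≤ w * w * (1 * Real.exp (2 * w ^ (3 / 2 : ℝ)) * Z) := by gcongr
          _ = Z * w ^ 2 * Real.exp (2 * w ^ (3 / 2 : ℝ)) := by ring
          _ ≤ _ := by gcongr; linarith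
    have hDe : D ≤ Real.exp (D * w ^ (3 / 2 : ℝ)) := by
      have := Real.add_one_le_exp (D * w ^ (3 / 2 : ℝ))
      have hD0 : 0 ≤ D := by linarith
      nlinarith
    calc ‖xiFun s‖ ≤ _ := hmain
      _ ≤ Real.exp (D * w ^ (3 / 2 : ℝ)) * Real.exp (2 * w ^ (3 / 2 : ℝ))
          * Real.exp (2 * w ^ (3 / 2 : ℝ)) := by
        gcongr
        exact hw2 w hw1
      _ = _ := by rw [← Real.exp_add, ← Real.exp_add]; ring_nf
  refine ⟨(D + 4) * 2 ^ (3 / 2 : ℝ), fun s => ?_⟩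
  have hD0 : 0 ≤ D := by linarith
  have h2 : (D + 4) * (2 * (1 + ‖s‖)) ^ (3 / 2 : ℝ)
      = (D + 4) * 2 ^ (3 / 2 : ℝ) * (1 + ‖s‖) ^ (3 / 2 : ℝ) := by
    rw [Real.mul_rpow (by norm_num) (by positivity)]; ring
  rw [← h2]
  rcases le_total (1 / 2) s.re with h | h
  · refine (hright s h).trans ?_
    have := norm_nonneg s
    gcongr
    linarith
  · rw [← xiFun_one_sub]
    refine (hright (1 - s) (by simp; linarith)).trans ?_
    have := norm_sub_le (1 : ℂ) s
    rw [norm_one] at this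
    have := norm_nonneg s
    gcongr
    linarith

end Xi

section Digamma

open Complex Topology

lemma re_add_natCast_pos {z : ℂ} (hz : 0 < z.re) (n : ℕ) : 0 < ((n : ℂ) + z).re := by
  simp only [add_re, natCast_re]; positivity

lemma ne_neg_nat_of_re_pos {z : ℂ} (hz : 0 < z.re) (m : ℕ) : z ≠ -m := by
  rintro rfl
  simp only [neg_re, natCast_re, Left.neg_pos_iff] at hz
  exact absurd hz (not_lt.mpr m.cast_nonneg)

lemma digamma_ofReal {x : ℝ} (hx : 0 < x) :
    digamma (x : ℂ) = ((deriv (Real.log ∘ Real.Gamma) x : ℝ) : ℂ) := by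
  have hd : DifferentiableAt ℝ Real.Gamma x :=
    Real.differentiableAt_Gamma fun m => ne_of_gt (by have : (0:ℝ) ≤ m := m.cast_nonneg; linarith)
  have h1 := hd.hasDerivAt.ofReal_comp
  have h2 : HasDerivAt (fun y : ℝ => Complex.Gamma y) (deriv Complex.Gamma x) x :=
    (Complex.differentiableAt_Gamma (x : ℂ)
      (ne_neg_nat_of_re_pos (by simpa using hx))).hasDerivAt.comp_ofReal
  have h3 : (fun y : ℝ => Complex.Gamma y) = fun y : ℝ => ((Real.Gamma y : ℝ) : ℂ) := by
    funext y; exact Complex.Gamma_ofReal y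
  rw [h3] at h2
  have h4 := h2.unique h1
  rw [digamma_def, logDeriv_apply, h4, Complex.Gamma_ofReal, Function.comp_def,
    deriv.log hd (Real.Gamma_pos_of_pos hx).ne', ofReal_div]

lemma digamma_re_real_le {x : ℝ} (hx : 0 < x) : (digamma (x : ℂ)).re ≤ Real.log x := by
  have hd : DifferentiableAt ℝ (Real.log ∘ Real.Gamma) x :=
    (Real.differentiableAt_Gamma fun m => ne_of_gt (by
      have : (0:ℝ) ≤ m := m.cast_nonneg; linarith)).log (Real.Gamma_pos_of_pos hx).ne'
  rw [digamma_ofReal hx, ofReal_re]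
  refine (Real.convexOn_log_Gamma.deriv_le_slope hx (show (0:ℝ) < x + 1 by positivity)
    (by linarith) hd).trans (le_of_eq ?_)
  rw [slope_def_field, add_sub_cancel_left, div_one, Function.comp_apply, Function.comp_apply,
    Real.Gamma_add_one hx.ne', Real.log_mul hx.ne' (Real.Gamma_pos_of_pos hx).ne']
  ring

lemma log_le_digamma_re_real {x : ℝ} (hx : 0 < x) :
    Real.log x ≤ (digamma ((x + 1 : ℝ) : ℂ)).re := by
  have hx1 : (0:ℝ) < x + 1 := by positivity
  have hd : DifferentiableAt ℝ (Real.log ∘ Real.Gamma) (x + 1) :=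
    (Real.differentiableAt_Gamma fun m => ne_of_gt (by
      have : (0:ℝ) ≤ m := m.cast_nonneg; linarith)).log (Real.Gamma_pos_of_pos hx1).ne'
  rw [digamma_ofReal hx1, ofReal_re]
  refine (le_of_eq ?_).trans
    (Real.convexOn_log_Gamma.slope_le_deriv hx hx1 (by linarith) hd)
  rw [slope_def_field, add_sub_cancel_left, div_one, Function.comp_apply, Function.comp_apply,
    Real.Gamma_add_one hx.ne', Real.log_mul hx.ne' (Real.Gamma_pos_of_pos hx).ne']
  ring

lemma tendsto_log_norm_add_sub_log (z : ℂ) :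
    Tendsto (fun N : ℕ => Real.log ‖(N : ℂ) + z‖ - Real.log N) atTop (𝓝 0) := by
  have h1 : Tendsto (fun N : ℕ => ‖1 + z * ((N : ℂ))⁻¹‖) atTop (𝓝 1) := by
    have : Tendsto (fun N : ℕ => 1 + z * ((N : ℂ))⁻¹) atTop (𝓝 (1 + z * 0)) :=
      (tendsto_inv_atTop_nhds_zero_nat (𝕜 := ℂ)).const_mul z |>.const_add 1
    simpa using this.norm
  have h2 := (Real.continuousAt_log one_ne_zero).tendsto.comp h1
  rw [Real.log_one] at h2
  refine h2.congr' ?_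
  filter_upwards [eventually_gt_atTop 0, h1.eventually (lt_mem_nhds (zero_lt_one' ℝ))] with N hN h0
  have hN' : (N : ℂ) ≠ 0 := by exact_mod_cast hN.ne'
  have e : (N : ℂ) + z = N * (1 + z * ((N : ℂ))⁻¹) := by field_simp
  rw [Function.comp_apply, e, norm_mul, Real.log_mul (by simpa using hN.ne') h0.ne']
  simp

lemma digamma_add_nat {z : ℂ} (hz : 0 < z.re) (N : ℕ) :
    digamma (N + z) = digamma z + ∑ n ∈ range N, 1 / ((n : ℂ) + z) := by
  induction N with
  | zero => simp
  | succ N ih =>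
    rw [sum_range_succ, ← add_assoc, ← ih]
    have := digamma_apply_add_one ((N : ℂ) + z)
      (ne_neg_nat_of_re_pos (re_add_natCast_pos hz N))
    rw [one_div, ← this]
    congr 1
    push_cast; ring

lemma sum_digamma_terms (z : ℂ) (N : ℕ) :
    ∑ n ∈ range N, (1 / ((n : ℂ) + 1) - 1 / ((n : ℂ) + z)) =
      ((harmonic N : ℝ) : ℂ) - ∑ n ∈ range N, 1 / ((n : ℂ) + z) := by
  rw [sum_sub_distrib]
  simp [harmonic]

lemma tendsto_digamma_real {x : ℝ} (hx : 0 < x) :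
    Tendsto (fun N : ℕ => ∑ n ∈ range N, (1 / ((n : ℂ) + 1) - 1 / ((n : ℂ) + x))) atTop
      (𝓝 (digamma x + Real.eulerMascheroniConstant)) := by
  have key : ∀ N : ℕ, ∑ n ∈ range N, (1 / ((n : ℂ) + 1) - 1 / ((n : ℂ) + x)) =
      digamma x + (((harmonic N : ℝ) - Real.log N -
        ((digamma ((N + x : ℝ) : ℂ)).re - Real.log N) : ℝ) : ℂ) := by
    intro N
    rw [sum_digamma_terms]
    have h1 := digamma_add_nat (z := (x : ℂ)) (by simpa using hx) N
    have h2 : ((digamma ((N + x : ℝ) : ℂ)).re : ℂ) = digamma ((N : ℂ) + x) := by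
      have hNx : (0:ℝ) < N + x := by positivity
      conv_rhs => rw [← ofReal_natCast, ← ofReal_add, digamma_ofReal hNx]
      rw [digamma_ofReal hNx, ofReal_re]
    push_cast [h2] at *
    rw [h2, h1]
    ring
  have h0 : Tendsto (fun N : ℕ => (digamma ((N + x : ℝ) : ℂ)).re - Real.log N) atTop (𝓝 0) := by
    have hA := tendsto_log_norm_add_sub_log (x : ℂ)
    have hB := tendsto_log_norm_add_sub_log ((x - 1 : ℝ) : ℂ)
    refine tendsto_of_tendsto_of_tendsto_of_le_of_le' hB hA ?_ ?_
    · filter_upwards [eventually_gt_atTop 1] with N hN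
      have hN1 : (1:ℝ) < N := by exact_mod_cast hN
      have hp : (0:ℝ) < N + (x - 1) := by linarith
      rw [← ofReal_natCast, ← ofReal_add, Complex.norm_real, Real.norm_of_nonneg hp.le]
      have := log_le_digamma_re_real hp
      rw [show (N : ℝ) + (x - 1) + 1 = N + x by ring] at this
      linarith
    · filter_upwards with N
      have hp : (0:ℝ) < N + x := by positivity
      rw [← ofReal_natCast, ← ofReal_add, Complex.norm_real, Real.norm_of_nonneg hp.le]
      have := digamma_re_real_le hp
      linarith
  have h1 := (Real.tendsto_harmonic_sub_log.sub h0)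
  rw [sub_zero] at h1
  have h2 := (continuous_ofReal.tendsto _).comp h1
  refine (h2.const_add (digamma x)).congr fun N => ?_
  rw [key]; rfl

lemma norm_digamma_term_le {δ R : ℝ} (hδ : 0 < δ) (hδ1 : δ ≤ 1) {z : ℂ} (h1 : δ < z.re)
    (h2 : ‖z‖ < R) (n : ℕ) :
    ‖1 / ((n : ℂ) + 1) - 1 / ((n : ℂ) + z)‖ ≤ (R + 1) / δ * (1 / ((n : ℝ) + 1) ^ 2) := by
  have hn1 : (n : ℂ) + 1 ≠ 0 := by exact_mod_cast n.succ_ne_zero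
  have hnz := ne_zero_of_re_pos (re_add_natCast_pos (hδ.trans h1) n)
  have e : 1 / ((n : ℂ) + 1) - 1 / ((n : ℂ) + z) = (z - 1) / (((n : ℂ) + 1) * (n + z)) := by
    field_simp; ring
  have hlow : δ * ((n : ℝ) + 1) ≤ ‖(n : ℂ) + z‖ := by
    refine le_trans ?_ (Complex.re_le_norm _)
    rw [add_re, natCast_re]
    nlinarith [(n.cast_nonneg : (0:ℝ) ≤ n)]
  have hup : ‖z - 1‖ ≤ R + 1 := by
    refine (norm_sub_le _ _).trans ?_
    rw [norm_one]; linarith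
  have hn : ‖(n : ℂ) + 1‖ = (n : ℝ) + 1 := by
    rw [show (n : ℂ) + 1 = ((n + 1 : ℕ) : ℂ) by push_cast; rfl, Complex.norm_natCast]; push_cast; rfl
  rw [e, norm_div, norm_mul, hn]
  have hR : 0 ≤ R + 1 := (norm_nonneg _).trans hup
  have : (R + 1) / δ * (1 / ((n : ℝ) + 1) ^ 2) = (R + 1) / (((n : ℝ) + 1) * (δ * ((n : ℝ) + 1))) := by
    field_simp
  rw [this]
  gcongr

lemma summable_digamma_bound (c : ℝ) :
    Summable fun n : ℕ => c * (1 / ((n : ℝ) + 1) ^ 2) := by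
  refine Summable.mul_left _ ?_
  have := (summable_nat_add_iff 1).mpr (Real.summable_one_div_nat_pow.mpr (by norm_num : 1 < 2))
  simpa using this

lemma frequently_nhdsNE_ofReal {p : ℂ → Prop} {a : ℝ} (h : ∀ᶠ x : ℝ in 𝓝 a, p x) :
    ∃ᶠ z in 𝓝[≠] (a : ℂ), p z := by
  have ht : Tendsto (fun x : ℝ => (x : ℂ)) (𝓝[≠] a) (𝓝[≠] (a : ℂ)) := by
    refine tendsto_nhdsWithin_of_tendsto_nhds_of_eventually_within _
      ((continuous_ofReal.tendsto a).mono_left nhdsWithin_le_nhds) ?_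
    filter_upwards [self_mem_nhdsWithin] with x hx
    simpa using hx
  exact ht.frequently (h.filter_mono nhdsWithin_le_nhds).frequently

theorem hasSum_digamma {z : ℂ} (hz : 0 < z.re) :
    HasSum (fun n : ℕ => 1 / ((n : ℂ) + 1) - 1 / ((n : ℂ) + z))
      (digamma z + Real.eulerMascheroniConstant) := by
  set δ : ℝ := min (z.re / 2) (1 / 2) with hδdef
  have hδ : 0 < δ := lt_min (by linarith) (by norm_num)
  have hδ1 : δ ≤ 1 := (min_le_right _ _).trans (by norm_num)
  set R : ℝ := ‖z‖ + 2 with hR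
  set U : Set ℂ := {w | δ < w.re} ∩ Metric.ball 0 R with hU
  have hUo : IsOpen U := (isOpen_lt continuous_const continuous_re).inter Metric.isOpen_ball
  have hUc : IsPreconnected U :=
    ((convex_halfSpace_re_gt δ).inter (convex_ball 0 R)).isPreconnected
  have hmem : ∀ w ∈ U, δ < w.re ∧ ‖w‖ < R := fun w hw => ⟨hw.1, by simpa using hw.2⟩
  have hb : ∀ (n : ℕ) (w : ℂ), w ∈ U → ‖1 / ((n : ℂ) + 1) - 1 / ((n : ℂ) + w)‖ ≤
      (R + 1) / δ * (1 / ((n : ℝ) + 1) ^ 2) := fun n w hw =>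
    norm_digamma_term_le hδ hδ1 (hmem w hw).1 (hmem w hw).2 n
  have hsum : ∀ w ∈ U, Summable fun n : ℕ => 1 / ((n : ℂ) + 1) - 1 / ((n : ℂ) + w) := fun w hw =>
    Summable.of_norm_bounded (summable_digamma_bound _) fun n => hb n w hw
  have hD : DifferentiableOn ℂ
      (fun w : ℂ => ∑' n : ℕ, (1 / ((n : ℂ) + 1) - 1 / ((n : ℂ) + w))) U := by
    refine differentiableOn_tsum_of_summable_norm (summable_digamma_bound _) (fun n w hw => ?_)
      hUo hb
    have := ne_zero_of_re_pos (re_add_natCast_pos (hδ.trans (hmem w hw).1) n)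
    refine DifferentiableAt.differentiableWithinAt ?_
    fun_prop (disch := assumption)
  have hψ : DifferentiableOn ℂ (fun w => digamma w + Real.eulerMascheroniConstant) U := by
    have hre : ∀ w ∈ U, 0 < w.re := fun w hw => hδ.trans (hmem w hw).1
    have hG : DifferentiableOn ℂ Complex.Gamma U := fun w hw =>
      (Complex.differentiableAt_Gamma w (ne_neg_nat_of_re_pos (hre w hw))).differentiableWithinAt
    refine DifferentiableOn.add_const _ ?_
    rw [digamma_def]
    exact (hG.deriv hUo).div hG fun w hw => Complex.Gamma_ne_zero_of_re_pos (hre w hw)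
  have h1U : ((1 : ℝ) : ℂ) ∈ U := by
    refine ⟨?_, ?_⟩
    · simp only [Set.mem_ofPred_eq, ofReal_re]
      exact (min_le_right _ _).trans_lt (by norm_num)
    · simp only [Metric.mem_ball, dist_zero_right, ofReal_one, norm_one]
      linarith [norm_nonneg z]
  have hzU : z ∈ U := by
    refine ⟨?_, ?_⟩
    · exact (min_le_left (z.re / 2) (1 / 2)).trans_lt (by linarith)
    · simp only [Metric.mem_ball, dist_zero_right]; linarith
  have heq : Set.EqOn (fun w => digamma w + Real.eulerMascheroniConstant)
      (fun w : ℂ => ∑' n : ℕ, (1 / ((n : ℂ) + 1) - 1 / ((n : ℂ) + w))) U := by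
    refine (hψ.analyticOnNhd hUo).eqOn_of_preconnected_of_frequently_eq (hD.analyticOnNhd hUo)
      hUc h1U (frequently_nhdsNE_ofReal ?_)
    have hUr : ∀ᶠ x : ℝ in 𝓝 1, (x : ℂ) ∈ U :=
      continuous_ofReal.continuousAt.eventually (hUo.mem_nhds h1U)
    filter_upwards [hUr] with x hx
    have hx0 : 0 < x := by simpa using hδ.trans (hmem _ hx).1
    exact (tendsto_nhds_unique (hsum _ hx).hasSum.tendsto_sum_nat (tendsto_digamma_real hx0)).symm
  have := (hsum z hzU).hasSum
  rwa [show ∑' n : ℕ, (1 / ((n : ℂ) + 1) - 1 / ((n : ℂ) + z)) = _ from (heq hzU).symm] at this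

/-- Trapezoidal comparison for the logarithm. -/
lemma log_norm_add_one_sub_le {w : ℂ} (hw : 0 < w.re) :
    Real.log ‖w + 1‖ - Real.log ‖w‖ ≤ (1 / (2 * w) + 1 / (2 * (w + 1))).re + 1 / 2 / ‖w‖ ^ 3 := by
  have hw0 := ne_zero_of_re_pos hw
  have hpos : ∀ t : ℝ, 0 ≤ t → 0 < (w + t).re := fun t ht => by
    simp only [add_re, ofReal_re]; positivity
  have hne : ∀ t : ℝ, 0 ≤ t → w + t ≠ 0 := fun t ht => ne_zero_of_re_pos (hpos t ht)
  let F : ℝ → ℂ := fun t => log (w + t) - (1 / 2 : ℂ) * t * (1 / w + 1 / (w + t))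
  have hd : ∀ t ∈ Set.Icc (0:ℝ) 1, HasDerivWithinAt F
      (-((1 / 2 : ℂ) * t ^ 2 / (w * (w + t) ^ 2))) (Set.Icc 0 1) t := by
    intro t ht
    have h0 := hne t ht.1
    have h1 : HasDerivAt (fun t : ℝ => w + (t : ℂ)) 1 t :=
      (ofRealCLM.hasDerivAt (x := t)).const_add w
    have h2 := h1.clog_real (by left; exact hpos t ht.1)
    have h3 : HasDerivAt (fun t : ℝ => (1 / 2 : ℂ) * (t : ℂ)) (1 / 2) t := by
      simpa using (ofRealCLM.hasDerivAt (x := t)).const_mul (1 / 2 : ℂ)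
    have h5 : HasDerivAt (fun t : ℝ => 1 / w + 1 / (w + (t : ℂ))) (-1 / (w + t) ^ 2) t := by
      simpa [one_div] using (h1.fun_inv h0).const_add (1 / w)
    have h4 := h3.fun_mul h5
    refine ((h2.sub h4).congr_deriv ?_).hasDerivWithinAt
    field_simp
    ring
  have hbound : ∀ t ∈ Set.Ico (0:ℝ) 1,
      ‖-((1 / 2 : ℂ) * t ^ 2 / (w * (w + t) ^ 2))‖ ≤ 1 / 2 / ‖w‖ ^ 3 := by
    intro t ht
    have hle : ‖w‖ ≤ ‖w + t‖ := by
      have hre : (w + t).re = w.re + t := by simp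
      have him : (w + t).im = w.im := by simp
      rw [← abs_of_nonneg (norm_nonneg w), ← abs_of_nonneg (norm_nonneg (w + t)), ← sq_le_sq,
        ← normSq_eq_norm_sq, ← normSq_eq_norm_sq, normSq_apply, normSq_apply, hre, him]
      nlinarith [ht.1]
    have hwp : 0 < ‖w‖ := norm_pos_iff.mpr hw0
    rw [norm_neg, norm_div, norm_mul, norm_mul, norm_pow, norm_pow, Complex.norm_real,
      Real.norm_of_nonneg ht.1]
    have : ‖(1 / 2 : ℂ)‖ = 1 / 2 := by norm_num
    rw [this]
    have ht2 : t ^ 2 ≤ 1 := by have := ht.1; have := ht.2; nlinarith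
    calc 1 / 2 * t ^ 2 / (‖w‖ * ‖w + t‖ ^ 2) ≤ 1 / 2 * 1 / (‖w‖ * ‖w‖ ^ 2) := by gcongr
      _ = 1 / 2 / ‖w‖ ^ 3 := by ring_nf
  have hmv := norm_image_sub_le_of_norm_deriv_le_segment' hd hbound 1 (Set.right_mem_Icc.mpr zero_le_one)
  have e : F 1 - F 0 = log (w + 1) - log w - (1 / (2 * w) + 1 / (2 * (w + 1))) := by
    have := hne 1 zero_le_one
    push_cast at this
    simp only [F]; push_cast
    field_simp
    ring_nf
  rw [e, sub_zero, mul_one] at hmv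
  have := (Complex.re_le_norm _).trans hmv
  rw [sub_re, sub_re, log_re, log_re] at this
  linarith

theorem digamma_re_le {z : ℂ} (hz : 0 < z.re) {y : ℝ} (hy : 1 / 2 < y) (hyz : y ≤ |z.im|) :
    (digamma z).re ≤ Real.log ‖z‖ + 1 / (y * (y - 1 / 2)) := by
  have hy0 : 0 < y := by linarith
  have step : ∀ N : ℕ, Real.log ‖(N : ℂ) + z‖ - ∑ n ∈ range N, (1 / ((n : ℂ) + z)).re ≤
      Real.log ‖z‖ - (1 / (2 * z)).re + (1 / (2 * (N + z))).re +
        1 / y * (1 / (y - 1 / 2) - 1 / (y + N - 1 / 2)) := by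
    intro N
    induction N with
    | zero => simp
    | succ N ih =>
      have hw := re_add_natCast_pos hz N
      have h1 := log_norm_add_one_sub_le hw
      set w : ℂ := (N : ℂ) + z with hwdef
      have e1 : ((N + 1 : ℕ) : ℂ) + z = w + 1 := by rw [hwdef]; push_cast; ring
      have hw0 := ne_zero_of_re_pos hw
      have hcube : 1 / 2 / ‖w‖ ^ 3 ≤
          1 / y * (1 / (y + N - 1 / 2) - 1 / (y + (N + 1 : ℕ) - 1 / 2)) := by
        have hN : (0:ℝ) ≤ N := N.cast_nonneg
        have him : w.im = z.im := by simp [hwdef]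
        have hre : (N : ℝ) ≤ w.re := by simp [hwdef, hz.le]
        have hsq : y ^ 2 + (N : ℝ) ^ 2 ≤ ‖w‖ ^ 2 := by
          rw [← normSq_eq_norm_sq, normSq_apply, him]
          have : y ^ 2 ≤ z.im * z.im := by
            rw [← sq, ← sq_abs z.im]; gcongr
          nlinarith
        have hyw : y ≤ ‖w‖ := by
          refine le_of_sq_le_sq ?_ (norm_nonneg _)
          nlinarith
        have hA : 0 < y + N - 1 / 2 := by linarith
        have hB : 0 < y + (N + 1 : ℕ) - 1 / 2 := by push_cast; linarith
        have hprod : (y + N - 1 / 2) * (y + (N + 1 : ℕ) - 1 / 2) ≤ 2 * ‖w‖ ^ 2 := by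
          push_cast; nlinarith [sq_nonneg (y - N)]
        have e2 : 1 / (y + N - 1 / 2) - 1 / (y + (N + 1 : ℕ) - 1 / 2) =
            1 / ((y + N - 1 / 2) * (y + (N + 1 : ℕ) - 1 / 2)) := by
          rw [div_sub_div _ _ hA.ne' hB.ne']
          congr 1
          push_cast; ring
        rw [e2]
        have hwp : 0 < ‖w‖ := norm_pos_iff.mpr hw0
        calc 1 / 2 / ‖w‖ ^ 3 = 1 / ‖w‖ * (1 / (2 * ‖w‖ ^ 2)) := by field_simp
          _ ≤ _ := by gcongr
      rw [sum_range_succ, e1]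
      have e3 : (1 / w).re = 2 * (1 / (2 * w)).re := by
        rw [show 1 / (2 * w) = (((1 / 2 : ℝ)) : ℂ) * (1 / w) by push_cast; field_simp, re_ofReal_mul]
        ring
      rw [add_re] at h1
      have e4 : 1 / y * (1 / (y - 1 / 2) - 1 / (y + (N + 1 : ℕ) - 1 / 2)) =
        1 / y * (1 / (y - 1 / 2) - 1 / (y + N - 1 / 2)) +
         1 / y * (1 / (y + N - 1 / 2) - 1 / (y + (N + 1 : ℕ) - 1 / 2)) := by ring
      rw [e4]
      linarith
  have hlim : Tendsto (fun N : ℕ => Real.log ‖(N : ℂ) + z‖ - ∑ n ∈ range N, (1 / ((n : ℂ) + z)).re)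
      atTop (𝓝 (digamma z).re) := by
    have h1 := (continuous_re.tendsto _).comp (hasSum_digamma hz).tendsto_sum_nat
    have h2 := ((tendsto_log_norm_add_sub_log z).sub Real.tendsto_harmonic_sub_log).add h1
    simp only [add_re, ofReal_re, zero_sub] at h2
    rw [show -Real.eulerMascheroniConstant + ((digamma z).re + Real.eulerMascheroniConstant)
      = (digamma z).re by ring] at h2
    refine h2.congr fun N => ?_
    rw [Function.comp_apply, sum_digamma_terms, sub_re, ofReal_re, re_sum]
    ring
  have hlim2 : Tendsto (fun N : ℕ => (1 / (2 * ((N : ℂ) + z))).re) atTop (𝓝 0) := by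
    rw [← zero_re]
    refine (continuous_re.tendsto _).comp ?_
    have : Tendsto (fun N : ℕ => ‖(N : ℂ) + z‖) atTop atTop := by
      refine tendsto_atTop_mono (fun N => ?_) (tendsto_natCast_atTop_atTop (R := ℝ))
      refine le_trans ?_ (Complex.re_le_norm _)
      simp [hz.le]
    have h3 := (tendsto_inv_atTop_zero.comp this).const_mul (1 / 2 : ℝ)
    rw [mul_zero] at h3
    refine squeeze_zero_norm (fun N => le_of_eq ?_) h3
    simp [mul_comm]
  have hup : Tendsto (fun N : ℕ => Real.log ‖z‖ + 1 / (y * (y - 1 / 2)) +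
      (1 / (2 * ((N : ℂ) + z))).re) atTop (𝓝 (Real.log ‖z‖ + 1 / (y * (y - 1 / 2)) + 0)) :=
    hlim2.const_add _
  rw [add_zero] at hup
  refine le_of_tendsto_of_tendsto' hlim hup fun N => (step N).trans ?_
  have ha : 0 ≤ (1 / (2 * z)).re := by
    rw [one_div, inv_re]
    have : 0 ≤ (2 * z).re := by simp [hz.le]
    exact div_nonneg this (normSq_nonneg _)
  have hb : 0 ≤ 1 / (y + N - 1 / 2) := by
    have hN : (0:ℝ) ≤ N := N.cast_nonneg
    exact one_div_nonneg.mpr (by linarith)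
  have hc : 1 / y * (1 / (y - 1 / 2) - 1 / (y + N - 1 / 2)) ≤ 1 / (y * (y - 1 / 2)) := by
    calc _ ≤ 1 / y * (1 / (y - 1 / 2)) := by gcongr; linarith
      _ = _ := by rw [one_div_mul_one_div]
  linarith

end Digamma

section XiZeros

open Complex Topology ComplexConjugate

/-- The multiplicity of `ρ` as a zero of `xiFun`. -/
noncomputable def xiMult (ρ : ℂ) : ℕ := analyticOrderNatAt xiFun ρ

lemma xiMult_ne_zero_iff {ρ : ℂ} : xiMult ρ ≠ 0 ↔ xiFun ρ = 0 :=
  order_pos_iff differentiable_xiFun xiFun_zero ρ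

lemma xiFun_ne_zero_of_one_le_re {s : ℂ} (hs : 1 ≤ s.re) : xiFun s ≠ 0 := by
  by_cases h1 : s = 1
  · rw [h1, xiFun_one]; exact one_ne_zero
  have hre : 0 < s.re := by linarith
  have h0 : s ≠ 0 := Complex.ne_zero_of_re_pos hre
  have hG := Gammaℝ_ne_zero_of_re_pos hre
  rw [xiFun_eq h0 h1, completedZeta_eq_Gammaℝ_mul h0 hG]
  exact mul_ne_zero (mul_ne_zero h0 (sub_ne_zero.mpr h1))
    (mul_ne_zero hG (riemannZeta_ne_zero_of_one_le_re hs))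

lemma re_lt_one_of_xiFun_eq_zero {ρ : ℂ} (h : xiFun ρ = 0) : ρ.re < 1 := by
  by_contra! hc
  exact xiFun_ne_zero_of_one_le_re hc h

lemma re_pos_of_xiFun_eq_zero {ρ : ℂ} (h : xiFun ρ = 0) : 0 < ρ.re := by
  have := re_lt_one_of_xiFun_eq_zero (ρ := 1 - ρ) (by rw [xiFun_one_sub, h])
  simp only [sub_re, one_re] at this
  linarith

lemma xiMult_one_sub (ρ : ℂ) : xiMult (1 - ρ) = xiMult ρ := by
  have h : xiFun ∘ (fun s : ℂ => 1 - s) = xiFun := funext xiFun_one_sub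
  have hd : deriv (fun s : ℂ => 1 - s) ρ ≠ 0 := by
    have : HasDerivAt (fun s : ℂ => 1 - s) (-1) ρ := by
      simpa using (hasDerivAt_id ρ).const_sub 1
    rw [this.deriv]; norm_num
  have := analyticOrderAt_comp_of_deriv_ne_zero (f := xiFun)
    (g := fun s : ℂ => 1 - s) (z₀ := ρ) (by fun_prop) hd
  rw [h] at this
  simp only [xiMult, analyticOrderNatAt, this]

lemma Gammaℝ_conj (s : ℂ) : Gammaℝ (conj s) = conj (Gammaℝ s) := by
  have h2 : conj s / 2 = conj (s / 2) := by rw [map_div₀, map_ofNat]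
  have hπ : (Real.pi : ℂ).arg ≠ Real.pi := by
    rw [arg_ofReal_of_nonneg Real.pi_pos.le]; exact Real.pi_pos.ne
  have h3 : -conj s / 2 = conj (-s / 2) := by rw [map_div₀, map_neg, map_ofNat]
  rw [Gammaℝ_def, Gammaℝ_def, map_mul, h2, h3, Gamma_conj, cpow_conj _ _ hπ, conj_ofReal]

lemma xiFun_conj (s : ℂ) : xiFun (conj s) = conj (xiFun s) := by
  have hd : Differentiable ℂ (conj ∘ xiFun ∘ conj) := fun s =>
    differentiableAt_conj_conj_iff.mpr (differentiable_xiFun (conj s))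
  have hev : (conj ∘ xiFun ∘ conj) =ᶠ[𝓝 2] xiFun := by
    filter_upwards [(isOpen_lt continuous_const continuous_re).mem_nhds
      (show (1 : ℝ) < (2 : ℂ).re by norm_num)] with z hz
    have hz : 1 < z.re := hz
    have aux : ∀ w : ℂ, 1 < w.re →
        xiFun w = w * (w - 1) * (Gammaℝ w * riemannZeta w) := fun w hw => by
      have h0 := Complex.ne_zero_of_re_pos (by linarith : 0 < w.re)
      have h1 : w ≠ 1 := by rintro rfl; simp at hw
      rw [xiFun_eq h0 h1, completedZeta_eq_Gammaℝ_mul h0 (Gammaℝ_ne_zero_of_re_pos (by linarith))]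
    rw [Function.comp_apply, Function.comp_apply, aux _ (by rwa [conj_re]), aux _ hz,
      riemannZeta_conj, Gammaℝ_conj]
    simp
  have hA := (AnalyticOnNhd.eq_of_eventuallyEq
    (Complex.analyticOnNhd_univ_iff_differentiable.mpr hd)
    (Complex.analyticOnNhd_univ_iff_differentiable.mpr differentiable_xiFun) hev)
  have := congrFun hA s
  rw [← this]; simp

lemma hasSum_xi {s : ℂ} (hs : xiFun s ≠ 0) :
    HasSum (fun ρ : ℂ => (xiMult ρ : ℂ) * (1 / (s - ρ) + 1 / ρ))
      (logDeriv xiFun s - logDeriv xiFun 0) := by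
  obtain ⟨C, hC⟩ := exists_growth_xiFun
  exact hasSum_logDeriv differentiable_xiFun xiFun_zero hC hs

lemma hasSum_xi_flip {s : ℂ} (hs : xiFun s ≠ 0) :
    HasSum (fun ρ : ℂ => (xiMult ρ : ℂ) * (1 / (s - (1 - ρ)) + 1 / (1 - ρ)))
      (logDeriv xiFun s - logDeriv xiFun 0) := by
  have := (Equiv.subLeft (1 : ℂ)).hasSum_iff.mpr (hasSum_xi hs)
  have e : ((fun ρ : ℂ => (xiMult ρ : ℂ) * (1 / (s - ρ) + 1 / ρ)) ∘ Equiv.subLeft (1 : ℂ)) =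
      fun ρ : ℂ => (xiMult ρ : ℂ) * (1 / (s - (1 - ρ)) + 1 / (1 - ρ)) := by
    funext ρ
    simp [xiMult_one_sub]
  rwa [e] at this

lemma logDeriv_xiFun_zero : logDeriv xiFun 0 = -completedRiemannZeta₀ 0 := by
  have h : HasDerivAt xiFun (-completedRiemannZeta₀ 0) 0 := by
    have h1 : HasDerivAt (fun s : ℂ => s * (1 - s)) 1 0 := by
      simpa using (hasDerivAt_id (0:ℂ)).fun_mul ((hasDerivAt_id (0:ℂ)).const_sub 1)
    have h2 := (h1.fun_mul (differentiable_completedZeta₀ 0).hasDerivAt).const_sub 1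
    have h3 : (fun s : ℂ => 1 - s * (1 - s) * completedRiemannZeta₀ s) = xiFun := rfl
    rw [h3] at h2
    simpa using h2
  rw [logDeriv_apply, h.deriv, xiFun_zero, div_one]

lemma logDeriv_xiFun_one : logDeriv xiFun 1 = -logDeriv xiFun 0 := by
  have h : (fun s => xiFun (1 - s)) = xiFun := funext xiFun_one_sub
  have h1 := deriv_comp_const_sub xiFun 1 (0 : ℂ)
  rw [h, sub_zero] at h1
  rw [logDeriv_apply, logDeriv_apply, h1, xiFun_zero, xiFun_one]
  simp

lemma logDeriv_xiFun_one_eq :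
    logDeriv xiFun 1 = (((Real.eulerMascheroniConstant - Real.log (4 * Real.pi)) / 2 + 1 : ℝ) : ℂ) := by
  rw [logDeriv_xiFun_one, logDeriv_xiFun_zero, neg_neg, completedRiemannZeta₀_zero]
  push_cast [ofReal_log (by positivity : (0:ℝ) ≤ 4 * Real.pi)]
  rfl

/-- Partial fractions for `xiFun`, symmetrised under `ρ ↦ 1 - ρ`. -/
theorem hasSum_xi_symm {s : ℂ} (hs : xiFun s ≠ 0) :
    HasSum (fun ρ : ℂ => (xiMult ρ : ℂ) * ((2 * s - 1) / (ρ * (1 - ρ) + s * (s - 1))))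
      (2 * logDeriv xiFun s) := by
  have h1 := ((hasSum_xi hs).add (hasSum_xi_flip hs)).sub
    (hasSum_xi (s := 1) (by rw [xiFun_one]; exact one_ne_zero))
  rw [logDeriv_xiFun_one] at h1
  convert! h1 using 1
  · funext ρ
    rcases eq_or_ne (xiMult ρ) 0 with h0 | h0
    · simp [h0]
    have hz := xiMult_ne_zero_iff.mp h0
    have ha : s - ρ ≠ 0 := fun h => hs (by rw [sub_eq_zero.mp h, hz])
    have hb : s - (1 - ρ) ≠ 0 := fun h => hs (by rw [sub_eq_zero.mp h, xiFun_one_sub, hz])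
    have hc : ρ * (1 - ρ) + s * (s - 1) = (s - ρ) * (s - (1 - ρ)) := by ring
    rw [hc, ← mul_add, ← mul_sub]
    congr 1
    rw [show 1 / (s - ρ) + 1 / ρ + (1 / (s - (1 - ρ)) + 1 / (1 - ρ)) - (1 / (1 - ρ) + 1 / ρ) =
      1 / (s - ρ) + 1 / (s - (1 - ρ)) by ring]
    field_simp
    ring
  · ring

lemma re_one_div_nonneg {z : ℂ} (hz : 0 ≤ z.re) : 0 ≤ (1 / z).re := by
  rw [one_div, inv_re]
  exact div_nonneg hz (normSq_nonneg _)

lemma natCast_mul_re (m : ℕ) (z : ℂ) : ((m : ℂ) * z).re = m * z.re := by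
  rw [← ofReal_natCast, re_ofReal_mul]

/-- The real parts of the partial fraction series converge absolutely without compensation. -/
theorem hasSum_xi_re {s : ℂ} (hs : xiFun s ≠ 0) :
    HasSum (fun ρ : ℂ => (xiMult ρ : ℝ) * (1 / (s - ρ)).re) (logDeriv xiFun s).re := by
  have h1 := hasSum_re (hasSum_xi (s := 1) (by rw [xiFun_one]; exact one_ne_zero))
  have hnn : ∀ ρ : ℂ, 0 ≤ (xiMult ρ : ℝ) * (1 / ρ).re ∧ 0 ≤ (xiMult ρ : ℝ) * (1 / (1 - ρ)).re := by
    intro ρ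
    rcases eq_or_ne (xiMult ρ) 0 with h0 | h0
    · simp [h0]
    have hz := xiMult_ne_zero_iff.mp h0
    have ha := re_pos_of_xiFun_eq_zero hz
    have hb := re_lt_one_of_xiFun_eq_zero hz
    exact ⟨mul_nonneg (Nat.cast_nonneg _) (re_one_div_nonneg ha.le),
      mul_nonneg (Nat.cast_nonneg _) (re_one_div_nonneg (by simp; linarith))⟩
  have hsm : Summable fun ρ : ℂ => (xiMult ρ : ℝ) * (1 / ρ).re := by
    refine Summable.of_nonneg_of_le (fun ρ => (hnn ρ).1) (fun ρ => ?_) h1.summable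
    rw [natCast_mul_re, add_re, mul_add]
    linarith [(hnn ρ).2]
  obtain ⟨A, hA⟩ := hsm
  have hA' : HasSum (fun ρ : ℂ => (xiMult ρ : ℝ) * (1 / (1 - ρ)).re) A := by
    have := (Equiv.subLeft (1 : ℂ)).hasSum_iff.mpr hA
    have e : ((fun ρ : ℂ => (xiMult ρ : ℝ) * (1 / ρ).re) ∘ Equiv.subLeft (1 : ℂ)) =
        fun ρ : ℂ => (xiMult ρ : ℝ) * (1 / (1 - ρ)).re := by
      funext ρ
      simp [xiMult_one_sub]
    rwa [e] at this
  have h2 : A + A = (logDeriv xiFun 1 - logDeriv xiFun 0).re := by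
    refine (hA'.add hA).unique ?_
    convert! h1 using 1
    funext ρ
    rw [natCast_mul_re, add_re, mul_add]
  have h3 := (hasSum_re (hasSum_xi hs)).sub hA
  rw [logDeriv_xiFun_one] at h2
  simp only [sub_re, neg_re] at h2 h3
  convert! h3 using 1
  · funext ρ
    rw [natCast_mul_re, add_re]; ring
  · linarith

lemma sum_le_logDeriv_xiFun {s : ℂ} (hs : 1 ≤ s.re) (F : Finset ℂ) :
    ∑ ρ ∈ F, (xiMult ρ : ℝ) * (1 / (s - ρ)).re ≤ (logDeriv xiFun s).re := by
  refine sum_le_hasSum F (fun ρ _ => ?_) (hasSum_xi_re (xiFun_ne_zero_of_one_le_re hs))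
  rcases eq_or_ne (xiMult ρ) 0 with h0 | h0
  · simp [h0]
  have hb := re_lt_one_of_xiFun_eq_zero (xiMult_ne_zero_iff.mp h0)
  exact mul_nonneg (Nat.cast_nonneg _) (re_one_div_nonneg (by simp; linarith))

theorem logDeriv_xiFun_eq {s : ℂ} (hs : 1 < s.re) :
    logDeriv xiFun s = 1 / s + 1 / (s - 1) - Real.log Real.pi / 2 + digamma (s / 2) / 2 +
      logDeriv riemannZeta s := by
  have hre : 0 < s.re := by linarith
  have h0 : s ≠ 0 := Complex.ne_zero_of_re_pos hre
  have h1 : s ≠ 1 := by rintro rfl; simp at hs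
  have hev : xiFun =ᶠ[𝓝 s] fun w => w * ((w - 1) * ((Real.pi : ℂ) ^ (-w / 2) *
      (Gamma (w / 2) * riemannZeta w))) := by
    filter_upwards [(isOpen_lt continuous_const continuous_re).mem_nhds hs] with w hw
    have hw : 1 < w.re := hw
    have h0 := Complex.ne_zero_of_re_pos (by linarith : 0 < w.re)
    have h1 : w ≠ 1 := by rintro rfl; simp at hw
    rw [xiFun_eq h0 h1, completedZeta_eq_Gammaℝ_mul h0 (Gammaℝ_ne_zero_of_re_pos (by linarith)),
      Gammaℝ_def]
    ring
  have hπ : (Real.pi : ℂ) ≠ 0 := by exact_mod_cast Real.pi_ne_zero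
  have hre2 : 0 < (s / 2).re := by
    rw [show s / 2 = ((1 / 2 : ℝ) : ℂ) * s by push_cast; ring, re_ofReal_mul]; positivity
  have hG : Gamma (s / 2) ≠ 0 := Gamma_ne_zero_of_re_pos hre2
  have hGd : DifferentiableAt ℂ Gamma (s / 2) :=
    differentiableAt_Gamma _ (ne_neg_nat_of_re_pos hre2)
  have hGd' : DifferentiableAt ℂ (fun w => Gamma (w / 2)) s :=
    DifferentiableAt.comp s hGd (by fun_prop)
  have hζ : riemannZeta s ≠ 0 := riemannZeta_ne_zero_of_one_le_re hs.le
  have hζd := differentiableAt_riemannZeta h1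
  have hPd : HasDerivAt (fun w : ℂ => (Real.pi : ℂ) ^ (-w / 2))
      ((Real.pi : ℂ) ^ (-s / 2) * log Real.pi * (-1 / 2)) s :=
    ((hasDerivAt_id s).neg.div_const 2).const_cpow (Or.inl hπ)
  have hP : (Real.pi : ℂ) ^ (-s / 2) ≠ 0 := by simp [cpow_eq_zero_iff, hπ]
  have e1 : logDeriv xiFun s = logDeriv (fun w => w * ((w - 1) * ((Real.pi : ℂ) ^ (-w / 2) *
      (Gamma (w / 2) * riemannZeta w)))) s := by
    rw [logDeriv_apply, logDeriv_apply, hev.deriv_eq, hev.self_of_nhds]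
  have d1 : DifferentiableAt ℂ (fun w : ℂ => Gamma (w / 2) * riemannZeta w) s := hGd'.fun_mul hζd
  have d2 := hPd.differentiableAt.fun_mul d1
  have d3 : DifferentiableAt ℂ (fun w : ℂ => w - 1) s := by fun_prop
  have d4 := d3.fun_mul d2
  have n2 := mul_ne_zero hP (mul_ne_zero hG hζ)
  have n1 : s - 1 ≠ 0 := sub_ne_zero.mpr h1
  rw [e1, logDeriv_mul (f := fun w => w)
      (g := fun w => (w - 1) * ((Real.pi : ℂ) ^ (-w / 2) * (Gamma (w / 2) * riemannZeta w))) s h0 (mul_ne_zero n1 n2) differentiableAt_fun_id d4,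
    logDeriv_mul (f := fun w => w - 1)
      (g := fun w => (Real.pi : ℂ) ^ (-w / 2) * (Gamma (w / 2) * riemannZeta w)) s n1 n2 d3 d2,
    logDeriv_mul (f := fun w => (Real.pi : ℂ) ^ (-w / 2))
      (g := fun w => Gamma (w / 2) * riemannZeta w) s hP (mul_ne_zero hG hζ)
      hPd.differentiableAt d1,
    logDeriv_mul (f := fun w => Gamma (w / 2)) s hG hζ hGd' hζd]
  have f1 : logDeriv (fun w : ℂ => w) s = 1 / s := by simp [logDeriv_apply]
  have f2 : logDeriv (fun w : ℂ => w - 1) s = 1 / (s - 1) := by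
    rw [logDeriv_apply, ((hasDerivAt_id' s).sub_const 1).deriv]
  have f3 : logDeriv (fun w : ℂ => (Real.pi : ℂ) ^ (-w / 2)) s = - Real.log Real.pi / 2 := by
    rw [logDeriv_apply, hPd.deriv, ofReal_log Real.pi_pos.le]
    field_simp
  have f4 : logDeriv (fun w => Gamma (w / 2)) s = digamma (s / 2) / 2 := by
    have : HasDerivAt (fun w => Gamma (w / 2)) (deriv Gamma (s / 2) * (1 / 2)) s :=
      hGd.hasDerivAt.comp s ((hasDerivAt_id' s).div_const 2)
    rw [logDeriv_apply, this.deriv, digamma_def, logDeriv_apply]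
    ring
  rw [f1, f2, f3, f4]
  ring

end XiZeros

section ZeroFree

open Complex Topology ComplexConjugate

set_option maxRecDepth 4000 in
lemma harmonic_256_le : harmonic 256 ≤ 61244 / 10000 := by
  norm_num [harmonic, Finset.sum_range_succ]

lemma two_add_eulerMascheroni_sub_le :
    Real.eulerMascheroniConstant - Real.log (4 * Real.pi) + 2 ≤ 1 / 20 := by
  have h1 : Real.eulerMascheroniConstant < (harmonic 256 : ℝ) - Real.log 256 := by
    have := Real.eulerMascheroniConstant_lt_eulerMascheroniSeq' 256
    rw [Real.eulerMascheroniSeq', if_neg (by norm_num)] at this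
    exact_mod_cast this
  have h2 : (harmonic 256 : ℝ) ≤ 6.1244 := by
    have h : ((harmonic 256 : ℚ) : ℝ) ≤ ((61244 / 10000 : ℚ) : ℝ) := by
      exact_mod_cast harmonic_256_le
    push_cast at h
    linarith
  have h3 : Real.log 256 = 8 * Real.log 2 := by
    rw [show (256 : ℝ) = 2 ^ 8 by norm_num, Real.log_pow]; norm_num
  have h4 : Real.log (4 * Real.pi) = 2 * Real.log 2 + Real.log Real.pi := by
    rw [Real.log_mul (by norm_num) Real.pi_ne_zero, show (4 : ℝ) = 2 ^ 2 by norm_num, Real.log_pow]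
    norm_num
  have h5 : 33 * Real.log 2 ≤ 20 * Real.log Real.pi := by
    have : Real.log ((2 : ℝ) ^ 33) ≤ Real.log (Real.pi ^ 20) := by
      refine Real.log_le_log (by positivity) ?_
      calc (2 : ℝ) ^ 33 ≤ 3.14 ^ 20 := by norm_num
        _ ≤ Real.pi ^ 20 := by
          have := Real.pi_gt_d2
          gcongr
    rw [Real.log_pow, Real.log_pow] at this
    exact_mod_cast this
  have := Real.log_two_gt_d9
  linarith

lemma hasSum_xi_inv : HasSum (fun ρ : ℂ => (xiMult ρ : ℝ) * (1 / (ρ * (1 - ρ))).re)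
    (Real.eulerMascheroniConstant - Real.log (4 * Real.pi) + 2) := by
  have h := hasSum_re (hasSum_xi_symm (s := 1) (by rw [xiFun_one]; exact one_ne_zero))
  rw [logDeriv_xiFun_one_eq] at h
  convert! h using 1
  · funext ρ
    rw [natCast_mul_re]
    norm_num
  · rw [← ofReal_ofNat, ← ofReal_mul, ofReal_re]
    ring

/-- Real part of `ρ (1 - ρ)`. -/
lemma re_mul_one_sub (ρ : ℂ) : (ρ * (1 - ρ)).re = ρ.re * (1 - ρ.re) + ρ.im ^ 2 := by
  simp; ring

lemma im_mul_one_sub (ρ : ℂ) : (ρ * (1 - ρ)).im = ρ.im * (1 - 2 * ρ.re) := by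
  simp; ring

lemma re_mul_one_sub_pos {ρ : ℂ} (hz : xiFun ρ = 0) : 0 < (ρ * (1 - ρ)).re := by
  have ha := re_pos_of_xiFun_eq_zero hz
  have hb := re_lt_one_of_xiFun_eq_zero hz
  rw [re_mul_one_sub]
  have := mul_pos ha (sub_pos.mpr hb)
  positivity

lemma xi_inv_nonneg (ρ : ℂ) : 0 ≤ (xiMult ρ : ℝ) * (1 / (ρ * (1 - ρ))).re := by
  rcases eq_or_ne (xiMult ρ) 0 with h0 | h0
  · simp [h0]
  exact mul_nonneg (Nat.cast_nonneg _)
    (re_one_div_nonneg (re_mul_one_sub_pos (xiMult_ne_zero_iff.mp h0)).le)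

lemma sum_xi_inv_le (F : Finset ℂ) :
    ∑ ρ ∈ F, (xiMult ρ : ℝ) * (1 / (ρ * (1 - ρ))).re ≤ 1 / 20 :=
  (sum_le_hasSum F (fun ρ _ => xi_inv_nonneg ρ) hasSum_xi_inv).trans
    two_add_eulerMascheroni_sub_le

lemma one_le_xiMult {ρ : ℂ} (hz : xiFun ρ = 0) : (1 : ℝ) ≤ xiMult ρ := by
  exact_mod_cast Nat.one_le_iff_ne_zero.mpr (xiMult_ne_zero_iff.mpr hz)

lemma inv_le_re_one_div {ρ : ℂ} (hz : xiFun ρ = 0) :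
    1 / (ρ.im ^ 2 + 1) ≤ (1 / (ρ * (1 - ρ))).re := by
  have ha := re_pos_of_xiFun_eq_zero hz
  have hb := re_lt_one_of_xiFun_eq_zero hz
  have hq := re_mul_one_sub_pos hz
  have hN : 0 < normSq (ρ * (1 - ρ)) := normSq_pos.mpr (by intro h; rw [h] at hq; simp at hq)
  rw [one_div (ρ * (1 - ρ)), inv_re, div_le_div_iff₀ (by positivity) hN, normSq_apply,
    im_mul_one_sub, re_mul_one_sub]
  have hp : 0 < ρ.re * (1 - ρ.re) := mul_pos ha (sub_pos.mpr hb)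
  have hp1 : ρ.re * (1 - ρ.re) ≤ 1 / 4 := by nlinarith [sq_nonneg (ρ.re - 1 / 2)]
  have e : (1 - 2 * ρ.re) ^ 2 = 1 - 4 * (ρ.re * (1 - ρ.re)) := by ring
  generalize ρ.re * (1 - ρ.re) = p at *
  have e2 : ρ.im * (1 - 2 * ρ.re) * (ρ.im * (1 - 2 * ρ.re)) = ρ.im ^ 2 * (1 - 4 * p) := by
    rw [← e]; ring
  rw [e2]
  nlinarith [mul_nonneg (sq_nonneg ρ.im) hp.le]

lemma nineteen_le_im_sq {ρ : ℂ} (hz : xiFun ρ = 0) : 19 ≤ ρ.im ^ 2 := by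
  have h := sum_xi_inv_le {ρ}
  rw [sum_singleton] at h
  have h1 := inv_le_re_one_div hz
  have h2 := one_le_xiMult hz
  have h3 : 1 / (ρ.im ^ 2 + 1) ≤ 1 / 20 := by
    have : 0 ≤ 1 / (ρ.im ^ 2 + 1) := by positivity
    nlinarith
  rw [div_le_div_iff₀ (by positivity) (by norm_num)] at h3
  linarith

lemma xiFun_conj_eq_zero {ρ : ℂ} (hz : xiFun ρ = 0) : xiFun (conj ρ) = 0 := by
  rw [xiFun_conj, hz, map_zero]

lemma le_im_sq_of_re_ne_half {ρ : ℂ} (hz : xiFun ρ = 0) (hne : ρ.re ≠ 1 / 2) :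
    79 ≤ ρ.im ^ 2 := by
  have him : ρ.im ≠ 0 := by
    intro h
    have := nineteen_le_im_sq hz
    rw [h] at this; norm_num at this
  have n1 : ρ ≠ 1 - ρ := fun h => hne (by have := congrArg re h; simp at this; linarith)
  have n2 : ρ ≠ conj ρ := fun h => him (by have := congrArg im h; simp at this; linarith)
  have n3 : ρ ≠ 1 - conj ρ := fun h => hne (by have := congrArg re h; simp at this; linarith)
  have n4 : 1 - ρ ≠ conj ρ := fun h => hne (by have := congrArg re h; simp at this; linarith)
  have n5 : 1 - ρ ≠ 1 - conj ρ := fun h => n2 (by linear_combination -h)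
  have n6 : conj ρ ≠ 1 - conj ρ :=
    fun h => hne (by have := congrArg re h; simp at this; linarith)
  have h := sum_xi_inv_le {ρ, 1 - ρ, conj ρ, 1 - conj ρ}
  rw [sum_insert (by simp [n1, n2, n3]), sum_insert (by simp only [mem_insert, mem_singleton, not_or]; exact ⟨n4, n5⟩),
    sum_insert (by simpa using n6), sum_singleton] at h
  have key : ∀ w : ℂ, xiFun w = 0 → w.im ^ 2 = ρ.im ^ 2 →
      1 / (ρ.im ^ 2 + 1) ≤ (xiMult w : ℝ) * (1 / (w * (1 - w))).re := by
    intro w hw he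
    have h1 := inv_le_re_one_div hw
    have h2 := one_le_xiMult hw
    rw [he] at h1
    have : 0 ≤ 1 / (ρ.im ^ 2 + 1) := by positivity
    nlinarith
  have hc := xiFun_conj_eq_zero hz
  have k1 := key ρ hz rfl
  have k2 := key (1 - ρ) (by rw [xiFun_one_sub, hz]) (by simp)
  have k3 := key (conj ρ) hc (by simp)
  have k4 := key (1 - conj ρ) (by rw [xiFun_one_sub, hc]) (by simp)
  have h3 : 1 / (ρ.im ^ 2 + 1) ≤ 1 / 80 := by linarith
  rw [div_le_div_iff₀ (by positivity) (by norm_num)] at h3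
  linarith

/-- The `3-4-1` inequality for the logarithmic derivative of the zeta function. -/
lemma logDeriv_riemannZeta_three_four_one {σ : ℝ} (hσ : 1 < σ) (t : ℝ) :
    3 * (logDeriv riemannZeta (σ : ℂ)).re + 4 * (logDeriv riemannZeta (σ + t * I)).re +
      (logDeriv riemannZeta (σ + (2 * t : ℝ) * I)).re ≤ 0 := by
  have key : ∀ y : ℝ, HasSum (fun n : ℕ => -(ArithmeticFunction.vonMangoldt n * (n : ℝ) ^ (-σ) *
      Real.cos (y * Real.log n))) (logDeriv riemannZeta (σ + y * I)).re := by
    intro y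
    have hre : 1 < ((σ : ℂ) + y * I).re := by simpa using hσ
    have h1 := (ArithmeticFunction.LSeriesSummable_vonMangoldt hre).LSeriesHasSum
    rw [LSeriesHasSum, ArithmeticFunction.LSeries_vonMangoldt_eq_deriv_riemannZeta_div hre] at h1
    have h2 := (hasSum_re h1).neg
    have e : -((-deriv riemannZeta (σ + y * I) / riemannZeta (σ + y * I)).re) =
        (logDeriv riemannZeta (σ + y * I)).re := by
      rw [logDeriv_apply, neg_div, neg_re, neg_neg]
    rw [e] at h2
    convert! h2 using 1
    funext n
    rcases eq_or_ne n 0 with rfl | hn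
    · simp
    have hn' : (0 : ℝ) < n := by exact_mod_cast Nat.pos_of_ne_zero hn
    congr 1
    rw [LSeries.term_of_ne_zero hn, div_eq_mul_inv, ← cpow_neg, re_ofReal_mul, mul_assoc]
    congr 1
    rw [cpow_def_of_ne_zero (by exact_mod_cast hn), ← ofReal_natCast, ← ofReal_log hn'.le, exp_re,
      Real.rpow_def_of_pos hn']
    simp only [re_ofReal_mul, im_ofReal_mul]
    congr 1
    · simp
    · rw [← Real.cos_neg]; congr 1; simp; ring
  have h0 := key 0
  have h1 := key t
  have h2 := key (2 * t)
  rw [ofReal_zero, zero_mul, add_zero] at h0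
  refine ((h0.mul_left 3).add (h1.mul_left 4)).add h2 |>.nonpos (fun n => ?_)
  have hΛ : 0 ≤ ArithmeticFunction.vonMangoldt n * (n : ℝ) ^ (-σ) :=
    mul_nonneg ArithmeticFunction.vonMangoldt_nonneg (by positivity)
  rw [mul_assoc 2 t, Real.cos_two_mul]
  simp only [zero_mul, Real.cos_zero]
  nlinarith [mul_nonneg hΛ (sq_nonneg (Real.cos (t * Real.log n) + 1))]

end ZeroFree

section ZeroFreeRegion

open Complex Topology ComplexConjugate

/-- The archimedean part of the logarithmic derivative of `xiFun`. -/
noncomputable def xiArch (s : ℂ) : ℝ :=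
  (1 / s).re + (1 / (s - 1)).re - Real.log Real.pi / 2 + (digamma (s / 2)).re / 2

lemma logDeriv_xiFun_re {s : ℂ} (hs : 1 < s.re) :
    (logDeriv xiFun s).re = xiArch s + (logDeriv riemannZeta s).re := by
  rw [logDeriv_xiFun_eq hs, xiArch]
  have h1 : ((Real.log Real.pi : ℂ) / 2).re = Real.log Real.pi / 2 := by
    rw [← ofReal_ofNat, ← ofReal_div, ofReal_re]
  have h2 : (digamma (s / 2) / 2).re = (digamma (s / 2)).re / 2 := by
    rw [← ofReal_ofNat 2, div_ofReal_re]
  simp only [add_re, sub_re, h1, h2]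

lemma digamma_re_succ {x : ℝ} (hx : 0 < x) :
    (digamma (x : ℂ)).re = (digamma ((x + 1 : ℝ) : ℂ)).re - 1 / x := by
  have h := digamma_apply_add_one (x : ℂ) (ne_neg_nat_of_re_pos (by simpa using hx))
  have h' : digamma ((x + 1 : ℝ) : ℂ) = digamma (x : ℂ) + ((1 / x : ℝ) : ℂ) := by
    push_cast
    rw [h]
    ring
  rw [h', add_re, ofReal_re]
  ring

lemma xiArch_ofReal_le {ε : ℝ} (h0 : 0 < ε) (h1 : ε ≤ 7 / 10) :
    xiArch ((1 + ε : ℝ) : ℂ) ≤ 1 / ε - 3 / 10 := by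
  have hx : 0 < (1 + ε) / 2 := by positivity
  have e1 : ((1 + ε : ℝ) : ℂ) / 2 = (((1 + ε) / 2 : ℝ) : ℂ) := by push_cast; ring
  have e2 : ((1 + ε : ℝ) : ℂ) - 1 = ((ε : ℝ) : ℂ) := by push_cast; ring
  have hd := digamma_re_real_le (x := (1 + ε) / 2 + 1 + 1) (by positivity)
  have hl : Real.log ((1 + ε) / 2 + 1 + 1) - Real.log Real.pi ≤ -0.0922 := by
    rw [← Real.log_div (by positivity) Real.pi_ne_zero]
    refine (Real.log_le_sub_one_of_pos (by positivity)).trans ?_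
    have : ((1 + ε) / 2 + 1 + 1) / Real.pi ≤ 2.85 / 3.14 := by
      have := Real.pi_gt_d2
      gcongr
      linarith
    norm_num at this ⊢
    linarith
  have hr : 1 / (1 + ε) - 1 / ((1 + ε) / 2) / 2 - 1 / ((1 + ε) / 2 + 1) / 2 ≤ -0.27 := by
    have : 1 / (1 + ε) - 1 / ((1 + ε) / 2) / 2 - 1 / ((1 + ε) / 2 + 1) / 2 = - (1 / (3 + ε)) := by
      field_simp
      ring
    rw [this]
    have : 1 / 3.7 ≤ 1 / (3 + ε) := by gcongr; linarith
    norm_num at this ⊢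
    linarith
  rw [xiArch, e1, e2, digamma_re_succ hx, digamma_re_succ (by positivity : 0 < (1 + ε) / 2 + 1),
    ← ofReal_one, ← ofReal_div, ← ofReal_div, ofReal_re, ofReal_re]
  linarith

lemma xiArch_add_mul_I_le {ε t : ℝ} (h0 : 0 < ε) (h1 : ε ≤ 7 / 10) (ht : 2 ≤ |t|) :
    xiArch ((1 + ε : ℝ) + t * I) ≤
      (Real.log |t| - Real.log (2 * Real.pi)) / 2 + 3.2 / t ^ 2 + 2 / (|t| * (|t| - 1)) := by
  set z : ℂ := (1 + ε : ℝ) + t * I with hz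
  have zre : z.re = 1 + ε := by simp [hz]
  have zim : z.im = t := by simp [hz]
  have ht2 : 0 < t ^ 2 := by rw [← sq_abs]; positivity
  have a1 : (1 / z).re ≤ 1.7 / t ^ 2 := by
    rw [one_div, inv_re, normSq_apply, zre, zim]
    gcongr
    · linarith
    · nlinarith
  have a2 : (1 / (z - 1)).re ≤ 0.7 / t ^ 2 := by
    rw [one_div, inv_re, normSq_apply]
    simp only [sub_re, sub_im, one_re, one_im, zre, zim, sub_zero]
    gcongr
    · linarith
    · nlinarith
  have e : z / 2 = ((1 / 2 : ℝ) : ℂ) * z := by push_cast; ring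
  have zre2 : (z / 2).re = (1 + ε) / 2 := by rw [e, re_ofReal_mul, zre]; ring
  have zim2 : (z / 2).im = t / 2 := by rw [e, im_ofReal_mul, zim]; ring
  have a3 := digamma_re_le (z := z / 2) (y := |t| / 2) (by rw [zre2]; positivity) (by linarith)
    (by rw [zim2, abs_div]; norm_num)
  have hz0 : 0 < ‖z‖ := norm_pos_iff.mpr (by intro h; rw [h] at zre; simp at zre; linarith)
  have a4 : Real.log ‖z / 2‖ ≤ Real.log |t| + 1.5 / t ^ 2 - Real.log 2 := by
    have hn : ‖z / 2‖ = ‖z‖ / 2 := by simp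
    have hsq : ‖z‖ ^ 2 = (1 + ε) ^ 2 + t ^ 2 := by
      rw [← normSq_eq_norm_sq, normSq_apply, zre, zim]; ring
    have : 2 * Real.log ‖z‖ ≤ 2 * Real.log |t| + (1 + ε) ^ 2 / t ^ 2 := by
      have l1 : 2 * Real.log ‖z‖ = Real.log ((1 + ε) ^ 2 + t ^ 2) := by
        rw [← hsq, Real.log_pow]; norm_num
      have l2 : 2 * Real.log |t| = Real.log (t ^ 2) := by
        rw [← sq_abs, Real.log_pow]; norm_num
      have l3 := Real.log_le_sub_one_of_pos (x := ((1 + ε) ^ 2 + t ^ 2) / t ^ 2) (by positivity)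
      rw [Real.log_div (by positivity) ht2.ne'] at l3
      have l4 : ((1 + ε) ^ 2 + t ^ 2) / t ^ 2 - 1 = (1 + ε) ^ 2 / t ^ 2 := by
        rw [add_div, div_self ht2.ne']; ring
      linarith
    have : (1 + ε) ^ 2 / t ^ 2 ≤ 3 / t ^ 2 := by gcongr; nlinarith
    have e3 : 3 / t ^ 2 = 2 * (1.5 / t ^ 2) := by ring
    rw [hn, Real.log_div hz0.ne' (by norm_num)]
    linarith
  have a5 : 1 / (|t| / 2 * (|t| / 2 - 1 / 2)) = 4 / (|t| * (|t| - 1)) := by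
    have : |t| - 1 ≠ 0 := by linarith
    have : |t| ≠ 0 := by linarith
    field_simp
    norm_num
  have a6 : Real.log (2 * Real.pi) = Real.log 2 + Real.log Real.pi :=
    Real.log_mul (by norm_num) Real.pi_ne_zero
  rw [a5] at a3
  rw [xiArch, a6]
  have e7 : 3.2 / t ^ 2 = 1.7 / t ^ 2 + 0.7 / t ^ 2 + 1.5 / t ^ 2 / 2 + 0.05 / t ^ 2 := by ring
  have e8 : 4 / (|t| * (|t| - 1)) = 2 * (2 / (|t| * (|t| - 1))) := by ring
  have e9 : 0 ≤ 0.05 / t ^ 2 := by positivity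
  linarith

/-- The basic inequality behind the zero-free region. -/
lemma zero_inequality {ρ : ℂ} (hz : xiFun ρ = 0) (hne : ρ.re ≠ 1 / 2) {ε : ℝ} (h0 : 0 < ε) :
    4 / (ε + (1 - ρ.re)) + 4 / (1 + ε - (1 - ρ.re)) ≤ 3 * xiArch ((1 + ε : ℝ) : ℂ) +
      4 * xiArch ((1 + ε : ℝ) + ρ.im * I) + xiArch ((1 + ε : ℝ) + (2 * ρ.im : ℝ) * I) := by
  have ha := re_pos_of_xiFun_eq_zero hz
  have hb := re_lt_one_of_xiFun_eq_zero hz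
  have h341 := logDeriv_riemannZeta_three_four_one (σ := 1 + ε) (by linarith) ρ.im
  have r0 : (((1 + ε : ℝ) : ℂ)).re = 1 + ε := ofReal_re _
  have r1 : ∀ y : ℝ, ((1 + ε : ℝ) + y * I : ℂ).re = 1 + ε := by intro y; simp
  have b0 := sum_le_logDeriv_xiFun (s := ((1 + ε : ℝ) : ℂ)) (by rw [r0]; linarith) ∅
  have b2 := sum_le_logDeriv_xiFun (s := (1 + ε : ℝ) + (2 * ρ.im : ℝ) * I)
    (by rw [r1]; linarith) ∅
  have b1 := sum_le_logDeriv_xiFun (s := (1 + ε : ℝ) + ρ.im * I) (by rw [r1]; linarith)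
    {ρ, 1 - conj ρ}
  have n3 : ρ ≠ 1 - conj ρ := fun h => hne (by have := congrArg re h; simp at this; linarith)
  rw [sum_pair n3] at b1
  rw [sum_empty] at b0 b2
  rw [logDeriv_xiFun_re (by rw [r0]; linarith)] at b0
  rw [logDeriv_xiFun_re (by rw [r1]; linarith)] at b1 b2
  have c1 : ((1 + ε : ℝ) + ρ.im * I : ℂ) - ρ = ((ε + (1 - ρ.re) : ℝ) : ℂ) := by
    apply Complex.ext <;> simp
    ring
  have c2 : ((1 + ε : ℝ) + ρ.im * I : ℂ) - (1 - conj ρ) = ((1 + ε - (1 - ρ.re) : ℝ) : ℂ) := by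
    apply Complex.ext <;> simp
  rw [c1, c2, ← ofReal_one, ← ofReal_div, ← ofReal_div, ofReal_re, ofReal_re, ofReal_one] at b1
  have m1 := one_le_xiMult hz
  have m2 : (1 : ℝ) ≤ xiMult (1 - conj ρ) :=
    one_le_xiMult (by rw [xiFun_one_sub, xiFun_conj_eq_zero hz])
  have p1 : 0 < 1 / (ε + (1 - ρ.re)) := by
    have : 0 < ε + (1 - ρ.re) := by linarith
    positivity
  have p2 : 0 < 1 / (1 + ε - (1 - ρ.re)) := by
    have : 0 < 1 + ε - (1 - ρ.re) := by linarith
    positivity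
  have q1 : 1 / (ε + (1 - ρ.re)) ≤ xiMult ρ * (1 / (ε + (1 - ρ.re))) := by nlinarith
  have q2 : 1 / (1 + ε - (1 - ρ.re)) ≤ xiMult (1 - conj ρ) * (1 / (1 + ε - (1 - ρ.re))) := by
    nlinarith
  have e1 : 4 / (ε + (1 - ρ.re)) = 4 * (1 / (ε + (1 - ρ.re))) := by ring
  have e2 : 4 / (1 + ε - (1 - ρ.re)) = 4 * (1 / (1 + ε - (1 - ρ.re))) := by ring
  linarith

lemma log_le_tangent {x a : ℝ} (hx : 0 < x) (ha : 0 < a) :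
    Real.log x ≤ Real.log a + x / a - 1 := by
  have := Real.log_le_sub_one_of_pos (x := x / a) (by positivity)
  rw [Real.log_div hx.ne' ha.ne'] at this
  linarith

lemma log_two_pi_ge : 1.836 ≤ Real.log (2 * Real.pi) := by
  have h5 : 33 * Real.log 2 ≤ 20 * Real.log Real.pi := by
    have : Real.log ((2 : ℝ) ^ 33) ≤ Real.log (Real.pi ^ 20) := by
      refine Real.log_le_log (by positivity) ?_
      calc (2 : ℝ) ^ 33 ≤ 3.14 ^ 20 := by norm_num
        _ ≤ Real.pi ^ 20 := by
          have := Real.pi_gt_d2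
          gcongr
    rw [Real.log_pow, Real.log_pow] at this
    exact_mod_cast this
  have := Real.log_two_gt_d9
  rw [Real.log_mul (by norm_num) Real.pi_ne_zero]
  norm_num at *
  linarith

lemma zero_free_numeric {g : ℝ} (hg1 : 4.29 ≤ g) :
    3 * (g / 2.8) - 0.9 + 3.75 * Real.log g - 4.59 + 0.3466 + 23.2 / g ^ 3 <
      4 * g / 3.25 + 4 * g / (g + 2.8) := by
  have hg0 : 0 < g := by linarith
  have hl2 := Real.log_two_lt_d9
  have e1 : 4 * g / 3.25 = 16 / 13 * g := by ring
  have e2 : 3 * (g / 2.8) = 15 / 14 * g := by ring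
  rw [e1, e2]
  rcases le_total g 12 with h12 | h12
  · have t1 := log_le_tangent hg0 (show (0:ℝ) < 8 by norm_num)
    have t2 : Real.log 8 = 3 * Real.log 2 := by
      rw [show (8 : ℝ) = 2 ^ 3 by norm_num, Real.log_pow]; norm_num
    have t3 : 23.2 / g ^ 3 ≤ 0.3 := by
      rw [div_le_iff₀ (by positivity)]
      have : (4.29 : ℝ) ^ 3 ≤ g ^ 3 := by gcongr
      norm_num at this
      linarith
    have t4 : 0.32 * g - 0.79 < 4 * g / (g + 2.8) := by
      rw [lt_div_iff₀ (by positivity)]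
      nlinarith [mul_nonneg (sub_nonneg.mpr hg1) (sub_nonneg.mpr h12)]
    generalize 4 * g / (g + 2.8) = X at *
    generalize 23.2 / g ^ 3 = Y at *
    norm_num at t3 t4 hl2 ⊢
    linarith
  · have t1 := log_le_tangent hg0 (show (0:ℝ) < 25 by norm_num)
    have t2 : Real.log 25 ≤ 14 / 3 * Real.log 2 := by
      have : Real.log ((25 : ℝ) ^ 3) ≤ Real.log (2 ^ 14) :=
        Real.log_le_log (by norm_num) (by norm_num)
      rw [Real.log_pow, Real.log_pow] at this
      norm_num at this
      linarith
    have t3 : 23.2 / g ^ 3 ≤ 0.014 := by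
      rw [div_le_iff₀ (by positivity)]
      have : (12 : ℝ) ^ 3 ≤ g ^ 3 := by gcongr
      norm_num at this
      linarith
    have t4 : 3.24 ≤ 4 * g / (g + 2.8) := by
      rw [le_div_iff₀ (by positivity)]
      norm_num
      linarith
    generalize 4 * g / (g + 2.8) = X at *
    generalize 23.2 / g ^ 3 = Y at *
    norm_num at t3 t4 hl2 ⊢
    linarith

/-- A zero-free region of Littlewood type, with exponents suited to small heights. -/
theorem zero_free_region {ρ : ℂ} (hz : xiFun ρ = 0) (hne : ρ.re ≠ 1 / 2) {u : ℝ} (hu : 0 < u)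
    (hu3 : u ^ 3 = |ρ.im|) : 0.45 ≤ (1 - ρ.re) * u ^ 2 := by
  by_contra! hcon
  have hb := re_lt_one_of_xiFun_eq_zero hz
  have him := le_im_sq_of_re_ne_half hz hne
  obtain ⟨g, hg⟩ : ∃ g, g = u ^ 2 := ⟨_, rfl⟩
  have hg0 : 0 < g := by rw [hg]; positivity
  have hg3 : ρ.im ^ 2 = g ^ 3 := by rw [← sq_abs, ← hu3, hg]; ring
  have hg1 : 4.29 ≤ g := by
    by_contra! h
    have : g ^ 3 < 4.29 ^ 3 := by gcongr
    norm_num at this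
    linarith
  have hG : 8.8 ≤ |ρ.im| := by
    by_contra! h
    have : |ρ.im| ^ 2 < 8.8 ^ 2 := by gcongr
    rw [sq_abs] at this
    norm_num at this
    linarith
  have hL : Real.log |ρ.im| = 1.5 * Real.log g := by
    rw [← hu3, hg, Real.log_pow, Real.log_pow]; norm_num; ring
  have hL2 : Real.log |2 * ρ.im| = Real.log 2 + 1.5 * Real.log g := by
    rw [abs_mul, Real.log_mul (by norm_num) (by linarith), hL]; norm_num
  rw [← hg] at hcon
  set d := 1 - ρ.re with hd
  have hd0 : 0 < d := by linarith
  have hε1 : 2.8 / g ≤ 7 / 10 := by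
    rw [div_le_div_iff₀ hg0 (by norm_num)]; linarith
  have key := zero_inequality hz hne (ε := 2.8 / g) (by positivity)
  have a0 := xiArch_ofReal_le (ε := 2.8 / g) (by positivity) hε1
  have a1 := xiArch_add_mul_I_le (ε := 2.8 / g) (t := ρ.im) (by positivity) hε1 (by linarith)
  have a2 := xiArch_add_mul_I_le (ε := 2.8 / g) (t := 2 * ρ.im) (by positivity) hε1
    (by rw [abs_mul]; norm_num; linarith)
  rw [hL] at a1
  rw [hL2] at a2
  rw [abs_mul, abs_two, mul_pow] at a2
  rw [hg3] at a1 a2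
  rw [← hd] at key
  have hGg : |ρ.im| ^ 2 = g ^ 3 := by rw [sq_abs, hg3]
  have b1 : 2 / (|ρ.im| * (|ρ.im| - 1)) ≤ 2.26 / g ^ 3 := by
    rw [← hGg, div_le_div_iff₀ (by nlinarith) (by positivity)]
    nlinarith
  have b2 : 2 / (2 * |ρ.im| * (2 * |ρ.im| - 1)) ≤ 0.54 / g ^ 3 := by
    rw [← hGg, div_le_div_iff₀ (by nlinarith) (by positivity)]
    nlinarith
  have c1 : 4 * g / 3.25 ≤ 4 / (2.8 / g + d) := by
    rw [div_le_div_iff₀ (by norm_num) (by positivity)]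
    have : (2.8 / g + d) * g = 2.8 + d * g := by field_simp
    nlinarith
  have c2 : 4 * g / (g + 2.8) ≤ 4 / (1 + 2.8 / g - d) := by
    rw [div_le_div_iff₀ (by positivity) (by have : 0 < 2.8 / g := by positivity
                                            have := re_pos_of_xiFun_eq_zero hz
                                            linarith)]
    have : g * (1 + 2.8 / g - d) = g + 2.8 - d * g := by field_simp
    nlinarith
  have c3 : 1 / (2.8 / g) = g / 2.8 := by field_simp
  rw [c3] at a0
  have e1 : 3.2 / (2 ^ 2 * g ^ 3) = 0.8 / g ^ 3 := by field_simp; norm_num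
  rw [e1] at a2
  have hℓ := log_two_pi_ge
  have hl2 := Real.log_two_lt_d9
  have main : 4 * g / 3.25 + 4 * g / (g + 2.8) ≤ 3 * (g / 2.8) - 0.9 + 3.75 * Real.log g - 4.59
      + 0.3466 + 23.2 / g ^ 3 := by
    have e2 : 23.2 / g ^ 3 = 4 * (3.2 / g ^ 3) + 4 * (2.26 / g ^ 3) + 0.8 / g ^ 3 + 0.54 / g ^ 3
        + 0.02 / g ^ 3 := by ring
    have e3 : 0 ≤ 0.02 / g ^ 3 := by positivity
    linarith
  exact absurd main (not_le.mpr (zero_free_numeric hg1))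

end ZeroFreeRegion

section ZeroSum

open Complex Topology ComplexConjugate

lemma one_add_cube_le_exp {y : ℝ} (hy : 0 ≤ y) : 1 + y ^ 3 ≤ Real.exp (15 / 13 * y) := by
  have h := Real.sum_le_exp_of_nonneg (x := 15 / 13 * y) (by positivity) 8
  refine le_trans ?_ h
  simp only [sum_range_succ, range_zero, sum_empty, Nat.factorial]
  norm_num
  obtain ⟨x, rfl⟩ : ∃ x, y = 13 / 15 * x := ⟨15 / 13 * y, by ring⟩
  have hx : 0 ≤ x := by linarith
  ring_nf
  have key : 0 ≤ 1 + x / 2 - 0.4844 * x ^ 2 + x ^ 3 / 24 + x ^ 4 / 120 + x ^ 5 / 720 := by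
    have h1 : 0 ≤ x * (x ^ 2 - 7.3) ^ 2 := by positivity
    have h2 : 0 ≤ (x ^ 2 - 7.3) ^ 2 := by positivity
    nlinarith [sq_nonneg (x - 2.7), mul_nonneg hx (sq_nonneg (x - 2.7))]
  have := mul_nonneg hx key
  have h7 : 0 ≤ x ^ 7 := by positivity
  nlinarith [pow_nonneg hx 3]

lemma norm_one_div_le {ρ : ℂ} (hz : xiFun ρ = 0) :
    ‖1 / (ρ * (1 - ρ))‖ ≤ 2 * (1 / (ρ * (1 - ρ))).re := by
  have ha := re_pos_of_xiFun_eq_zero hz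
  have hb := re_lt_one_of_xiFun_eq_zero hz
  have hg := nineteen_le_im_sq hz
  have hq := re_mul_one_sub_pos hz
  have hp : 0 < ρ.re * (1 - ρ.re) := mul_pos ha (sub_pos.mpr hb)
  have e := re_mul_one_sub ρ
  have e' := im_mul_one_sub ρ
  set q := ρ * (1 - ρ)
  have hN : 0 < ‖q‖ := norm_pos_iff.mpr (by intro h; rw [h] at hq; simp at hq)
  have h1 : ‖q‖ ≤ 2 * q.re := by
    have him : |q.im| ≤ q.re := by
      rw [e, e', abs_mul]
      have h2 : |1 - 2 * ρ.re| ≤ 1 := by rw [abs_le]; constructor <;> linarith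
      have h3 : |ρ.im| * |1 - 2 * ρ.re| ≤ |ρ.im| * 1 := by gcongr
      have h4 : 1 ≤ |ρ.im| := by
        by_contra! h
        have : |ρ.im| ^ 2 < 1 := by nlinarith [abs_nonneg ρ.im]
        rw [sq_abs] at this
        linarith
      have h5 : ρ.im ^ 2 = |ρ.im| ^ 2 := (sq_abs _).symm
      nlinarith
    have := norm_le_abs_re_add_abs_im q
    rw [abs_of_pos hq] at this
    linarith
  rw [norm_div, norm_one, one_div q, inv_re, normSq_eq_norm_sq, ← mul_div_assoc,
    div_le_div_iff₀ hN (by positivity)]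
  nlinarith

/-- The contribution of a zero to the explicit formula. -/
noncomputable def zeroTerm (u : ℝ) (ρ : ℂ) : ℂ :=
  (xiMult ρ : ℂ) * (exp ((ρ - 1) * u) / (ρ * (1 - ρ)))

lemma norm_zeroTerm (u : ℝ) (ρ : ℂ) : ‖zeroTerm u ρ‖ =
    (xiMult ρ : ℝ) * (Real.exp (-(1 - ρ.re) * u) * ‖1 / (ρ * (1 - ρ))‖) := by
  rw [zeroTerm, norm_mul, norm_natCast, norm_div, norm_exp, norm_div, norm_one]
  simp
  ring_nf
  simp

lemma norm_zeroTerm_le {u : ℝ} (hu : 0 ≤ u) (ρ : ℂ) :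
    ‖zeroTerm u ρ‖ ≤ 2 * ((xiMult ρ : ℝ) * (1 / (ρ * (1 - ρ))).re) := by
  rw [norm_zeroTerm]
  rcases eq_or_ne (xiMult ρ) 0 with h0 | h0
  · simp [h0]
  have hz := xiMult_ne_zero_iff.mp h0
  have hb := re_lt_one_of_xiFun_eq_zero hz
  have h1 := norm_one_div_le hz
  have h2 : Real.exp (-(1 - ρ.re) * u) ≤ 1 := Real.exp_le_one_iff.mpr (by nlinarith)
  calc (xiMult ρ : ℝ) * (Real.exp (-(1 - ρ.re) * u) * ‖1 / (ρ * (1 - ρ))‖)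
      ≤ (xiMult ρ : ℝ) * (1 * (2 * (1 / (ρ * (1 - ρ))).re)) := by gcongr
    _ = _ := by ring

lemma summable_zeroTerm_norm {u : ℝ} (hu : 0 ≤ u) : Summable fun ρ => ‖zeroTerm u ρ‖ :=
  Summable.of_nonneg_of_le (fun _ => norm_nonneg _) (norm_zeroTerm_le hu)
    (hasSum_xi_inv.summable.mul_left 2)

lemma exp_mul_norm_le_of_half_lt {ρ : ℂ} (hz : xiFun ρ = 0) (hβ : 1 / 2 < ρ.re) {u t : ℝ}
    (hu : 0 < u) (ht : 0 < t) (htu : t ^ 2 = 0.39 * u) :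
    (Real.exp (-(1 - ρ.re) * u) + Real.exp (-ρ.re * u)) / 2 * ‖1 / (ρ * (1 - ρ))‖ ≤
      0.5055 * (1 / (ρ * (1 - ρ) + ((t ^ 3) ^ 2 - 1 / 4 : ℝ))).re +
        1.011 * Real.exp (-u / 2) * (1 / (ρ * (1 - ρ))).re := by
  have ha := re_pos_of_xiFun_eq_zero hz
  have hb := re_lt_one_of_xiFun_eq_zero hz
  have hg := le_im_sq_of_re_ne_half hz hβ.ne'
  have hq := re_mul_one_sub_pos hz
  have hp : 0 < ρ.re * (1 - ρ.re) := mul_pos ha (sub_pos.mpr hb)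
  have e := re_mul_one_sub ρ
  have e' := im_mul_one_sub ρ
  have him : (ρ * (1 - ρ)).im ^ 2 ≤ ρ.im ^ 2 := by
    rw [e', mul_pow]
    have : (1 - 2 * ρ.re) ^ 2 ≤ 1 := by nlinarith
    nlinarith [sq_nonneg ρ.im]
  set q := ρ * (1 - ρ)
  have hN : 0 < ‖q‖ := norm_pos_iff.mpr (by intro h; rw [h] at hq; simp at hq)
  have hqa : ‖1 / q‖ ≤ 1 / q.re := by
    rw [norm_div, norm_one]
    exact one_div_le_one_div_of_le hq ((le_abs_self _).trans (abs_re_le_norm q))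
  have k2 : ‖1 / q‖ / 2 ≤ 1.011 * (1 / q).re := by
    have := norm_one_div_le hz
    have h0 : 0 ≤ (1 / q).re := re_one_div_nonneg hq.le
    have h1 : 1 / q.re ≤ 2 * (1 / q).re := by
      rw [one_div q, inv_re, normSq_apply, ← mul_div_assoc,
        div_le_div_iff₀ hq (by nlinarith [mul_pos hq hq, mul_self_nonneg q.im])]
      nlinarith
    linarith
  have k3 : Real.exp (-ρ.re * u) ≤ Real.exp (-u / 2) := Real.exp_le_exp.mpr (by nlinarith)
  have part2 : Real.exp (-ρ.re * u) / 2 * ‖1 / q‖ ≤ 1.011 * Real.exp (-u / 2) * (1 / q).re := by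
    calc Real.exp (-ρ.re * u) / 2 * ‖1 / q‖ = Real.exp (-ρ.re * u) * (‖1 / q‖ / 2) := by ring
      _ ≤ Real.exp (-u / 2) * (1.011 * (1 / q).re) := by gcongr
      _ = _ := by ring
  have hG0 : 0 < |ρ.im| := abs_pos.mpr (by intro h; rw [h] at hg; norm_num at hg)
  obtain ⟨v, hv0, hv⟩ : ∃ v : ℝ, 0 < v ∧ v ^ 3 = |ρ.im| :=
    ⟨|ρ.im| ^ ((1 : ℝ) / 3), by positivity, by
      rw [← Real.rpow_natCast, ← Real.rpow_mul hG0.le]; norm_num⟩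
  have hzf := zero_free_region hz hβ.ne' hv0 hv
  have hex : 1 + (t ^ 3) ^ 2 / ρ.im ^ 2 ≤ Real.exp ((1 - ρ.re) * u) := by
    have h1 := one_add_cube_le_exp (y := t ^ 2 / v ^ 2) (by positivity)
    have h2 : (t ^ 2 / v ^ 2) ^ 3 = (t ^ 3) ^ 2 / ρ.im ^ 2 := by
      rw [← sq_abs ρ.im, ← hv]; ring
    rw [h2] at h1
    refine h1.trans (Real.exp_le_exp.mpr ?_)
    rw [htu, ← mul_div_assoc, div_le_iff₀ (by positivity)]
    nlinarith
  have hT : 0 ≤ (t ^ 3) ^ 2 := by positivity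
  generalize (t ^ 3) ^ 2 = T at *
  have part1 : Real.exp (-(1 - ρ.re) * u) / 2 * ‖1 / q‖ ≤
      0.5055 * (1 / (q + (T - 1 / 4 : ℝ))).re := by
    have hg0 : 0 < ρ.im ^ 2 := by linarith
    have s1 : Real.exp (-(1 - ρ.re) * u) ≤ 1 / (1 + T / ρ.im ^ 2) := by
      rw [neg_mul, Real.exp_neg, ← one_div]
      exact one_div_le_one_div_of_le (by positivity) hex
    have s2 : 1 / (1 + T / ρ.im ^ 2) * (1 / q.re) ≤ 1 / (q.re + T) := by
      rw [one_div_mul_one_div]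
      refine one_div_le_one_div_of_le (by positivity) ?_
      have : T ≤ T / ρ.im ^ 2 * q.re := by
        rw [div_mul_eq_mul_div, le_div_iff₀ hg0]
        nlinarith
      linarith
    have s3 : 1 / (q.re + T) ≤ 1.011 * (1 / (q + (T - 1 / 4 : ℝ))).re := by
      have hbp : 0 < q.re + (T - 1 / 4) := by linarith
      rw [one_div (q + _), inv_re, normSq_apply, add_re, add_im, ofReal_re, ofReal_im, add_zero,
        ← mul_div_assoc, div_le_div_iff₀ (by positivity)
          (by nlinarith [mul_pos hbp hbp, mul_self_nonneg q.im])]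
      have h5 : ρ.im ^ 2 - 1 / 4 ≤ q.re + (T - 1 / 4) := by linarith
      have h6 : q.re + T = (q.re + (T - 1 / 4)) + 1 / 4 := by ring
      rw [h6]
      generalize q.re + (T - 1 / 4) = b at *
      nlinarith
    calc Real.exp (-(1 - ρ.re) * u) / 2 * ‖1 / q‖
        ≤ 1 / (1 + T / ρ.im ^ 2) / 2 * (1 / q.re) := by gcongr
      _ = 1 / (1 + T / ρ.im ^ 2) * (1 / q.re) / 2 := by ring
      _ ≤ 1.011 * (1 / (q + (T - 1 / 4 : ℝ))).re / 2 := by linarith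
      _ = _ := by ring
  linarith

lemma exp_mul_norm_le {ρ : ℂ} (hz : xiFun ρ = 0) {u t : ℝ}
    (hu : 0 < u) (ht : 0 < t) (htu : t ^ 2 = 0.39 * u) :
    (Real.exp (-(1 - ρ.re) * u) + Real.exp (-ρ.re * u)) / 2 * ‖1 / (ρ * (1 - ρ))‖ ≤
      0.5055 * (1 / (ρ * (1 - ρ) + ((t ^ 3) ^ 2 - 1 / 4 : ℝ))).re +
        1.011 * Real.exp (-u / 2) * (1 / (ρ * (1 - ρ))).re := by
  rcases lt_trichotomy ρ.re (1 / 2) with h | h | h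
  · have := exp_mul_norm_le_of_half_lt (ρ := 1 - ρ) (by rw [xiFun_one_sub, hz])
      (by simp; linarith) hu ht htu
    rw [show (1 - ρ) * (1 - (1 - ρ)) = ρ * (1 - ρ) by ring, sub_re, one_re, sub_sub_cancel,
      add_comm (Real.exp _)] at this
    exact this
  · have hg := nineteen_le_im_sq hz
    have e := re_mul_one_sub ρ
    have e' := im_mul_one_sub ρ
    have hq := re_mul_one_sub_pos hz
    rw [h] at e e'
    norm_num at e'
    have h1 : ρ * (1 - ρ) = (((ρ * (1 - ρ)).re : ℝ) : ℂ) := Complex.ext (by simp) (by simpa using e')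
    rw [h1]
    generalize (ρ * (1 - ρ)).re = a at *
    rw [← ofReal_one, ← ofReal_add, ← ofReal_div, ← ofReal_div, ofReal_re, ofReal_re, norm_real,
      Real.norm_of_nonneg (by positivity), h]
    have h2 : 0 ≤ 1 / (a + ((t ^ 3) ^ 2 - 1 / 4)) := by
      have : 0 ≤ (t ^ 3) ^ 2 := by positivity
      apply div_nonneg zero_le_one
      linarith
    have h3 : -(1 - 1 / 2 : ℝ) * u = -u / 2 := by ring
    have h4 : -(1 / 2 : ℝ) * u = -u / 2 := by ring
    rw [h3, h4]
    have h5 : 0 ≤ Real.exp (-u / 2) * (1 / a) := by positivity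
    nlinarith
  · exact exp_mul_norm_le_of_half_lt hz h hu ht htu

lemma logDeriv_xiFun_ofReal_le {σ : ℝ} (hσ : 1 < σ) :
    (logDeriv xiFun σ).re ≤
      1 / σ + 1 / (σ - 1) + (Real.log σ - Real.log (2 * Real.pi)) / 2 := by
  have h1 := logDeriv_riemannZeta_three_four_one hσ 0
  simp only [ofReal_zero, mul_zero, zero_mul, add_zero] at h1
  have h2 := digamma_re_real_le (x := σ / 2) (by linarith)
  rw [logDeriv_xiFun_re (by simpa using hσ), xiArch,
    show (σ : ℂ) / 2 = ((σ / 2 : ℝ) : ℂ) by push_cast; ring, ← ofReal_one, ← ofReal_sub,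
    ← ofReal_div, ← ofReal_div, ofReal_re, ofReal_re]
  rw [Real.log_div (by linarith) (by norm_num)] at h2
  have a6 : Real.log (2 * Real.pi) = Real.log 2 + Real.log Real.pi :=
    Real.log_mul (by norm_num) Real.pi_ne_zero
  linarith

lemma tsum_norm_zeroTerm_le {u t : ℝ} (hu : 0 < u) (ht : 0 < t) (ht1 : 1 / 2 < t ^ 3)
    (htu : t ^ 2 = 0.39 * u) :
    ∑' ρ, ‖zeroTerm u ρ‖ ≤
      0.5055 * ((logDeriv xiFun ((t ^ 3 + 1 / 2 : ℝ) : ℂ)).re / t ^ 3) +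
        0.0506 * Real.exp (-u / 2) := by
  set s : ℂ := ((t ^ 3 + 1 / 2 : ℝ) : ℂ) with hs
  have hsre : 1 < s.re := by rw [hs, ofReal_re]; linarith
  have h1 := hasSum_re (hasSum_xi_symm (xiFun_ne_zero_of_one_le_re hsre.le))
  have h2 : HasSum (fun ρ : ℂ => (xiMult ρ : ℝ) *
      (1 / (ρ * (1 - ρ) + ((t ^ 3) ^ 2 - 1 / 4 : ℝ))).re) ((logDeriv xiFun s).re / t ^ 3) := by
    have h3 := h1.mul_left (1 / (2 * t ^ 3))
    convert! h3 using 1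
    · funext ρ
      have e1 : s * (s - 1) = (((t ^ 3) ^ 2 - 1 / 4 : ℝ) : ℂ) := by
        rw [hs]; push_cast; ring
      have e2 : (2 * s - 1) = ((2 * t ^ 3 : ℝ) : ℂ) := by rw [hs]; push_cast; ring
      rw [natCast_mul_re, e1, e2, div_eq_mul_one_div (((2 * t ^ 3 : ℝ) : ℂ)), re_ofReal_mul]
      have : 2 * t ^ 3 ≠ 0 := by positivity
      generalize (1 / (ρ * (1 - ρ) + (((t ^ 3) ^ 2 - 1 / 4 : ℝ) : ℂ))).re = X
      field_simp
    · rw [← ofReal_ofNat, re_ofReal_mul]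
      field_simp
  have h4 := (h2.mul_left 0.5055).add (hasSum_xi_inv.mul_left (1.011 * Real.exp (-u / 2)))
  have h5 := (summable_zeroTerm_norm hu.le).hasSum
  have h6 := (Equiv.subLeft (1 : ℂ)).hasSum_iff.mpr h5
  have h7 := ((h5.add h6).mul_left (1 / 2))
  have h8 : 1 / 2 * (∑' ρ, ‖zeroTerm u ρ‖ + ∑' ρ, ‖zeroTerm u ρ‖) ≤ _ := hasSum_le (fun ρ => ?_) h7 h4
  · have h9 := two_add_eulerMascheroni_sub_le
    have h10 : 1.011 * Real.exp (-u / 2) * (Real.eulerMascheroniConstant -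
        Real.log (4 * Real.pi) + 2) ≤ 1.011 * Real.exp (-u / 2) * (1 / 20) := by gcongr
    have := Real.exp_pos (-u / 2)
    linarith
  · simp only [Function.comp, Equiv.subLeft_apply]
    rw [norm_zeroTerm, norm_zeroTerm, xiMult_one_sub]
    rcases eq_or_ne (xiMult ρ) 0 with h0 | h0
    · simp [h0]
    have := exp_mul_norm_le (xiMult_ne_zero_iff.mp h0) hu ht htu
    rw [show (1 - ρ) * (1 - (1 - ρ)) = ρ * (1 - ρ) by ring, sub_re, one_re, sub_sub_cancel]
    calc _ = (xiMult ρ : ℝ) * ((Real.exp (-(1 - ρ.re) * u) + Real.exp (-ρ.re * u)) / 2 *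
            ‖1 / (ρ * (1 - ρ))‖) := by ring
      _ ≤ _ := mul_le_mul_of_nonneg_left this (Nat.cast_nonneg _)
      _ = _ := by ring

lemma log_le_div_mul_log_two {a : ℝ} (ha : 0 < a) (m k : ℕ) (hk : 0 < k) (h : a ^ k ≤ 2 ^ m) :
    Real.log a ≤ m / k * Real.log 2 := by
  have h1 := Real.log_le_log (by positivity) h
  rw [Real.log_pow, Real.log_pow] at h1
  have hk' : (0 : ℝ) < k := Nat.cast_pos.mpr hk
  rw [div_mul_eq_mul_div, le_div_iff₀ hk']
  linarith

lemma xi_bound_numeric {t : ℝ} (ht : 1.94 ≤ t) :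
    0.5055 * (1 / (t ^ 3 + 1 / 2) + 1 / (t ^ 3 + 1 / 2 - 1) +
      (Real.log (t ^ 3 + 1 / 2) - Real.log (2 * Real.pi)) / 2) + 0.0092 / t ≤
        0.1677 * t - 0.21294 / t := by
  have ht0 : 0 < t := by linarith
  obtain ⟨T, hT⟩ : ∃ T, T = t ^ 3 := ⟨_, rfl⟩
  have hT1 : 7.3 ≤ T := by
    have : (1.94 : ℝ) ^ 3 ≤ t ^ 3 := by gcongr
    rw [← hT] at this
    norm_num at this ⊢
    linarith
  have hT0 : 0 < T := by linarith
  have hl := log_le_tangent (x := T + 1 / 2) (a := T) (by linarith) (by linarith)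
  have hl2 : Real.log T = 3 * Real.log t := by rw [hT, Real.log_pow]; norm_num
  have e1 : (T + 1 / 2) / T = 1 + (1 / 2) / T := by field_simp
  have hsum : 1 / (T + 1 / 2) + 1 / (T + 1 / 2 - 1) ≤ 2.02 / T := by
    rw [div_add_div _ _ (by linarith) (by linarith),
      div_le_div_iff₀ (mul_pos (by linarith) (by linarith)) hT0]
    nlinarith
  have hpi := log_two_pi_ge
  have hlog2 := Real.log_two_lt_d9
  have h1 : 1 / (T + 1 / 2) + 1 / (T + 1 / 2 - 1) +
      (Real.log (T + 1 / 2) - Real.log (2 * Real.pi)) / 2 ≤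
      2.27 / T + 1.5 * Real.log t - 0.918 := by
    rw [e1, hl2] at hl
    have e2 : 2.27 / T = 2.02 / T + (1 / 2 / T) / 2 := by ring
    rw [e2]
    linarith
  rw [← hT]
  have key : ∀ a b c L : ℝ, 0 < a → 0 < b → b ≤ t → t ≤ c → Real.log a ≤ L →
      1.1475 / b ^ 3 + 0.2222 / b + 0.75825 * (L + b / a - 1) - 0.46404 - 0.1677 * b ≤ 0 →
      1.1475 / c ^ 3 + 0.2222 / c + 0.75825 * (L + c / a - 1) - 0.46404 - 0.1677 * c ≤ 0 →
      1.1475 / T + 0.2222 / t + 0.75825 * Real.log t - 0.46404 - 0.1677 * t ≤ 0 := by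
    intro a b c L ha hb hbt htc hL h2 h3
    have hc : 0 < c := by linarith
    have hconv : ConvexOn ℝ (Set.Ioi 0) fun x : ℝ =>
        1.1475 * x ^ (-3 : ℤ) + 0.2222 * x ^ (-1 : ℤ) +
          ((0.75825 / a - 0.1677) * x + (0.75825 * (L - 1) - 0.46404)) := by
      refine (((convexOn_zpow (-3)).smul (by norm_num)).add
        ((convexOn_zpow (-1)).smul (by norm_num))).add ⟨convex_Ioi 0, ?_⟩
      intro x _ y _ p q _ _ hpq
      simp only [smul_eq_mul]
      apply le_of_eq
      linear_combination -(0.75825 * (L - 1) - 0.46404) * hpq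
    have h4 := hconv.le_max_of_mem_Icc (x := b) (y := c) (z := t) hb hc ⟨hbt, htc⟩
    have h5 := log_le_tangent ht0 ha
    have e : ∀ x : ℝ, 1.1475 * x ^ (-3 : ℤ) + 0.2222 * x ^ (-1 : ℤ) +
        ((0.75825 / a - 0.1677) * x + (0.75825 * (L - 1) - 0.46404)) =
        1.1475 / x ^ 3 + 0.2222 / x + 0.75825 * (L + x / a - 1) - 0.46404 - 0.1677 * x := by
      intro x
      rw [zpow_neg, zpow_neg]
      norm_cast
      ring
    simp only [e] at h4
    rw [hT]
    have := h4.trans (max_le h2 h3)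
    linarith
  have fin : 1.1475 / T + 0.2222 / t + 0.75825 * Real.log t - 0.46404 - 0.1677 * t ≤ 0 := by
    rcases le_total t 2.6 with h | h
    · refine key 2.25 1.94 2.6 (34 / 29 * 0.6931471808) (by norm_num) (by norm_num) ht h ?_
        (by norm_num) (by norm_num)
      have := log_le_div_mul_log_two (a := 2.25) (by norm_num) 34 29 (by norm_num) (by norm_num)
      norm_num at this ⊢
      linarith
    rcases le_total t 3.4 with h' | h'
    · refine key 3 2.6 3.4 (27 / 17 * 0.6931471808) (by norm_num) (by norm_num) h h' ?_
        (by norm_num) (by norm_num)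
      have := log_le_div_mul_log_two (a := 3) (by norm_num) 27 17 (by norm_num) (by norm_num)
      norm_num at this ⊢
      linarith
    rcases le_total t 4.1 with h'' | h''
    · refine key 3.8 3.4 4.1 (27 / 14 * 0.6931471808) (by norm_num) (by norm_num) h' h'' ?_
        (by norm_num) (by norm_num)
      have := log_le_div_mul_log_two (a := 3.8) (by norm_num) 27 14 (by norm_num) (by norm_num)
      norm_num at this ⊢
      linarith
    · have h5 := log_le_tangent ht0 (show (0 : ℝ) < 4.6 by norm_num)
      have h6 := log_le_div_mul_log_two (a := 4.6) (by norm_num) 64 29 (by norm_num) (by norm_num)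
      have h7 : 1.1475 / T ≤ 0.0167 := by
        have : (4.1 : ℝ) ^ 3 ≤ t ^ 3 := by gcongr
        rw [← hT] at this
        rw [div_le_iff₀ hT0]
        norm_num at this ⊢
        linarith
      have h8 : 0.2222 / t ≤ 0.0542 := by
        rw [div_le_iff₀ ht0]
        linarith
      have e3 : t / 4.6 = 5 / 23 * t := by ring
      rw [e3] at h5
      norm_num at h5 h6 h7 h8 h'' ⊢
      linarith
  have e3 : 1.1475 / T = 0.5055 * (2.27 / T) + 0.000015 / T := by ring
  have e4 : 0.2222 / t = 0.0092 / t + 0.21294 / t + 0.00006 / t := by ring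
  have : 0 < 0.00006 / t := by positivity
  have : 0 < 0.000015 / T := by positivity
  rw [e3, e4] at fin
  linarith

lemma exp_terms_le {u : ℝ} (hu : 9.7 ≤ u) :
    0.0506 * Real.exp (-u / 2) + 2 * Real.exp (-u) ≤ 0.06 / u ^ 2 := by
  have hu0 : 0 < u := by linarith
  have h1 : 127 * (1 + (u / 2 - 4.85) + (u / 2 - 4.85) ^ 2 / 2) ≤ Real.exp (u / 2) := by
    have h2 := Real.quadratic_le_exp_of_nonneg (x := u / 2 - 4.85) (by linarith)
    have h3 : (127 : ℝ) ≤ Real.exp 4.85 := by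
      have := Real.exp_one_gt_d9
      have h4 : Real.exp 4.85 ^ 20 = Real.exp 1 ^ 97 := by
        rw [← Real.exp_nat_mul, ← Real.exp_nat_mul]
        norm_num
      refine le_of_pow_le_pow_left₀ (n := 20) (by norm_num) (by positivity) ?_
      rw [h4]
      have : (2.7182 : ℝ) ^ 97 ≤ Real.exp 1 ^ 97 := by
        gcongr
        linarith
      refine le_trans ?_ this
      norm_num
    have h5 : Real.exp (u / 2) = Real.exp 4.85 * Real.exp (u / 2 - 4.85) := by
      rw [← Real.exp_add]; ring_nf
    rw [h5]
    have : 0 ≤ u / 2 - 4.85 := by linarith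
    gcongr
  have e1 : Real.exp (-u / 2) = 1 / Real.exp (u / 2) := by
    rw [one_div, ← Real.exp_neg]; ring_nf
  have e2 : Real.exp (-u) = Real.exp (-u / 2) * Real.exp (-u / 2) := by
    rw [← Real.exp_add]; ring_nf
  have h0 : 0 < 127 * (1 + (u / 2 - 4.85) + (u / 2 - 4.85) ^ 2 / 2) := by
    have : 0 ≤ u / 2 - 4.85 := by linarith
    positivity
  have h6 : Real.exp (-u / 2) ≤ 1 / (127 * (1 + (u / 2 - 4.85) + (u / 2 - 4.85) ^ 2 / 2)) := by
    rw [e1]; exact one_div_le_one_div_of_le h0 h1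
  have h7 : Real.exp (-u / 2) ≤ 0.0079 := h6.trans (by
    rw [div_le_iff₀ h0]; nlinarith)
  have h8 : Real.exp (-u / 2) ≤ 0.86 / u ^ 2 := h6.trans (by
    rw [div_le_div_iff₀ h0 (by positivity)]
    nlinarith [mul_nonneg (sub_nonneg.2 hu) (sub_nonneg.2 hu)])
  have hp := Real.exp_pos (-u / 2)
  rw [e2]
  have e3 : 0.06 / u ^ 2 = 0.06 / 0.86 * (0.86 / u ^ 2) := by ring
  rw [e3]
  nlinarith

/-- The contribution of the zeros to the explicit formula is `O(1 / u)` with a small constant. -/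
theorem tsum_norm_zeroTerm_add_le {u : ℝ} (hu : 9.7 ≤ u) :
    ∑' ρ, ‖zeroTerm u ρ‖ + 2 * Real.exp (-u) ≤ 0.43 / u - 1.4 / u ^ 2 := by
  have hu0 : 0 < u := by linarith
  obtain ⟨t, ht⟩ : ∃ t, t = √(0.39 * u) := ⟨_, rfl⟩
  have htu : t ^ 2 = 0.39 * u := by rw [ht, Real.sq_sqrt (by linarith)]
  have ht1 : 1.94 ≤ t := by
    rw [ht]
    refine Real.le_sqrt_of_sq_le ?_
    norm_num at hu ⊢
    linarith
  have ht0 : 0 < t := by linarith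
  have hT : 5 < t ^ 3 := by
    have : (1.94 : ℝ) ^ 3 ≤ t ^ 3 := by gcongr
    norm_num at this ⊢
    linarith
  have h1 := tsum_norm_zeroTerm_le hu0 ht0 (by linarith) htu
  have h2 := logDeriv_xiFun_ofReal_le (σ := t ^ 3 + 1 / 2) (by linarith)
  have h3 := xi_bound_numeric ht1
  have h4 : 0.5055 * ((logDeriv xiFun ((t ^ 3 + 1 / 2 : ℝ) : ℂ)).re / t ^ 3) ≤
      (0.1677 * t - 0.21294 / t - 0.0092 / t) / t ^ 3 := by
    rw [← mul_div_assoc]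
    gcongr
    linarith
  have h5 := exp_terms_le hu
  have e : (0.1677 * t - 0.21294 / t - 0.0092 / t) / t ^ 3 =
      0.43 / u - 1.4 / u ^ 2 - 0.0092 / 0.1521 / u ^ 2 := by
    have hu' : u = t ^ 2 / 0.39 := by rw [htu]; ring
    rw [hu']
    field_simp
    norm_num
    ring
  have h6 : 0.06 / u ^ 2 ≤ 0.0092 / 0.1521 / u ^ 2 := by
    gcongr
    norm_num
  linarith

end ZeroSum

section Laplace

open Complex Topology MeasureTheory FourierTransform

lemma integrableOn_exp_neg_half : IntegrableOn (fun u : ℝ => Real.exp (-(1 / 2) * u)) (Set.Ioi 0) :=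
  integrableOn_exp_mul_Ioi (by norm_num) 0

lemma norm_exp_neg_mul {s : ℂ} (hs : s.re = 1) (u : ℝ) : ‖exp (-s * u)‖ = Real.exp (-u) := by
  rw [norm_exp]; simp [hs]

lemma norm_exp_mul_le {s : ℂ} (hs : s.re = 1) {z : ℂ} {u c : ℝ}
    (hz : ‖z‖ ≤ c * Real.exp (u / 2)) :
    ‖exp (-s * u) * z‖ ≤ c * Real.exp (-(1 / 2) * u) := by
  rw [norm_mul, norm_exp_neg_mul hs]
  calc Real.exp (-u) * ‖z‖ ≤ Real.exp (-u) * (c * Real.exp (u / 2)) := by gcongr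
    _ = c * (Real.exp (-u) * Real.exp (u / 2)) := by ring
    _ = _ := by rw [← Real.exp_add]; ring_nf

lemma integrableOn_laplace {s : ℂ} (hs : s.re = 1) {D : ℝ → ℂ} {c : ℝ}
    (hc : ContinuousOn D (Set.Ici 0)) (hb : ∀ u, 0 ≤ u → ‖D u‖ ≤ c * Real.exp (u / 2)) :
    IntegrableOn (fun u : ℝ => exp (-s * u) * D u) (Set.Ioi 0) := by
  refine Integrable.mono' (integrableOn_exp_neg_half.const_mul c) ?_ ?_
  · refine ContinuousOn.aestronglyMeasurable ?_ measurableSet_Ioi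
    exact (Continuous.continuousOn (by fun_prop)).mul (hc.mono Set.Ioi_subset_Ici_self)
  · filter_upwards [ae_restrict_mem measurableSet_Ioi] with u hu
    exact norm_exp_mul_le hs (hb u (le_of_lt hu))

/-- Uniqueness for the Laplace transform on a vertical line. -/
theorem eq_zero_of_laplace_eq_zero {D : ℝ → ℂ} {c : ℝ}
    (hc : ContinuousOn D (Set.Ici 0)) (hb : ∀ u, 0 ≤ u → ‖D u‖ ≤ c * Real.exp (u / 2))
    (h : ∀ s : ℂ, s.re = 1 → ∫ u in Set.Ioi (0 : ℝ), exp (-s * u) * D u = 0) {u : ℝ} (hu : 0 < u) :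
    D u = 0 := by
  set f : ℝ → ℂ := Set.indicator (Set.Ioi 0) (fun u => exp (-(1 : ℂ) * u) * D u) with hf
  have hfi : Integrable f :=
    (integrable_indicator_iff measurableSet_Ioi).mpr (integrableOn_laplace one_re hc hb)
  have hF : 𝓕 f = fun _ => 0 := by
    funext ξ
    rw [Real.fourier_real_eq_integral_exp_smul]
    have e : (fun v : ℝ => exp (((-2 * Real.pi * v * ξ : ℝ) : ℂ) * I) • f v) =
        Set.indicator (Set.Ioi 0)
          (fun u : ℝ => exp (-((1 : ℂ) + (2 * Real.pi * ξ : ℝ) * I) * u) * D u) := by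
      funext v
      by_cases hv : v ∈ Set.Ioi (0 : ℝ)
      · rw [hf, Set.indicator_of_mem hv, Set.indicator_of_mem hv, smul_eq_mul, ← mul_assoc,
          ← exp_add]
        congr 2
        push_cast
        ring
      · rw [hf, Set.indicator_of_notMem hv, Set.indicator_of_notMem hv, smul_zero]
    rw [e, integral_indicator measurableSet_Ioi]
    exact h _ (by simp)
  have hcont : ContinuousAt f u := by
    have h1 : f =ᶠ[𝓝 u] fun u => exp (-(1 : ℂ) * u) * D u := by
      filter_upwards [Ioi_mem_nhds hu] with v hv
      exact Set.indicator_of_mem hv _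
    refine ContinuousAt.congr ?_ h1.symm
    exact (Continuous.continuousAt (by fun_prop)).mul (hc.continuousAt (Ici_mem_nhds hu))
  have hinv := hfi.fourierInv_fourier_eq (by rw [hF]; exact integrable_zero _ _ _) hcont
  rw [hF] at hinv
  have h0 : f u = 0 := by
    rw [← hinv, Real.fourierInv_eq]
    simp
  rw [hf, Set.indicator_of_mem (Set.mem_Ioi.mpr hu)] at h0
  exact (mul_eq_zero.mp h0).resolve_left (exp_ne_zero _)

section Series

variable {ι : Type*} {f : ι → ℝ → ℂ} {b : ι → ℝ}

lemma continuousOn_tsum_of_exp_bound (hf : ∀ i, Continuous (f i))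
    (hb : ∀ i u, 0 ≤ u → ‖f i u‖ ≤ b i * Real.exp (u / 2)) (hs : Summable b) :
    ContinuousOn (fun u => ∑' i, f i u) (Set.Ici 0) := by
  intro u hu
  have hnn : ∀ i, 0 ≤ b i := by
    intro i
    have := (norm_nonneg _).trans (hb i 0 le_rfl)
    simpa using this
  have h1 : ContinuousOn (fun u => ∑' i, f i u) (Set.Icc 0 (u + 1)) := by
    refine continuousOn_tsum (fun i => (hf i).continuousOn)
      (hs.mul_right (Real.exp ((u + 1) / 2))) fun i v hv => (hb i v hv.1).trans ?_
    have := hv.2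
    have := hnn i
    gcongr
  refine (h1 u ⟨hu, by linarith⟩).mono_of_mem_nhdsWithin ?_
  have : Set.Iio (u + 1) ∈ 𝓝[Set.Ici 0] u := mem_nhdsWithin_of_mem_nhds (Iio_mem_nhds (by linarith))
  filter_upwards [this, self_mem_nhdsWithin] with v hv1 hv2
  exact ⟨hv2, le_of_lt hv1⟩

lemma norm_tsum_le_of_exp_bound (hb : ∀ i u, 0 ≤ u → ‖f i u‖ ≤ b i * Real.exp (u / 2))
    (hs : Summable b) {u : ℝ} (hu : 0 ≤ u) :
    ‖∑' i, f i u‖ ≤ (∑' i, b i) * Real.exp (u / 2) := by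
  rw [← tsum_mul_right]
  exact tsum_of_norm_bounded (hs.mul_right _).hasSum fun i => hb i u hu

lemma hasSum_laplace [Countable ι] (hf : ∀ i, Continuous (f i))
    (hb : ∀ i u, 0 ≤ u → ‖f i u‖ ≤ b i * Real.exp (u / 2)) (hs : Summable b) {s : ℂ}
    (hs1 : s.re = 1) :
    HasSum (fun i => ∫ u in Set.Ioi (0 : ℝ), exp (-s * u) * f i u)
      (∫ u in Set.Ioi (0 : ℝ), exp (-s * u) * ∑' i, f i u) := by
  have hI : ∀ i, IntegrableOn (fun u : ℝ => exp (-s * u) * f i u) (Set.Ioi 0) := fun i =>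
    integrableOn_laplace hs1 (hf i).continuousOn (hb i)
  have h := hasSum_integral_of_summable_integral_norm (μ := volume.restrict (Set.Ioi (0 : ℝ)))
    (F := fun i (u : ℝ) => exp (-s * u) * f i u) hI ?_
  · simpa only [tsum_mul_left] using h
  · refine Summable.of_nonneg_of_le (fun i => by positivity) (fun i => ?_)
      (hs.mul_right (∫ u in Set.Ioi (0 : ℝ), Real.exp (-(1 / 2) * u)))
    rw [← integral_const_mul]
    refine setIntegral_mono_on (hI i).norm (integrableOn_exp_neg_half.const_mul _)
      measurableSet_Ioi fun u hu => ?_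
    exact norm_exp_mul_le hs1 (hb i u (le_of_lt hu))

end Series

lemma laplace_exp {s a : ℂ} (h : 0 < (s + a).re) :
    ∫ u in Set.Ioi (0 : ℝ), exp (-s * u) * exp (-a * u) = 1 / (s + a) := by
  have := integral_exp_mul_complex_Ioi (a := -(s + a)) (by rw [neg_re]; linarith) 0
  simp only [← exp_add]
  convert this using 1
  · refine integral_congr_ae (Eventually.of_forall fun u => ?_)
    simp only
    ring_nf
  · rw [neg_div_neg_eq]
    simp

lemma norm_ofReal_le_exp {u : ℝ} (hu : 0 ≤ u) : ‖(u : ℂ)‖ ≤ 2 * Real.exp (u / 2) := by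
  rw [norm_real, Real.norm_of_nonneg hu]
  linarith [Real.add_one_le_exp (u / 2)]

lemma laplace_id {s : ℂ} (h : s.re = 1) :
    ∫ u in Set.Ioi (0 : ℝ), exp (-s * u) * u = 1 / s ^ 2 := by
  have hs : s ≠ 0 := ne_zero_of_re_pos (by rw [h]; norm_num)
  have hd : ∀ u ∈ Set.Ici (0 : ℝ), HasDerivAt
      (fun u : ℝ => -(exp (-s * u) * (u / s + 1 / s ^ 2))) (exp (-s * u) * u) u := by
    intro u _
    have h1 : HasDerivAt (fun u : ℝ => (u : ℂ)) 1 u := ofRealCLM.hasDerivAt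
    have h2 : HasDerivAt (fun u : ℝ => exp (-s * u)) (exp (-s * u) * (-s * 1)) u :=
      (h1.const_mul (-s)).cexp
    have h3 := (h2.fun_mul ((h1.div_const s).add_const (1 / s ^ 2))).fun_neg
    refine h3.congr_deriv ?_
    field_simp
    ring
  have hi := integrableOn_laplace (D := fun u => (u : ℂ)) h continuous_ofReal.continuousOn
    (fun u hu => norm_ofReal_le_exp hu)
  have ht : Tendsto (fun u : ℝ => -(exp (-s * u) * (u / s + 1 / s ^ 2))) atTop (𝓝 0) := by
    have h0 : Tendsto (fun u : ℝ => u ^ 1 * Real.exp (-u) * ‖1 / s‖ +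
        u ^ 0 * Real.exp (-u) * ‖1 / s ^ 2‖) atTop (𝓝 0) := by
      have := ((Real.tendsto_pow_mul_exp_neg_atTop_nhds_zero 1).mul_const ‖1 / s‖).add
        ((Real.tendsto_pow_mul_exp_neg_atTop_nhds_zero 0).mul_const ‖1 / s ^ 2‖)
      rwa [zero_mul, zero_mul, add_zero] at this
    refine squeeze_zero_norm' ?_ h0
    filter_upwards [eventually_ge_atTop 0] with u hu
    rw [norm_neg, norm_mul, norm_exp_neg_mul h]
    have : ‖(u : ℂ) / s + 1 / s ^ 2‖ ≤ u * ‖1 / s‖ + ‖1 / s ^ 2‖ := by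
      refine (norm_add_le _ _).trans ?_
      rw [div_eq_mul_one_div, norm_mul, norm_real, Real.norm_of_nonneg hu]
    calc Real.exp (-u) * ‖(u : ℂ) / s + 1 / s ^ 2‖
        ≤ Real.exp (-u) * (u * ‖1 / s‖ + ‖1 / s ^ 2‖) := by gcongr
      _ = _ := by ring
  rw [integral_Ioi_of_hasDerivAt_of_tendsto' hd hi ht]
  simp

end Laplace

section ExplicitFormula

open Complex Topology MeasureTheory ArithmeticFunction

/-- The `n`-th summand of the weighted Chebyshev function
`∑ n ≤ exp u, Λ n (1 / n - exp (-u))`. -/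
noncomputable def chebTerm (n : ℕ) (u : ℝ) : ℝ := Λ n * max (1 / (n : ℝ) - Real.exp (-u)) 0

lemma continuous_chebTerm (n : ℕ) : Continuous (chebTerm n) := by
  unfold chebTerm
  fun_prop

lemma chebTerm_nonneg (n : ℕ) (u : ℝ) : 0 ≤ chebTerm n u :=
  mul_nonneg vonMangoldt_nonneg (le_max_right _ _)

lemma chebTerm_le (n : ℕ) (u : ℝ) :
    chebTerm n u ≤ Λ n / (n : ℝ) ^ (3 / 2 : ℝ) * Real.exp (u / 2) := by
  rcases Nat.eq_zero_or_pos n with rfl | hn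
  · simp [chebTerm]
  have hn' : (0 : ℝ) < n := Nat.cast_pos.mpr hn
  rw [chebTerm, div_mul_eq_mul_div, mul_div_assoc]
  refine mul_le_mul_of_nonneg_left ?_ vonMangoldt_nonneg
  refine max_le ?_ (by positivity)
  rcases le_or_gt (n : ℝ) (Real.exp u) with h | h
  · have h1 : (n : ℝ) ^ (1 / 2 : ℝ) ≤ Real.exp (u / 2) := by
      rw [show u / 2 = u * (1 / 2) by ring, Real.exp_mul]
      gcongr
    have h2 : (n : ℝ) ^ (3 / 2 : ℝ) = n * (n : ℝ) ^ (1 / 2 : ℝ) := by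
      rw [show (3 / 2 : ℝ) = 1 + 1 / 2 by norm_num, Real.rpow_add hn', Real.rpow_one]
    have h3 : 1 / (n : ℝ) ≤ Real.exp (u / 2) / (n : ℝ) ^ (3 / 2 : ℝ) := by
      rw [h2, div_le_div_iff₀ hn' (by positivity)]
      nlinarith
    linarith [Real.exp_pos (-u)]
  · have h1 : 1 / (n : ℝ) ≤ Real.exp (-u) := by
      rw [Real.exp_neg, ← one_div]
      exact one_div_le_one_div_of_le (Real.exp_pos u) h.le
    have : 0 ≤ Real.exp (u / 2) / (n : ℝ) ^ (3 / 2 : ℝ) := by positivity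
    linarith

lemma norm_ofReal_chebTerm_le (n : ℕ) (u : ℝ) :
    ‖(chebTerm n u : ℂ)‖ ≤ Λ n / (n : ℝ) ^ (3 / 2 : ℝ) * Real.exp (u / 2) := by
  rw [norm_real, Real.norm_of_nonneg (chebTerm_nonneg n u)]
  exact chebTerm_le n u

lemma summable_vonMangoldt_div_rpow :
    Summable fun n : ℕ => Λ n / (n : ℝ) ^ (3 / 2 : ℝ) := by
  have h : Summable fun n => ‖LSeries.term (fun n => (Λ n : ℂ)) (3 / 2 : ℝ) n‖ :=
    (LSeriesSummable_vonMangoldt (s := (3 / 2 : ℝ)) (by rw [ofReal_re]; norm_num)).norm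
  refine h.congr fun n => ?_
  rw [LSeries.term_def]
  split_ifs with h0
  · simp [h0]
  · rw [norm_div, norm_real, Real.norm_of_nonneg vonMangoldt_nonneg,
      norm_natCast_cpow_of_pos (Nat.pos_of_ne_zero h0), ofReal_re]

lemma laplace_chebTerm {s : ℂ} (hs : s.re = 1) (n : ℕ) :
    ∫ u in Set.Ioi (0 : ℝ), exp (-s * u) * (chebTerm n u : ℂ) =
      LSeries.term (fun n => (Λ n : ℂ)) (s + 1) n / (s * (s + 1)) := by
  rcases Nat.eq_zero_or_pos n with rfl | hn
  · simp [chebTerm]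
  have hn' : (0 : ℝ) < n := Nat.cast_pos.mpr hn
  have hn1 : (n : ℂ) ≠ 0 := Nat.cast_ne_zero.mpr hn.ne'
  have hl : 0 ≤ Real.log n := Real.log_natCast_nonneg n
  have hs0 : s ≠ 0 := ne_zero_of_re_pos (by rw [hs]; norm_num)
  have hs1 : s + 1 ≠ 0 := ne_zero_of_re_pos (by rw [add_re, hs]; norm_num)
  have hsub : Set.Ioi (Real.log n) ⊆ Set.Ioi (0 : ℝ) := Set.Ioi_subset_Ioi hl
  rw [setIntegral_eq_of_subset_of_forall_sdiff_eq_zero measurableSet_Ioi hsub]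
  · have h1 : ∀ u ∈ Set.Ioi (Real.log n), exp (-s * u) * (chebTerm n u : ℂ) =
        (Λ n : ℂ) * (1 / n) * exp (-s * u) - (Λ n : ℂ) * exp (-(s + 1) * u) := by
      intro u hu
      have h2 : Real.exp (-u) ≤ 1 / (n : ℝ) := by
        rw [Real.exp_neg, ← one_div]
        refine one_div_le_one_div_of_le hn' ?_
        rw [← Real.exp_log hn']
        exact Real.exp_le_exp.mpr (le_of_lt hu)
      rw [chebTerm, max_eq_left (by linarith)]
      rw [show -(s + 1) * (u : ℂ) = -s * u + -u by ring, exp_add]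
      push_cast
      ring
    have hi1 : IntegrableOn (fun u : ℝ => exp (-s * u)) (Set.Ioi (Real.log n)) :=
      integrableOn_exp_mul_complex_Ioi (by rw [neg_re, hs]; norm_num) _
    have hi2 : IntegrableOn (fun u : ℝ => exp (-(s + 1) * u)) (Set.Ioi (Real.log n)) :=
      integrableOn_exp_mul_complex_Ioi (by rw [neg_re, add_re, hs]; norm_num) _
    rw [setIntegral_congr_fun measurableSet_Ioi h1, integral_sub (hi1.const_mul _) (hi2.const_mul _),
      integral_const_mul, integral_const_mul,
      integral_exp_mul_complex_Ioi (by rw [neg_re, hs]; norm_num),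
      integral_exp_mul_complex_Ioi (by rw [neg_re, add_re, hs]; norm_num),
      LSeries.term_def, if_neg hn.ne', cpow_def_of_ne_zero hn1, natCast_log]
    have e1 : -s * Complex.log n = -(Complex.log n * s) := by ring
    have e2 : -(s + 1) * Complex.log n = -(Complex.log n * (s + 1)) := by ring
    have e3 : exp (Complex.log n * (s + 1)) = exp (Complex.log n * s) * n := by
      rw [mul_add, exp_add, mul_one, exp_log hn1]
    rw [e1, e2, exp_neg, exp_neg, e3]
    have := exp_ne_zero (Complex.log n * s)
    field_simp
    ring
  · rintro u ⟨-, hu⟩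
    have h2 : 1 / (n : ℝ) ≤ Real.exp (-u) := by
      rw [Real.exp_neg, ← one_div]
      refine one_div_le_one_div_of_le (Real.exp_pos u) ?_
      rw [← Real.exp_log hn']
      exact Real.exp_le_exp.mpr (by simpa using hu)
    rw [chebTerm, max_eq_right (by linarith)]
    simp

lemma laplace_tsum_chebTerm {s : ℂ} (hs : s.re = 1) :
    ∫ u in Set.Ioi (0 : ℝ), exp (-s * u) * ∑' n, (chebTerm n u : ℂ) =
      -logDeriv riemannZeta (s + 1) / (s * (s + 1)) := by
  have h := hasSum_laplace (f := fun n u => (chebTerm n u : ℂ))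
    (fun n => continuous_ofReal.comp (continuous_chebTerm n)) (fun n u _ => norm_ofReal_chebTerm_le n u)
    summable_vonMangoldt_div_rpow hs
  have hs2 : 1 < (s + 1).re := by rw [add_re, hs, one_re]; norm_num
  have h2 := (LSeriesSummable_vonMangoldt hs2).hasSum.div_const (s * (s + 1))
  simp only [laplace_chebTerm hs] at h
  rw [h.unique h2]
  congr 1
  have := LSeries_vonMangoldt_eq_deriv_riemannZeta_div hs2
  rw [LSeries] at this
  rw [this, logDeriv_apply, neg_div]

lemma integrableOn_exp_mul_exp {s a : ℂ} (h : 0 < (s + a).re) :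
    IntegrableOn (fun u : ℝ => exp (-s * u) * exp (-a * u)) (Set.Ioi 0) := by
  refine (integrableOn_exp_mul_complex_Ioi (a := -(s + a)) (by rw [neg_re]; linarith) 0).congr ?_
  refine Eventually.of_forall fun u => ?_
  simp only [← exp_add]
  ring_nf

/-- The contribution of the zero `ρ` to the explicit formula. -/
noncomputable def zeroPart (ρ : ℂ) (u : ℝ) : ℂ :=
  (xiMult ρ : ℂ) / (ρ * (1 - ρ)) * (exp (-(1 - ρ) * u) - exp (-(1 : ℂ) * u))

lemma continuous_zeroPart (ρ : ℂ) : Continuous (zeroPart ρ) := by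
  unfold zeroPart
  fun_prop

lemma norm_zeroPart_le (ρ : ℂ) (u : ℝ) (hu : 0 ≤ u) :
    ‖zeroPart ρ u‖ ≤ 4 * ((xiMult ρ : ℝ) * (1 / (ρ * (1 - ρ))).re) * Real.exp (u / 2) := by
  rcases eq_or_ne (xiMult ρ) 0 with h0 | h0
  · simp [zeroPart, h0]
  have hz := xiMult_ne_zero_iff.mp h0
  have hb := re_lt_one_of_xiFun_eq_zero hz
  have h1 : ‖exp (-(1 - ρ) * u)‖ ≤ 1 := by
    rw [norm_exp, Real.exp_le_one_iff]
    simp only [mul_re, neg_re, sub_re, one_re, ofReal_re, ofReal_im, mul_zero, sub_zero]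
    nlinarith
  have h2 : ‖exp (-(1 : ℂ) * u)‖ ≤ 1 := by
    rw [norm_exp, Real.exp_le_one_iff]
    simpa using hu
  have h3 := norm_one_div_le hz
  have h4 : 0 ≤ (1 / (ρ * (1 - ρ))).re := re_one_div_nonneg (re_mul_one_sub_pos hz).le
  have h5 : 1 ≤ Real.exp (u / 2) := Real.one_le_exp (by linarith)
  rw [zeroPart, norm_mul, div_eq_mul_one_div, norm_mul, norm_natCast]
  calc (xiMult ρ : ℝ) * ‖1 / (ρ * (1 - ρ))‖ * ‖exp (-(1 - ρ) * u) - exp (-(1 : ℂ) * u)‖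
      ≤ (xiMult ρ : ℝ) * (2 * (1 / (ρ * (1 - ρ))).re) * (1 + 1) := by
        gcongr
        exact (norm_sub_le _ _).trans (add_le_add h1 h2)
    _ = 4 * ((xiMult ρ : ℝ) * (1 / (ρ * (1 - ρ))).re) * 1 := by ring
    _ ≤ _ := by gcongr

lemma laplace_zeroPart {s : ℂ} (hs : s.re = 1) (ρ : ℂ) :
    ∫ u in Set.Ioi (0 : ℝ), exp (-s * u) * zeroPart ρ u =
      -((xiMult ρ : ℂ) * (1 / (s + 1 - ρ) - 1 / (1 - ρ))) / (s * (s + 1)) := by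
  rcases eq_or_ne (xiMult ρ) 0 with h0 | h0
  · simp [zeroPart, h0]
  have hz := xiMult_ne_zero_iff.mp h0
  have hb := re_lt_one_of_xiFun_eq_zero hz
  have ha := re_pos_of_xiFun_eq_zero hz
  have hs0 : s ≠ 0 := ne_zero_of_re_pos (by rw [hs]; norm_num)
  have hs1 : s + 1 ≠ 0 := ne_zero_of_re_pos (by rw [add_re, hs]; norm_num)
  have hre2 : 0 < (s + (1 - ρ)).re := by simp; linarith
  have hre1 : 0 < (s + 1).re := by simp; linarith
  have hs2 : s + (1 - ρ) ≠ 0 := ne_zero_of_re_pos hre2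
  have hρ : ρ ≠ 0 := ne_zero_of_re_pos ha
  have hρ1 : 1 - ρ ≠ 0 := ne_zero_of_re_pos (by simp; linarith)
  have e : ∀ u : ℝ, exp (-s * u) * zeroPart ρ u =
      (xiMult ρ : ℂ) / (ρ * (1 - ρ)) * (exp (-s * u) * exp (-(1 - ρ) * u)) -
      (xiMult ρ : ℂ) / (ρ * (1 - ρ)) * (exp (-s * u) * exp (-(1 : ℂ) * u)) := by
    intro u
    rw [zeroPart]
    ring
  simp only [e]
  rw [integral_sub ((integrableOn_exp_mul_exp hre2).const_mul _)
    ((integrableOn_exp_mul_exp hre1).const_mul _), integral_const_mul,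
    integral_const_mul, laplace_exp hre2, laplace_exp hre1, add_sub_assoc s 1 ρ]
  field_simp
  ring

/-- The contribution of the `n`-th trivial zero to the explicit formula. -/
noncomputable def trivialPart (n : ℕ) (u : ℝ) : ℂ :=
  1 / ((2 * n + 2) * (2 * n + 3)) * (exp (-(1 : ℂ) * u) - exp (-(2 * n + 3 : ℂ) * u))

lemma continuous_trivialPart (n : ℕ) : Continuous (trivialPart n) := by
  unfold trivialPart
  fun_prop

lemma norm_trivialPart_le (n : ℕ) (u : ℝ) (hu : 0 ≤ u) :
    ‖trivialPart n u‖ ≤ 2 * (1 / ((2 * n + 2) * (2 * n + 3) : ℝ)) * Real.exp (u / 2) := by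
  have h1 : ‖exp (-(2 * n + 3 : ℂ) * u)‖ ≤ 1 := by
    rw [norm_exp, Real.exp_le_one_iff]
    have : (-(2 * n + 3 : ℂ) * u).re = -(2 * n + 3 : ℝ) * u := by
      rw [show (-(2 * n + 3 : ℂ) * u) = ((-(2 * n + 3 : ℝ) * u : ℝ) : ℂ) by push_cast; ring,
        ofReal_re]
    rw [this]
    nlinarith [Nat.cast_nonneg (α := ℝ) n]
  have h2 : ‖exp (-(1 : ℂ) * u)‖ ≤ 1 := by
    rw [norm_exp, Real.exp_le_one_iff]
    simpa using hu
  have h5 : 1 ≤ Real.exp (u / 2) := Real.one_le_exp (by linarith)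
  have h6 : ‖(1 / ((2 * n + 2) * (2 * n + 3)) : ℂ)‖ = 1 / ((2 * n + 2) * (2 * n + 3) : ℝ) := by
    rw [show (1 / ((2 * n + 2) * (2 * n + 3)) : ℂ) =
      ((1 / ((2 * n + 2) * (2 * n + 3)) : ℝ) : ℂ) by push_cast; ring, norm_real,
      Real.norm_of_nonneg (by positivity)]
  rw [trivialPart, norm_mul, h6]
  calc _ ≤ 1 / ((2 * n + 2) * (2 * n + 3) : ℝ) * (1 + 1) := by
        gcongr
        exact (norm_sub_le _ _).trans (add_le_add h2 h1)
    _ = 2 * (1 / ((2 * n + 2) * (2 * n + 3) : ℝ)) * 1 := by ring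
    _ ≤ _ := by gcongr

lemma summable_trivial_coeff : Summable fun n : ℕ => 1 / ((2 * n + 2) * (2 * n + 3) : ℝ) := by
  refine Summable.of_nonneg_of_le (fun n => by positivity) (fun n => ?_)
    ((summable_nat_add_iff 1).mpr (Real.summable_one_div_nat_pow.mpr (le_refl 2)))
  refine one_div_le_one_div_of_le (by positivity) ?_
  push_cast
  nlinarith [Nat.cast_nonneg (α := ℝ) n]

lemma laplace_trivialPart {s : ℂ} (hs : s.re = 1) (n : ℕ) :
    ∫ u in Set.Ioi (0 : ℝ), exp (-s * u) * trivialPart n u =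
      (1 / (2 * n + 3) - 1 / (2 * n + 3 + s)) / (s * (s + 1)) := by
  have hs0 : s ≠ 0 := ne_zero_of_re_pos (by rw [hs]; norm_num)
  have hs1 : s + 1 ≠ 0 := ne_zero_of_re_pos (by rw [add_re, hs]; norm_num)
  have e0 : (2 * n + 3 : ℂ) = ((2 * n + 3 : ℝ) : ℂ) := by push_cast; ring
  have hre2 : 0 < (s + (2 * n + 3)).re := by
    rw [e0, add_re, ofReal_re, hs]; positivity
  have hre1 : 0 < (s + 1).re := by simp; linarith
  have hs2 : s + (2 * n + 3) ≠ 0 := ne_zero_of_re_pos hre2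
  have hs2' : 2 * n + 3 + s ≠ 0 := by rwa [add_comm]
  have hn3 : (2 * n + 3 : ℂ) ≠ 0 := by exact_mod_cast (by omega : 2 * n + 3 ≠ 0)
  have hn2 : (2 * n + 2 : ℂ) ≠ 0 := by exact_mod_cast (by omega : 2 * n + 2 ≠ 0)
  have e : ∀ u : ℝ, exp (-s * u) * trivialPart n u =
      1 / ((2 * n + 2) * (2 * n + 3)) * (exp (-s * u) * exp (-(1 : ℂ) * u)) -
      1 / ((2 * n + 2) * (2 * n + 3)) * (exp (-s * u) * exp (-(2 * n + 3 : ℂ) * u)) := by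
    intro u
    rw [trivialPart]
    ring
  rw [integral_congr_ae (Eventually.of_forall e),
    integral_sub ((integrableOn_exp_mul_exp hre1).const_mul _)
      ((integrableOn_exp_mul_exp hre2).const_mul _), integral_const_mul,
    integral_const_mul, laplace_exp hre2, laplace_exp hre1]
  rw [add_comm (2 * n + 3 : ℂ) s]
  field_simp
  ring

lemma hasSum_trivial {s : ℂ} (hs : s.re = 1) :
    HasSum (fun n : ℕ => 1 / (2 * n + 3 : ℂ) - 1 / (2 * n + 3 + s))
      ((digamma ((s + 1) / 2) + 2 / (s + 1)) / 2 - (2 - 2 * Real.log 2 - Real.eulerMascheroniConstant) / 2) := by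
  have hz : 0 < ((s + 1) / 2).re := by
    rw [show (s + 1) / 2 = (s + 1) / ((2 : ℝ) : ℂ) by push_cast; rfl, div_ofReal_re, add_re, hs]
    norm_num
  have hh : 0 < ((1 / 2 : ℂ)).re := by norm_num
  have d1 := digamma_apply_add_one _ (ne_neg_nat_of_re_pos hz)
  have d2 := digamma_apply_add_one _ (ne_neg_nat_of_re_pos hh)
  have h1 := hasSum_digamma (z := (s + 1) / 2 + 1) (by rw [add_re, one_re]; linarith)
  have h2 := hasSum_digamma (z := 1 / 2 + 1) (by norm_num)
  rw [d1] at h1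
  rw [d2, digamma_one_half] at h2
  have h3 := (h1.sub h2).div_const 2
  have hs1 : s + 1 ≠ 0 := ne_zero_of_re_pos (by rw [add_re, hs]; norm_num)
  convert! h3 using 1
  · funext n
    have e0 : (2 * n + 3 : ℂ) = ((2 * n + 3 : ℝ) : ℂ) := by push_cast; ring
    have hn3 : (2 * n + 3 : ℂ) ≠ 0 := by exact_mod_cast (by omega : 2 * n + 3 ≠ 0)
    have hs2 : 2 * n + 3 + s ≠ 0 := ne_zero_of_re_pos (by
      rw [e0, add_re, ofReal_re, hs]; positivity)
    rw [show (n : ℂ) + ((s + 1) / 2 + 1) = (2 * n + 3 + s) / 2 by ring,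
      show (n : ℂ) + (1 / 2 + 1) = (2 * n + 3) / 2 by ring]
    field_simp
    ring
  · rw [inv_div, ofReal_log (by norm_num)]
    push_cast
    ring

/-- The set of zeros of the completed zeta function. -/
def xiZeros : Set ℂ := {ρ | xiMult ρ ≠ 0}

lemma countable_xiZeros : Countable xiZeros := by
  have h := hasSum_xi_inv.summable.countable_support
  refine (h.mono fun ρ (hρ : xiMult ρ ≠ 0) => ?_).to_subtype
  rw [Function.mem_support]
  have hz := xiMult_ne_zero_iff.mp hρ
  have := norm_one_div_le hz
  have hq : ρ * (1 - ρ) ≠ 0 := by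
    intro h
    have := re_mul_one_sub_pos hz
    rw [h] at this
    simp at this
  have : 0 < ‖1 / (ρ * (1 - ρ))‖ := norm_pos_iff.mpr (one_div_ne_zero hq)
  have : 0 < (xiMult ρ : ℝ) := by positivity
  have : 0 < (1 / (ρ * (1 - ρ))).re := by linarith
  positivity

lemma support_zeroPart (u : ℝ) : Function.support (fun ρ => zeroPart ρ u) ⊆ xiZeros := by
  intro ρ hρ h
  apply hρ
  simp [zeroPart, h]

lemma laplace_tsum_zeroPart {s : ℂ} (hs : s.re = 1) :
    ∫ u in Set.Ioi (0 : ℝ), exp (-s * u) * ∑' ρ : xiZeros, zeroPart ρ u =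
      -(logDeriv xiFun (s + 1) - logDeriv xiFun 1) / (s * (s + 1)) := by
  have := countable_xiZeros
  have h := hasSum_laplace (f := fun (ρ : xiZeros) u => zeroPart ρ u)
    (fun ρ => continuous_zeroPart ρ) (fun ρ => norm_zeroPart_le ρ)
    ((hasSum_xi_inv.summable.mul_left 4).subtype _) hs
  have h1 := (hasSum_xi (xiFun_ne_zero_of_one_le_re (s := s + 1) (by simp [hs]))).sub
    (hasSum_xi (xiFun_ne_zero_of_one_le_re (s := 1) (by simp)))
  have h2 := (h1.neg).div_const (s * (s + 1))
  have h3 := (hasSum_subtype_iff_of_support_subset (s := xiZeros) (fun ρ hρ h => ?_)).mpr h2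
  · refine h.unique ?_
    convert! h3 using 1
    · funext ρ
      rw [laplace_zeroPart hs]
      simp only [Function.comp]
      ring
    · ring
  · apply hρ
    simp [h]

lemma laplace_tsum_trivialPart {s : ℂ} (hs : s.re = 1) :
    ∫ u in Set.Ioi (0 : ℝ), exp (-s * u) * ∑' n, trivialPart n u =
      ((digamma ((s + 1) / 2) + 2 / (s + 1)) / 2 -
        (2 - 2 * Real.log 2 - Real.eulerMascheroniConstant) / 2) / (s * (s + 1)) := by
  have h := hasSum_laplace (f := trivialPart) continuous_trivialPart norm_trivialPart_le
    (summable_trivial_coeff.mul_left 2) hs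
  simp only [laplace_trivialPart hs] at h
  exact h.unique ((hasSum_trivial hs).div_const _)

theorem explicit_formula {u : ℝ} (hu : 0 < u) :
    ∑' n, (chebTerm n u : ℂ) - u + (1 + Real.eulerMascheroniConstant : ℝ) =
      (1 + Real.eulerMascheroniConstant : ℝ) * exp (-(1 : ℂ) * u) + ∑' ρ : xiZeros, zeroPart ρ u +
        ∑' n, trivialPart n u := by
  have hcz := countable_xiZeros
  set k : ℝ := 1 + Real.eulerMascheroniConstant with hk
  have b1 := fun n u => norm_ofReal_chebTerm_le n u
  have s1 := summable_vonMangoldt_div_rpow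
  have s2 : Summable fun ρ : xiZeros => 4 * ((xiMult ρ : ℝ) * (1 / ((ρ : ℂ) * (1 - ρ))).re) :=
    (hasSum_xi_inv.summable.mul_left 4).subtype _
  have s3 := summable_trivial_coeff.mul_left 2
  have c1 : ContinuousOn (fun u => ∑' n, (chebTerm n u : ℂ)) (Set.Ici 0) :=
    continuousOn_tsum_of_exp_bound (fun n => continuous_ofReal.comp (continuous_chebTerm n))
      (fun n u _ => b1 n u) s1
  have c2 : ContinuousOn (fun u => ∑' ρ : xiZeros, zeroPart ρ u) (Set.Ici 0) :=
    continuousOn_tsum_of_exp_bound (fun ρ => continuous_zeroPart ρ)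
      (fun ρ => norm_zeroPart_le ρ) s2
  have c3 : ContinuousOn (fun u => ∑' n, trivialPart n u) (Set.Ici 0) :=
    continuousOn_tsum_of_exp_bound continuous_trivialPart norm_trivialPart_le s3
  have c4 : ContinuousOn (fun u : ℝ => (u : ℂ)) (Set.Ici 0) := continuous_ofReal.continuousOn
  have c5 : ContinuousOn (fun _ : ℝ => (k : ℂ)) (Set.Ici 0) := continuousOn_const
  have c6 : ContinuousOn (fun u : ℝ => (k : ℂ) * exp (-(1 : ℂ) * u)) (Set.Ici 0) :=
    Continuous.continuousOn (by fun_prop)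
  obtain ⟨C1, n1⟩ : ∃ C : ℝ, ∀ u : ℝ, 0 ≤ u →
      ‖∑' n, (chebTerm n u : ℂ)‖ ≤ C * Real.exp (u / 2) :=
    ⟨_, fun u hu => norm_tsum_le_of_exp_bound (fun n u (_ : 0 ≤ u) => b1 n u) s1 hu⟩
  obtain ⟨C2, n2⟩ : ∃ C : ℝ, ∀ u : ℝ, 0 ≤ u →
      ‖∑' ρ : xiZeros, zeroPart ρ u‖ ≤ C * Real.exp (u / 2) :=
    ⟨_, fun u hu => norm_tsum_le_of_exp_bound (fun ρ : xiZeros => norm_zeroPart_le ρ) s2 hu⟩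
  obtain ⟨C3, n3⟩ : ∃ C : ℝ, ∀ u : ℝ, 0 ≤ u → ‖∑' n, trivialPart n u‖ ≤ C * Real.exp (u / 2) :=
    ⟨_, fun u hu => norm_tsum_le_of_exp_bound norm_trivialPart_le s3 hu⟩
  have n4 : ∀ u : ℝ, 0 ≤ u → ‖(u : ℂ)‖ ≤ 2 * Real.exp (u / 2) :=
    fun u hu => norm_ofReal_le_exp hu
  have n5 : ∀ u : ℝ, 0 ≤ u → ‖(k : ℂ)‖ ≤ ‖(k : ℂ)‖ * Real.exp (u / 2) := fun u hu =>
    le_mul_of_one_le_right (norm_nonneg _) (Real.one_le_exp (by linarith))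
  have n6 : ∀ u : ℝ, 0 ≤ u → ‖(k : ℂ) * exp (-(1 : ℂ) * u)‖ ≤ ‖(k : ℂ)‖ * Real.exp (u / 2) := by
    intro u hu
    rw [norm_mul, norm_exp]
    gcongr
    simp
    linarith
  have hD := eq_zero_of_laplace_eq_zero (c := C1 + 2 + ‖(k : ℂ)‖ + ‖(k : ℂ)‖ + C2 + C3)
    (((((c1.sub c4).add c5).sub c6).sub c2).sub c3)
    (fun u hu => (norm_sub_le_of_le (norm_sub_le_of_le (norm_sub_le_of_le (norm_add_le_of_le
      (norm_sub_le_of_le (n1 u hu) (n4 u hu)) (n5 u hu)) (n6 u hu)) (n2 u hu)) (n3 u hu)).trans_eq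
        (by ring)) ?_ hu
  · simp only [Pi.sub_apply, Pi.add_apply] at hD
    linear_combination hD
  · intro s hs
    have hs0 : s ≠ 0 := ne_zero_of_re_pos (by rw [hs]; norm_num)
    have hre : 0 < (s + 1).re := by rw [add_re, hs]; norm_num
    have hs1 : s + 1 ≠ 0 := ne_zero_of_re_pos hre
    have i1 := integrableOn_laplace hs c1 n1
    have i2 := integrableOn_laplace hs c2 n2
    have i3 := integrableOn_laplace hs c3 n3
    have i4 := integrableOn_laplace hs c4 n4
    have i5 := integrableOn_laplace hs c5 n5
    have i6 := integrableOn_laplace hs c6 n6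
    have L5 : ∫ u in Set.Ioi (0 : ℝ), exp (-s * u) * (k : ℂ) = k / s := by
      have := laplace_exp (s := s) (a := 0) (by rw [add_zero, hs]; norm_num)
      simp only [neg_zero, zero_mul, exp_zero, mul_one, add_zero] at this
      rw [integral_mul_const, this]
      ring
    have L6 : ∫ u in Set.Ioi (0 : ℝ), exp (-s * u) * ((k : ℂ) * exp (-(1 : ℂ) * u)) =
        k / (s + 1) := by
      simp only [mul_left_comm _ (k : ℂ)]
      rw [integral_const_mul, laplace_exp hre]
      ring
    simp only [Pi.sub_apply, Pi.add_apply, mul_sub, mul_add]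
    have j1 := Integrable.sub' i1 i4
    have j2 := j1.fun_add i5
    have j3 := j2.sub' i6
    rw [integral_sub (j3.sub' i2) i3, integral_sub j3 i2, integral_sub j2 i6,
      integral_add j1 i5, integral_sub i1 i4, laplace_tsum_chebTerm hs, laplace_id hs,
      L5, L6, laplace_tsum_zeroPart hs, laplace_tsum_trivialPart hs, logDeriv_xiFun_one_eq,
      logDeriv_xiFun_eq (by rw [add_re, hs]; norm_num), hk,
      Real.log_mul (by norm_num) Real.pi_ne_zero, show (4 : ℝ) = 2 ^ 2 by norm_num, Real.log_pow]
    rw [add_sub_cancel_right]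
    push_cast
    field_simp
    ring

lemma hasSum_trivial_coeff :
    HasSum (fun n : ℕ => 1 / ((2 * n + 2) * (2 * n + 3) : ℝ)) (1 - Real.log 2) := by
  have hh : 0 < ((1 / 2 : ℂ)).re := by norm_num
  have d2 := digamma_apply_add_one _ (ne_neg_nat_of_re_pos hh)
  have h2 := hasSum_digamma (z := 1 / 2 + 1) (by norm_num)
  rw [d2, digamma_one_half] at h2
  have h3 := hasSum_re (h2.div_const 2)
  convert! h3 using 1
  · funext n
    have hn3 : (2 * n + 3 : ℂ) ≠ 0 := by exact_mod_cast (by omega : 2 * n + 3 ≠ 0)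
    have hn2 : (n + 1 : ℂ) ≠ 0 := by exact_mod_cast (by omega : n + 1 ≠ 0)
    rw [show (n : ℂ) + (1 / 2 + 1) = (2 * n + 3) / 2 by ring,
      ← ofReal_re (1 / ((2 * n + 2) * (2 * n + 3) : ℝ))]
    congr 1
    push_cast
    rw [show (2 * n + 2 : ℂ) = 2 * (n + 1) by ring]
    field_simp
    ring
  · rw [← ofReal_re (1 - Real.log 2)]
    congr 1
    rw [ofReal_sub, ofReal_log (by norm_num)]
    push_cast
    ring

lemma norm_trivialPart_le_exp_neg (n : ℕ) {u : ℝ} (hu : 0 ≤ u) :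
    ‖trivialPart n u‖ ≤ 1 / ((2 * n + 2) * (2 * n + 3) : ℝ) * Real.exp (-u) := by
  have e : trivialPart n u = ((1 / ((2 * n + 2) * (2 * n + 3) : ℝ) *
      (Real.exp (-u) - Real.exp (-(2 * n + 3) * u)) : ℝ) : ℂ) := by
    rw [trivialPart]
    push_cast
    ring_nf
  have h1 : Real.exp (-(2 * n + 3) * u) ≤ Real.exp (-u) :=
    Real.exp_le_exp.mpr (by nlinarith [Nat.cast_nonneg (α := ℝ) n])
  rw [e, norm_real, Real.norm_of_nonneg (mul_nonneg (by positivity) (by linarith))]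
  gcongr
  linarith [Real.exp_pos (-(2 * n + 3) * u)]

lemma tsum_zeroPart {u : ℝ} (hu : 0 ≤ u) : ∑' ρ : xiZeros, zeroPart ρ u =
    ∑' ρ, zeroTerm u ρ -
      (Real.eulerMascheroniConstant - Real.log (4 * Real.pi) + 2 : ℝ) * exp (-(1 : ℂ) * u) := by
  have h1 := hasSum_xi_symm (s := 1) (by rw [xiFun_one]; exact one_ne_zero)
  rw [logDeriv_xiFun_one_eq] at h1
  have h2 := (summable_zeroTerm_norm hu).of_norm.hasSum.sub (h1.mul_right (exp (-(1 : ℂ) * u)))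
  have h3 : HasSum (fun ρ => zeroPart ρ u) (∑' ρ, zeroTerm u ρ -
      (Real.eulerMascheroniConstant - Real.log (4 * Real.pi) + 2 : ℝ) * exp (-(1 : ℂ) * u)) := by
    convert! h2 using 1
    · funext ρ
      rw [zeroPart, zeroTerm]
      ring_nf
    · push_cast
      ring
  exact ((hasSum_subtype_iff_of_support_subset (support_zeroPart u)).mpr h3).tsum_eq

theorem abs_tsum_chebTerm_le {u : ℝ} (hu : 9.7 ≤ u) :
    |∑' n, chebTerm n u - u + (1 + Real.eulerMascheroniConstant)| ≤ 0.43 / u - 1.4 / u ^ 2 := by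
  have hu0 : 0 < u := by linarith
  have h := explicit_formula hu0
  rw [tsum_zeroPart hu0.le] at h
  set S := Real.eulerMascheroniConstant - Real.log (4 * Real.pi) + 2 with hS
  have hS1 : S ≤ 1 / 20 := by linarith [two_add_eulerMascheroni_sub_le]
  have hS0 : 0 ≤ S := hasSum_xi_inv.nonneg xi_inv_nonneg
  have hγ := Real.eulerMascheroniConstant_lt_two_thirds
  have hγ0 := Real.one_half_lt_eulerMascheroniConstant
  have h1 : ((∑' n, chebTerm n u - u + (1 + Real.eulerMascheroniConstant) : ℝ) : ℂ) =
      ((1 + Real.eulerMascheroniConstant - S : ℝ) : ℂ) * exp (-(1 : ℂ) * u) +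
        ∑' n, trivialPart n u + ∑' ρ, zeroTerm u ρ := by
    rw [ofReal_add, ofReal_sub, ofReal_tsum, h]
    push_cast
    ring
  have h2 : ‖((1 + Real.eulerMascheroniConstant - S : ℝ) : ℂ) * exp (-(1 : ℂ) * u)‖ ≤
      (1 + 2 / 3) * Real.exp (-u) := by
    rw [norm_mul, norm_real, Real.norm_of_nonneg (by linarith), norm_exp]
    have : (-(1 : ℂ) * u).re = -u := by simp
    rw [this]
    gcongr
    linarith
  have h3 : ‖∑' n, trivialPart n u‖ ≤ (1 - Real.log 2) * Real.exp (-u) :=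
    tsum_of_norm_bounded (hasSum_trivial_coeff.mul_right _)
      fun n => norm_trivialPart_le_exp_neg n hu0.le
  have h4 := norm_tsum_le_tsum_norm (summable_zeroTerm_norm hu0.le)
  have h5 := tsum_norm_zeroTerm_add_le hu
  have h6 := norm_add₃_le (a := ((1 + Real.eulerMascheroniConstant - S : ℝ) : ℂ) *
    exp (-(1 : ℂ) * u)) (b := ∑' n, trivialPart n u) (c := ∑' ρ, zeroTerm u ρ)
  rw [← h1, norm_real, Real.norm_eq_abs] at h6
  nlinarith [Real.exp_pos (-u), Real.log_two_gt_d9]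

end ExplicitFormula

section Mertens

open MeasureTheory Topology ArithmeticFunction ENNReal

/-- The exponential probability distribution with rate `δ`. -/
noncomputable def expTail (δ : ℝ) : Measure ℝ :=
  (volume.restrict (Set.Ici 0)).withDensity fun u => ENNReal.ofReal (δ * Real.exp (-δ * u))

lemma expTail_Ici {δ b : ℝ} (hδ : 0 < δ) (hb : 0 ≤ b) :
    expTail δ (Set.Ici b) = ENNReal.ofReal (Real.exp (-δ * b)) := by
  have h0 : Set.Ici b ∩ Set.Ici (0 : ℝ) = Set.Ici b :=
    Set.inter_eq_left.mpr (Set.Ici_subset_Ici.mpr hb)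
  rw [expTail, withDensity_apply _ measurableSet_Ici, Measure.restrict_restrict measurableSet_Ici,
    h0, ← ofReal_integral_eq_lintegral_ofReal]
  · rw [integral_Ici_eq_integral_Ioi, integral_const_mul, integral_exp_mul_Ioi (by linarith)]
    congr 1
    field_simp
  · exact ((integrableOn_Ici_iff_integrableOn_Ioi).mpr
      (integrableOn_exp_mul_Ioi (by linarith) b)).const_mul δ
  · exact Eventually.of_forall fun u => by positivity

lemma expTail_Iio {δ : ℝ} (hδ : 0 < δ) (c : ℝ) :
    expTail δ (Set.Iio c) ≤ ENNReal.ofReal (δ * c) := by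
  rw [expTail, withDensity_apply _ measurableSet_Iio, Measure.restrict_restrict measurableSet_Iio]
  have h1 : ∀ u ∈ Set.Iio c ∩ Set.Ici (0 : ℝ),
      ENNReal.ofReal (δ * Real.exp (-δ * u)) ≤ ENNReal.ofReal δ := fun u hu => by
    refine ENNReal.ofReal_le_ofReal ?_
    have : Real.exp (-δ * u) ≤ 1 := Real.exp_le_one_iff.mpr (by nlinarith [hu.2.out])
    nlinarith
  refine (setLIntegral_mono measurable_const h1).trans ?_
  rw [setLIntegral_const]
  have h2 : Set.Iio c ∩ Set.Ici (0 : ℝ) = Set.Ico 0 c := by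
    rw [Set.inter_comm, Set.Ici_inter_Iio]
  rw [h2, Real.volume_Ico, sub_zero, ENNReal.ofReal_mul hδ.le]

lemma lintegral_tsum_indicator {δ : ℝ} (hδ : 0 < δ) (a : ℕ → ℝ≥0∞) {b : ℕ → ℝ}
    (hb : ∀ n, 0 ≤ b n) :
    ∫⁻ u, ∑' n, (Set.Ici (b n)).indicator (fun _ => a n) u ∂(expTail δ) =
      ∑' n, a n * ENNReal.ofReal (Real.exp (-δ * b n)) := by
  rw [lintegral_tsum fun n => (measurable_const.indicator measurableSet_Ici).aemeasurable]
  refine tsum_congr fun n => ?_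
  rw [lintegral_indicator_const measurableSet_Ici, expTail_Ici hδ (hb n)]

lemma tsum_add_le_of_forall_add_le {a a' : ℕ → ℝ≥0∞} {b b' : ℕ → ℝ} (hb : ∀ n, 0 ≤ b n)
    (hb' : ∀ n, 0 ≤ b' n) {c : ℝ} {ε C : ℝ≥0∞}
    (hC : ∀ u < c, ∑' n, (Set.Ici (b' n)).indicator (fun _ => a' n) u ≤ C)
    (h : ∀ u, c ≤ u → ∑' n, (Set.Ici (b' n)).indicator (fun _ => a' n) u + ε ≤
      ∑' n, (Set.Ici (b n)).indicator (fun _ => a n) u) {δ : ℝ} (hδ : 0 < δ) :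
    ∑' n, a' n * ENNReal.ofReal (Real.exp (-δ * b' n)) + ε ≤
      ∑' n, a n * ENNReal.ofReal (Real.exp (-δ * b n)) + (C + ε) * ENNReal.ofReal (δ * c) := by
  have h1 : expTail δ Set.univ = 1 := by
    have h2 : expTail δ (Set.Iio 0) = 0 := by
      have := expTail_Iio hδ 0
      simpa using this
    have h3 := measure_add_measure_compl (μ := expTail δ) (s := Set.Iio 0) measurableSet_Iio
    rw [← h3, h2, Set.compl_Iio, expTail_Ici hδ le_rfl]
    simp
  have key : ∀ u, ∑' n, (Set.Ici (b' n)).indicator (fun _ => a' n) u + ε ≤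
      ∑' n, (Set.Ici (b n)).indicator (fun _ => a n) u +
        (Set.Iio c).indicator (fun _ => C + ε) u := by
    intro u
    rcases lt_or_ge u c with hu | hu
    · rw [Set.indicator_of_mem (Set.mem_Iio.mpr hu)]
      exact (add_le_add_left (hC u hu) ε).trans le_add_self
    · exact (h u hu).trans le_self_add
  have := lintegral_mono (μ := expTail δ) key
  rw [lintegral_add_right _ measurable_const, lintegral_add_right _
    (measurable_const.indicator measurableSet_Iio), lintegral_tsum_indicator hδ a hb,
    lintegral_tsum_indicator hδ a' hb', lintegral_const, h1, mul_one,
    lintegral_indicator_const measurableSet_Iio] at this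
  refine this.trans ?_
  gcongr
  exact expTail_Iio hδ c

lemma summable_vonMangoldt_div_log {s : ℝ} (hs : 1 < s) :
    Summable fun n : ℕ => Λ n / ((n : ℝ) ^ s * Real.log n) := by
  refine Summable.of_nonneg_of_le (fun n => ?_) (fun n => ?_)
    (Real.summable_nat_rpow_inv.mpr hs)
  · have := Real.log_natCast_nonneg n
    have := vonMangoldt_nonneg (n := n)
    positivity
  · rw [div_mul_eq_div_div_swap, ← one_div]
    gcongr
    exact div_le_one_of_le₀ vonMangoldt_le_log (Real.log_natCast_nonneg n)

lemma tsum_vonMangoldt_exp {δ : ℝ} (hδ : 0 < δ) :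
    ∑' n : ℕ, ENNReal.ofReal (Λ n / (n * Real.log n)) *
      ENNReal.ofReal (Real.exp (-δ * Real.log n)) =
        ENNReal.ofReal (Real.log (riemannZeta ((1 + δ : ℝ) : ℂ)).re) := by
  have hs : 1 < 1 + δ := by linarith
  rw [log_riemannZeta_eq hs, ENNReal.ofReal_tsum_of_nonneg _ (summable_vonMangoldt_div_log hs)]
  · refine tsum_congr fun n => ?_
    have := Real.log_natCast_nonneg n
    have := vonMangoldt_nonneg (n := n)
    rw [← ENNReal.ofReal_mul (by positivity)]
    rcases Nat.eq_zero_or_pos n with rfl | hn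
    · simp
    have hn' : (0 : ℝ) < n := by exact_mod_cast hn
    congr 1
    rw [Real.rpow_add hn', Real.rpow_one, neg_mul, Real.exp_neg, mul_comm δ, ← Real.rpow_def_of_pos hn']
    have := Real.rpow_pos_of_pos hn' δ
    field_simp
  · intro n
    have := Real.log_natCast_nonneg n
    have := vonMangoldt_nonneg (n := n)
    positivity

lemma tsum_inv_exp {δ : ℝ} (hδ : 0 < δ) :
    ∑' n : ℕ, ENNReal.ofReal (1 / ((n : ℝ) + 1)) * ENNReal.ofReal (Real.exp (-δ * ((n : ℝ) + 1))) =
        ENNReal.ofReal (-Real.log (1 - Real.exp (-δ))) := by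
  have h := Real.hasSum_pow_div_log_of_abs_lt_one (x := Real.exp (-δ))
    (by rw [abs_of_pos (Real.exp_pos _)]; exact Real.exp_lt_one_iff.mpr (by linarith))
  rw [← h.tsum_eq, ENNReal.ofReal_tsum_of_nonneg (fun n => by positivity) h.summable]
  refine tsum_congr fun n => ?_
  rw [← ENNReal.ofReal_mul (by positivity), ← Real.exp_nat_mul]
  congr 1
  push_cast
  rw [one_div, div_eq_inv_mul]
  ring_nf

lemma tsum_indicator_vonMangoldt (u : ℝ) :
    ∑' n : ℕ, (Set.Ici (Real.log n)).indicator
      (fun _ => ENNReal.ofReal (Λ n / (n * Real.log n))) u =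
    ENNReal.ofReal (∑ n ∈ range (⌊Real.exp u⌋₊ + 1), Λ n / (n * Real.log n)) := by
  have hnn : ∀ n : ℕ, 0 ≤ Λ n / (n * Real.log n) := fun n => by
    have := Real.log_natCast_nonneg n
    have := vonMangoldt_nonneg (n := n)
    positivity
  rw [ENNReal.ofReal_sum_of_nonneg fun n _ => hnn n, tsum_eq_sum]
  · refine Finset.sum_congr rfl fun n hn => ?_
    rcases Nat.eq_zero_or_pos n with rfl | hn0
    · simp
    rw [Set.indicator_of_mem]
    have hn' : (0 : ℝ) < n := by exact_mod_cast hn0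
    rw [Set.mem_Ici, Real.log_le_iff_le_exp hn', ← Nat.le_floor_iff (Real.exp_pos u).le]
    have := Finset.mem_range.mp hn
    omega
  · intro n hn
    have h2 : ⌊Real.exp u⌋₊ < n := by
      rw [Finset.mem_range] at hn
      omega
    have hn' : (0 : ℝ) < n := by exact_mod_cast (by omega : 0 < n)
    refine Set.indicator_of_notMem ?_ _
    rw [Set.mem_Ici, Real.log_le_iff_le_exp hn', ← Nat.le_floor_iff (Real.exp_pos u).le]
    omega

lemma tsum_indicator_inv {u : ℝ} (hu : 0 ≤ u) :
    ∑' n : ℕ, (Set.Ici ((n : ℝ) + 1)).indicator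
      (fun _ => ENNReal.ofReal (1 / ((n : ℝ) + 1))) u =
    ENNReal.ofReal (harmonic ⌊u⌋₊ : ℝ) := by
  have e : (harmonic ⌊u⌋₊ : ℝ) = ∑ n ∈ range ⌊u⌋₊, 1 / ((n : ℝ) + 1) := by
    rw [harmonic]; push_cast; simp
  have hm : ∀ n : ℕ, u ∈ Set.Ici ((n : ℝ) + 1) ↔ n < ⌊u⌋₊ := fun n => by
    rw [Set.mem_Ici, ← Nat.succ_le_iff, Nat.le_floor_iff hu]
    push_cast
    rfl
  rw [e, ENNReal.ofReal_sum_of_nonneg fun n _ => by positivity, tsum_eq_sum]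
  · refine Finset.sum_congr rfl fun n hn => ?_
    rw [Set.indicator_of_mem ((hm n).mpr (Finset.mem_range.mp hn))]
  · intro n hn
    exact Set.indicator_of_notMem (fun h => hn (Finset.mem_range.mpr ((hm n).mp h))) _

lemma tendsto_log_zeta_add_log :
    Tendsto (fun δ : ℝ => Real.log (riemannZeta ((1 + δ : ℝ) : ℂ)).re +
      Real.log (1 - Real.exp (-δ))) (𝓝[>] 0) (𝓝 0) := by
  have h1 : Tendsto (fun s : ℝ => (riemannZeta s).re.log + (s - 1).log) (𝓝[>] (1 : ℝ)) (𝓝 0) := by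
    have := log_riemannZeta_add_log_sub_isLittleO_ofReal
    rwa [Asymptotics.isLittleO_one_iff] at this
  have h2 : Tendsto (fun δ : ℝ => 1 + δ) (𝓝[>] 0) (𝓝[>] (1 : ℝ)) := by
    refine tendsto_nhdsWithin_iff.mpr ⟨?_, ?_⟩
    · have : Tendsto (fun δ : ℝ => 1 + δ) (𝓝 0) (𝓝 (1 + 0)) := tendsto_const_nhds.add tendsto_id
      rw [add_zero] at this
      exact this.mono_left nhdsWithin_le_nhds
    · filter_upwards [self_mem_nhdsWithin] with δ hδ
      simpa using hδ
  have h3 : Tendsto (fun δ : ℝ => Real.log ((1 - Real.exp (-δ)) / δ)) (𝓝[>] 0) (𝓝 0) := by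
    suffices h : Tendsto (fun δ : ℝ => (1 - Real.exp (-δ)) / δ) (𝓝[>] 0) (𝓝 1) by
      simpa using h.log one_ne_zero
    have hd : HasDerivAt (fun δ : ℝ => 1 - Real.exp (-δ)) 1 0 := by
      have := ((hasDerivAt_neg (0 : ℝ)).exp).const_sub 1
      simpa using this
    have := (hasDerivAt_iff_tendsto_slope.mp hd).mono_left
      (nhdsWithin_mono 0 (fun x (hx : (0 : ℝ) < x) => hx.ne'))
    refine this.congr fun δ => ?_
    simp [slope_def_field]
  have h4 := (h1.comp h2).add h3
  rw [add_zero] at h4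
  refine h4.congr' ?_
  filter_upwards [self_mem_nhdsWithin] with δ (hδ : 0 < δ)
  have h5 : Real.exp (-δ) < 1 := Real.exp_lt_one_iff.mpr (by linarith)
  simp only [Function.comp]
  rw [Real.log_div (by linarith) hδ.ne', add_sub_cancel_left]
  ring

/-- One half of Mertens' theorem, for prime powers and along a subsequence. -/
theorem frequently_sum_vonMangoldt_div_log_le {ε : ℝ} (hε : 0 < ε) :
    ∃ᶠ W : ℝ in atTop, ∑ n ∈ range (⌊Real.exp W⌋₊ + 1), Λ n / (n * Real.log n) ≤
      Real.log W + Real.eulerMascheroniConstant + ε := by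
  intro hcon
  have h1 : ∀ᶠ u : ℝ in atTop,
      (harmonic ⌊u⌋₊ : ℝ) - Real.log ⌊u⌋₊ < Real.eulerMascheroniConstant + ε / 2 :=
    (Real.tendsto_harmonic_sub_log.comp tendsto_nat_floor_atTop).eventually_lt_const (by linarith)
  obtain ⟨c, hc⟩ := eventually_atTop.mp (hcon.and (h1.and (eventually_ge_atTop 1)))
  have hc1 : 1 ≤ c := (hc c le_rfl).2.2
  have hC : ∀ u < c, ∑' n : ℕ, (Set.Ici ((n : ℝ) + 1)).indicator
      (fun _ => ENNReal.ofReal (1 / ((n : ℝ) + 1))) u ≤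
        ENNReal.ofReal (harmonic ⌊c⌋₊ : ℝ) := by
    intro u hu
    rw [← tsum_indicator_inv (by linarith)]
    refine ENNReal.tsum_le_tsum fun n => ?_
    by_cases hn : u ∈ Set.Ici ((n : ℝ) + 1)
    · have hn' : c ∈ Set.Ici ((n : ℝ) + 1) := le_trans hn.out hu.le
      rw [Set.indicator_of_mem hn, Set.indicator_of_mem hn']
    · rw [Set.indicator_of_notMem hn]
      exact zero_le
  have h : ∀ u, c ≤ u → ∑' n : ℕ, (Set.Ici ((n : ℝ) + 1)).indicator
      (fun _ => ENNReal.ofReal (1 / ((n : ℝ) + 1))) u + ENNReal.ofReal (ε / 2) ≤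
      ∑' n : ℕ, (Set.Ici (Real.log n)).indicator
      (fun _ => ENNReal.ofReal (Λ n / (n * Real.log n))) u := by
    intro u hu
    obtain ⟨h2, h3, h4⟩ := hc u hu
    rw [tsum_indicator_inv (by linarith), tsum_indicator_vonMangoldt,
      ← ENNReal.ofReal_add (by rw [harmonic]; positivity) (by linarith)]
    refine ENNReal.ofReal_le_ofReal ?_
    have h5 : Real.log ⌊u⌋₊ ≤ Real.log u := by
      refine Real.log_le_log ?_ (Nat.floor_le (by linarith))
      exact_mod_cast Nat.floor_pos.mpr h4
    linarith [not_le.mp h2]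
  have hineq : ∀ δ : ℝ, 0 < δ → ε / 2 ≤ Real.log (riemannZeta ((1 + δ : ℝ) : ℂ)).re +
      Real.log (1 - Real.exp (-δ)) + (harmonic ⌊c⌋₊ + ε / 2) * (δ * c) := by
    intro δ hδ
    have h6 := tsum_add_le_of_forall_add_le (fun n => Real.log_natCast_nonneg n)
      (fun n => by positivity) hC h hδ
    have hz : 0 ≤ Real.log (riemannZeta ((1 + δ : ℝ) : ℂ)).re := by
      rw [log_riemannZeta_eq (by linarith)]
      refine tsum_nonneg fun n => ?_
      have := Real.log_natCast_nonneg n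
      have := vonMangoldt_nonneg (n := n)
      positivity
    have hl : 0 ≤ -Real.log (1 - Real.exp (-δ)) := by
      have := Real.exp_lt_one_iff.mpr (show -δ < 0 by linarith)
      have := Real.log_nonpos (x := 1 - Real.exp (-δ)) (by linarith)
        (by linarith [Real.exp_pos (-δ)])
      linarith
    have hh : (0 : ℝ) ≤ harmonic ⌊c⌋₊ := by rw [harmonic]; positivity
    rw [tsum_inv_exp hδ, tsum_vonMangoldt_exp hδ, ← ENNReal.ofReal_add hl (by linarith),
      ← ENNReal.ofReal_add hh (by linarith), ← ENNReal.ofReal_mul (by positivity),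
      ← ENNReal.ofReal_add hz (by positivity), ENNReal.ofReal_le_ofReal_iff (by positivity)] at h6
    linarith
  have h7 : Tendsto (fun δ : ℝ => (harmonic ⌊c⌋₊ + ε / 2) * (δ * c)) (𝓝[>] 0) (𝓝 0) := by
    have : Tendsto (fun δ : ℝ => (harmonic ⌊c⌋₊ + ε / 2) * (δ * c)) (𝓝 0)
        (𝓝 ((harmonic ⌊c⌋₊ + ε / 2) * (0 * c))) := by
      apply Continuous.tendsto
      fun_prop
    rw [zero_mul, mul_zero] at this
    exact this.mono_left nhdsWithin_le_nhds
  have h8 := tendsto_log_zeta_add_log.add h7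
  have h9 := ge_of_tendsto h8 (b := ε / 2) (by
    filter_upwards [self_mem_nhdsWithin] with δ hδ
    exact hineq δ hδ)
  linarith

end Mertens

section Comparison

open Topology ArithmeticFunction

/-- The prime power sum whose comparison with `Real.log u` yields a Mertens type estimate. -/
noncomputable def mertensTerm (n : ℕ) (u : ℝ) : ℝ :=
  Λ n * max (1 / (n * Real.log n) - Real.exp (-u) / u) 0

/-- The bound for the error in the explicit formula. -/
noncomputable def errBound (u : ℝ) : ℝ := 0.43 / u - 1.4 / u ^ 2

/-- The integral over `[u, ∞)` of `errBound v * (1 / v ^ 2 + 2 / v ^ 3)`. -/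
noncomputable def errIntegral (u : ℝ) : ℝ :=
  0.43 * (1 / (2 * u ^ 2) + 2 / (3 * u ^ 3)) - 1.4 * (1 / (3 * u ^ 3) + 1 / (2 * u ^ 4))

/-- A primitive of `(u - (1 + γ) - errBound u) * (1 / u ^ 2 + 2 / u ^ 3)`. -/
noncomputable def mainPrimitive (u : ℝ) : ℝ :=
  Real.log u - 2 / u + (1 + Real.eulerMascheroniConstant) * (1 / u + 1 / u ^ 2) + errIntegral u

lemma mertensTerm_nonneg (n : ℕ) (u : ℝ) : 0 ≤ mertensTerm n u :=
  mul_nonneg vonMangoldt_nonneg (le_max_right _ _)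

lemma exp_neg_div_antitone {u v : ℝ} (hu : 0 < u) (huv : u ≤ v) :
    Real.exp (-v) / v ≤ Real.exp (-u) / u := by
  gcongr

lemma exp_neg_log_natCast {n : ℕ} (hn : 2 ≤ n) :
    Real.exp (-Real.log n) = 1 / n := by
  rw [Real.exp_neg, Real.exp_log (by positivity), one_div]

lemma mertensTerm_eq_zero {n : ℕ} (hn : 2 ≤ n) {u : ℝ} (hu : 0 < u) (h : u ≤ Real.log n) :
    mertensTerm n u = 0 := by
  have h1 := exp_neg_div_antitone hu h
  rw [exp_neg_log_natCast hn, div_div] at h1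
  rw [mertensTerm, max_eq_right (by linarith), mul_zero]

lemma chebTerm_eq_zero {n : ℕ} (hn : 2 ≤ n) {u : ℝ} (h : u ≤ Real.log n) :
    chebTerm n u = 0 := by
  have h1 : Real.exp (-Real.log n) ≤ Real.exp (-u) := Real.exp_le_exp.mpr (by linarith)
  rw [exp_neg_log_natCast hn] at h1
  rw [chebTerm, max_eq_right (by linarith), mul_zero]

lemma hasDerivAt_exp_neg_div {u : ℝ} (hu : 0 < u) :
    HasDerivAt (fun u : ℝ => Real.exp (-u) / u)
      (-Real.exp (-u) * (1 / u + 1 / u ^ 2)) u := by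
  refine (((hasDerivAt_neg u).exp).fun_div (hasDerivAt_id' u) hu.ne').congr_deriv ?_
  field_simp
  ring

lemma hasDerivAt_inv_add_inv_sq {u : ℝ} (hu : 0 < u) :
    HasDerivAt (fun u : ℝ => 1 / u + 1 / u ^ 2) (-(1 / u ^ 2 + 2 / u ^ 3)) u := by
  have h := hasDerivAt_inv hu.ne'
  have e : (fun u : ℝ => 1 / u + 1 / u ^ 2) = fun u => u⁻¹ + u⁻¹ ^ 2 := by
    ext x
    simp
  rw [e]
  refine (h.fun_add (h.fun_pow 2)).congr_deriv ?_
  push_cast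
  field_simp
  ring

lemma hasDerivWithinAt_mertensTerm_sub (n : ℕ) {u : ℝ} (hu : 0 < u) :
    HasDerivWithinAt (fun u => mertensTerm n u - chebTerm n u * (1 / u + 1 / u ^ 2))
      (chebTerm n u * (1 / u ^ 2 + 2 / u ^ 3)) (Set.Ici u) u := by
  rcases lt_or_ge n 2 with hn | hn
  · have h0 : Λ n = 0 := by interval_cases n <;> simp
    simpa [mertensTerm, chebTerm, h0] using hasDerivWithinAt_const u (Set.Ici u) (0 : ℝ)
  rcases lt_or_ge u (Real.log n) with h | h
  · rw [chebTerm_eq_zero hn h.le, zero_mul]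
    refine HasDerivAt.hasDerivWithinAt ((hasDerivAt_const u (0 : ℝ)).congr_of_eventuallyEq ?_)
    filter_upwards [Ioo_mem_nhds hu h] with v hv
    rw [chebTerm_eq_zero hn hv.2.le, mertensTerm_eq_zero hn hv.1 hv.2.le, zero_mul, sub_zero]
  · have hlog : 0 < Real.log n := Real.log_pos (by exact_mod_cast hn)
    have hm : ∀ v ∈ Set.Ici u, mertensTerm n v = Λ n * (1 / (n * Real.log n) - Real.exp (-v) / v) := by
      intro v hv
      have h1 := exp_neg_div_antitone hlog (h.trans hv)
      rw [exp_neg_log_natCast hn, div_div] at h1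
      rw [mertensTerm, max_eq_left (by linarith)]
    have hc : ∀ v ∈ Set.Ici u, chebTerm n v = Λ n * (1 / n - Real.exp (-v)) := by
      intro v hv
      have h1 : Real.exp (-v) ≤ Real.exp (-Real.log n) :=
        Real.exp_le_exp.mpr (by linarith [hv.out])
      rw [exp_neg_log_natCast hn] at h1
      rw [chebTerm, max_eq_left (by linarith)]
    have hd := (((hasDerivAt_exp_neg_div hu).const_sub (1 / (n * Real.log n))).const_mul
      (Λ n)).sub (((((hasDerivAt_neg u).exp).const_sub (1 / (n : ℝ))).const_mul (Λ n)).mul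
        (hasDerivAt_inv_add_inv_sq hu))
    refine HasDerivWithinAt.congr (f := _) (hd.hasDerivWithinAt.congr_deriv ?_) ?_ ?_
    · rw [hc u Set.self_mem_Ici]
      ring
    · intro v hv
      simp [hm v hv, hc v hv]
    · simp [hm u Set.self_mem_Ici, hc u Set.self_mem_Ici]

lemma continuousOn_mertensTerm_sub (n : ℕ) :
    ContinuousOn (fun u => mertensTerm n u - chebTerm n u * (1 / u + 1 / u ^ 2)) (Set.Ioi 0) := by
  have h1 : ContinuousOn (fun u : ℝ => Real.exp (-u) / u) (Set.Ioi 0) := fun u hu =>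
    (hasDerivAt_exp_neg_div hu).continuousAt.continuousWithinAt
  have h2 : ContinuousOn (fun u : ℝ => 1 / u + 1 / u ^ 2) (Set.Ioi 0) := fun u hu =>
    (hasDerivAt_inv_add_inv_sq hu).continuousAt.continuousWithinAt
  have h3 := (continuous_chebTerm n).continuousOn (s := Set.Ioi 0)
  exact (continuousOn_const.mul ((continuousOn_const.sub h1).sup continuousOn_const)).sub
    (h3.mul h2)

lemma hasDerivAt_mainPrimitive {u : ℝ} (hu : 0 < u) :
    HasDerivAt mainPrimitive
      ((u - (1 + Real.eulerMascheroniConstant) - errBound u) * (1 / u ^ 2 + 2 / u ^ 3)) u := by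
  have h := hasDerivAt_inv hu.ne'
  have h1 := ((Real.hasDerivAt_log hu.ne').fun_sub (h.const_mul 2)).fun_add
    ((hasDerivAt_inv_add_inv_sq hu).const_mul (1 + Real.eulerMascheroniConstant))
  have h2 := ((((h.fun_pow 2).const_mul (1 / 2)).fun_add
    ((h.fun_pow 3).const_mul (2 / 3))).const_mul 0.43).fun_sub
    ((((h.fun_pow 3).const_mul (1 / 3)).fun_add ((h.fun_pow 4).const_mul (1 / 2))).const_mul 1.4)
  have e : mainPrimitive = fun u => Real.log u - 2 * u⁻¹ +
      (1 + Real.eulerMascheroniConstant) * (1 / u + 1 / u ^ 2) +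
        (0.43 * (1 / 2 * u⁻¹ ^ 2 + 2 / 3 * u⁻¹ ^ 3) -
          1.4 * (1 / 3 * u⁻¹ ^ 3 + 1 / 2 * u⁻¹ ^ 4)) := by
    ext x
    simp only [mainPrimitive, errIntegral]
    ring
  rw [e]
  refine (h1.fun_add h2).congr_deriv ?_
  rw [errBound]
  push_cast
  field_simp
  ring

lemma tsum_chebTerm_eq_sum {u : ℝ} {N : ℕ} (hN : Real.exp u ≤ N) :
    ∑' n, chebTerm n u = ∑ n ∈ range N, chebTerm n u := by
  refine tsum_eq_sum fun n hn => ?_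
  have hn1 : N ≤ n := by simpa using hn
  have hn2 : Real.exp u ≤ n := hN.trans (by exact_mod_cast hn1)
  have h0 : (0 : ℝ) < n := (Real.exp_pos u).trans_le hn2
  rcases lt_or_ge n 2 with h | h
  · have h1 : n = 1 := by
      have : 0 < n := by exact_mod_cast h0
      omega
    rw [chebTerm, h1, vonMangoldt_apply_one, zero_mul]
  · exact chebTerm_eq_zero h ((Real.le_log_iff_exp_le h0).mpr hn2)

lemma mainPrimitive_sub_le {U W : ℝ} (hU : 9.7 ≤ U) (hUW : U ≤ W) {N : ℕ} (hN : Real.exp W ≤ N) :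
    mainPrimitive W - mainPrimitive U ≤
      ∑ n ∈ range N, (mertensTerm n W - chebTerm n W * (1 / W + 1 / W ^ 2)) -
      ∑ n ∈ range N, (mertensTerm n U - chebTerm n U * (1 / U + 1 / U ^ 2)) := by
  have hpos : Set.Icc U W ⊆ Set.Ioi 0 := fun u hu => by
    have := hu.1
    show 0 < u
    linarith
  have h := image_le_of_deriv_right_le_deriv_boundary (a := U) (b := W)
    (f := fun u => mainPrimitive u - mainPrimitive U)
    (f' := fun u => (u - (1 + Real.eulerMascheroniConstant) - errBound u) *
      (1 / u ^ 2 + 2 / u ^ 3))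
    (B := fun u => ∑ n ∈ range N, (mertensTerm n u - chebTerm n u * (1 / u + 1 / u ^ 2)) -
      ∑ n ∈ range N, (mertensTerm n U - chebTerm n U * (1 / U + 1 / U ^ 2)))
    (B' := fun u => ∑ n ∈ range N, chebTerm n u * (1 / u ^ 2 + 2 / u ^ 3))
    (fun u hu => ((hasDerivAt_mainPrimitive (hpos hu)).sub_const _).continuousAt.continuousWithinAt)
    (fun u hu => ((hasDerivAt_mainPrimitive
      (hpos (Set.Ico_subset_Icc_self hu))).sub_const _).hasDerivWithinAt)
    (by simp)
    ((continuousOn_finsetSum _ fun n _ => (continuousOn_mertensTerm_sub n).mono hpos).sub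
      continuousOn_const)
    (fun u hu => (HasDerivWithinAt.fun_sum fun n _ => hasDerivWithinAt_mertensTerm_sub n
      (hpos (Set.Ico_subset_Icc_self hu))).sub_const _)
    (fun u hu => by
      have hu0 : 0 < u := hpos (Set.Ico_subset_Icc_self hu)
      rw [← Finset.sum_mul, ← tsum_chebTerm_eq_sum ((Real.exp_le_exp.mpr hu.2.le).trans hN)]
      have := (abs_le.mp (abs_tsum_chebTerm_le (hU.trans hu.1))).1
      gcongr
      rw [errBound]
      linarith)
  exact h ⟨hUW, le_rfl⟩

/-- An upper bound of Mertens type obtained from the explicit formula. -/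
theorem sum_mertensTerm_le {U : ℝ} (hU : 9.7 ≤ U) (N₀ : ℕ) :
    ∑ n ∈ range N₀, mertensTerm n U ≤ Real.log U + Real.eulerMascheroniConstant - 1 / U +
      errBound U * (1 / U + 1 / U ^ 2) + errIntegral U := by
  refine le_of_forall_pos_le_add fun ε hε => ?_
  have hU0 : 0 < U := by linarith
  obtain ⟨W, hW, hW1, hW2, hW3⟩ := ((frequently_sum_vonMangoldt_div_log_le (half_pos hε)).and_eventually
    ((eventually_ge_atTop U).and ((eventually_ge_atTop (4 / ε)).and
      (Real.tendsto_exp_atTop.eventually_ge_atTop (N₀ : ℝ))))).exists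
  have hW0 : 0 < W := by linarith
  have hN : Real.exp W ≤ (⌊Real.exp W⌋₊ + 1 : ℕ) := by
    push_cast
    exact (Nat.lt_floor_add_one _).le
  have hN₀ : N₀ ≤ ⌊Real.exp W⌋₊ + 1 := by
    exact_mod_cast (hW3.trans hN)
  have h1 := mainPrimitive_sub_le hU hW1 hN
  rw [Finset.sum_sub_distrib, Finset.sum_sub_distrib, ← Finset.sum_mul, ← Finset.sum_mul,
    ← tsum_chebTerm_eq_sum hN, ← tsum_chebTerm_eq_sum ((Real.exp_le_exp.mpr hW1).trans hN)] at h1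
  have h2 : ∑ n ∈ range (⌊Real.exp W⌋₊ + 1), mertensTerm n W ≤
      ∑ n ∈ range (⌊Real.exp W⌋₊ + 1), Λ n / (n * Real.log n) := by
    refine Finset.sum_le_sum fun n _ => ?_
    have h3 : 0 ≤ 1 / ((n : ℝ) * Real.log n) := by
      have := Real.log_natCast_nonneg n
      positivity
    have h4 : 0 < Real.exp (-W) / W := by positivity
    rw [mertensTerm, div_eq_mul_one_div (Λ n)]
    exact mul_le_mul_of_nonneg_left (max_le (by linarith) h3) vonMangoldt_nonneg
  have h3 : ∑ n ∈ range N₀, mertensTerm n U ≤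
      ∑ n ∈ range (⌊Real.exp W⌋₊ + 1), mertensTerm n U :=
    Finset.sum_le_sum_of_subset_of_nonneg (Finset.range_subset_range.mpr hN₀)
      fun n _ _ => mertensTerm_nonneg n U
  have h4 := mul_le_mul_of_nonneg_right (abs_le.mp (abs_tsum_chebTerm_le hU)).2
    (show 0 ≤ 1 / U + 1 / U ^ 2 by positivity)
  have h5 := mul_le_mul_of_nonneg_right (abs_le.mp (abs_tsum_chebTerm_le (hU.trans hW1))).1
    (show 0 ≤ 1 / W + 1 / W ^ 2 by positivity)
  have h6 : errBound W * (1 / W + 1 / W ^ 2) - errIntegral W ≤ 1 / W := by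
    have hv : 1 / W ≤ 0.2 := by
      rw [div_le_iff₀ hW0]
      linarith
    have e : errBound W * (1 / W + 1 / W ^ 2) - errIntegral W = 1 / W - (1 / W) * (1 - (1 / W) *
      (0.43 / 2 - (1 / W) * (0.97 + 0.43 * 2 / 3 - 1.4 / 3 + (1 / W) * 0.7))) := by
      rw [errBound, errIntegral]
      ring
    rw [e]
    have hv0 : 0 < 1 / W := by positivity
    have : 0 ≤ (1 / W) * (1 - (1 / W) *
      (0.43 / 2 - (1 / W) * (0.97 + 0.43 * 2 / 3 - 1.4 / 3 + (1 / W) * 0.7))) := by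
      refine mul_nonneg hv0.le ?_
      have : 0 ≤ (1 / W) * ((1 / W) * (0.97 + 0.43 * 2 / 3 - 1.4 / 3 + (1 / W) * 0.7)) := by
        refine mul_nonneg hv0.le (mul_nonneg hv0.le ?_)
        linarith
      norm_num at this hv ⊢
      linarith
    linarith
  have h7 : 2 / W ≤ ε / 2 := by
    rw [div_le_iff₀ hW0]
    rw [div_le_iff₀ hε] at hW2
    linarith
  have e1 : ∀ x : ℝ, 0 < x → x * (1 / x + 1 / x ^ 2) = 1 + 1 / x := fun x hx => by
    field_simp
  have hmU : mainPrimitive U = Real.log U - 2 * (1 / U) +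
    (1 + Real.eulerMascheroniConstant) * (1 / U + 1 / U ^ 2) + errIntegral U := by
    rw [mainPrimitive]; ring
  have hmW : mainPrimitive W = Real.log W - 2 * (1 / W) +
    (1 + Real.eulerMascheroniConstant) * (1 / W + 1 / W ^ 2) + errIntegral W := by
    rw [mainPrimitive]; ring
  have eU := e1 U hU0
  have eW := e1 W hW0
  have h8 : 2 / W = 2 * (1 / W) := by ring
  rw [h8] at h7
  have h9 : errBound U = 0.43 / U - 1.4 / U ^ 2 := rfl
  have h10 : errBound W = 0.43 / W - 1.4 / W ^ 2 := rfl
  rw [← h9] at h4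
  rw [← h10] at h5
  rw [hmU, hmW] at h1
  linear_combination h1 + h2 + h3 + h4 + h5 + h6 + h7 + hW + eU - eW

end Comparison

section Reduction

open Topology

lemma primorialAt_eq_prod {n : ℕ} (hn : 1 ≤ n) :
    primorialAt n = ∏ p ∈ (nthPrime n).primesLE, p := by
  have hinj : Function.Injective (Nat.nth Nat.Prime) :=
    Nat.nth_injective Nat.infinite_setOfPred_prime
  have : (nthPrime n).primesLE = (range n).image (Nat.nth Nat.Prime) := by
    ext p
    rw [Nat.mem_primesLE, Finset.mem_image]
    constructor
    · rintro ⟨h1, h2⟩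
      refine ⟨Nat.count Nat.Prime p, Finset.mem_range.mpr ?_, Nat.nth_count h2⟩
      rw [← Nat.nth_count h2, nthPrime, Nat.nth_le_nth Nat.infinite_setOfPred_prime] at h1
      omega
    · rintro ⟨k, hk, rfl⟩
      refine ⟨?_, Nat.prime_nth_prime k⟩
      rw [nthPrime, Nat.nth_le_nth Nat.infinite_setOfPred_prime]
      have := Finset.mem_range.mp hk
      omega
  rw [this, Finset.prod_image fun a _ b _ h => hinj h, primorialAt]

lemma prime_nthPrime (n : ℕ) : (nthPrime n).Prime := Nat.prime_nth_prime _

lemma log_primorialAt {n : ℕ} (hn : 1 ≤ n) :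
    Real.log (primorialAt n) = ∑ p ∈ (nthPrime n).primesLE, Real.log p := by
  rw [primorialAt_eq_prod hn, Nat.cast_prod, Real.log_prod]
  intro p hp
  exact_mod_cast ((Nat.mem_primesLE.mp hp).2).ne_zero

lemma Rt_primorialAt {t n : ℕ} (hn : 1 ≤ n) :
    Rt t (primorialAt n) = (∏ p ∈ (nthPrime n).primesLE, (1 - 1 / (p : ℝ) ^ t)) *
      (∏ p ∈ (nthPrime n).primesLE, (1 - 1 / (p : ℝ))⁻¹) / Real.log (Real.log (primorialAt n)) := by
  have hp : ∀ p ∈ (nthPrime n).primesLE, p.Prime := fun p hp => (Nat.mem_primesLE.mp hp).2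
  have h0 : (primorialAt n : ℝ) ≠ 0 := by
    rw [primorialAt_eq_prod hn, Nat.cast_ne_zero]
    exact Finset.prod_ne_zero_iff.mpr fun p h => (hp p h).ne_zero
  have h1 : (primorialAt n).primeFactors = (nthPrime n).primesLE := by
    rw [primorialAt_eq_prod hn, Nat.primeFactors_prod hp]
  have h2 : ∏ p ∈ (nthPrime n).primesLE, ∑ i ∈ range t, (1 : ℝ) / (p : ℝ) ^ i =
      (∏ p ∈ (nthPrime n).primesLE, (1 - 1 / (p : ℝ) ^ t)) *
      (∏ p ∈ (nthPrime n).primesLE, (1 - 1 / (p : ℝ))⁻¹) := by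
    rw [← Finset.prod_mul_distrib]
    refine Finset.prod_congr rfl fun p h => ?_
    have h3 : (1 : ℝ) < p := by exact_mod_cast (hp p h).one_lt
    have h4 : (1 : ℝ) / p < 1 := by rw [div_lt_one (by linarith)]; exact h3
    rw [← div_eq_mul_inv, eq_div_iff (by linarith), ← one_div_pow]
    simp_rw [← one_div_pow]
    exact geom_sum_mul_neg _ _
  rw [Rt, Psi, h1, h2, mul_div_mul_left _ _ h0]

lemma prod_primesBelow_le {t x : ℕ} (ht : 2 ≤ t) (hx : 1 ≤ x) (M : ℕ) (hM : x ≤ M) :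
    ∏ p ∈ M.primesLE, (1 - 1 / (p : ℝ) ^ t)⁻¹ ≤
      (∏ p ∈ x.primesLE, (1 - 1 / (p : ℝ) ^ t)⁻¹) * (M * (x + 1) / (x * (M + 1))) := by
  have hx0 : (0 : ℝ) < x := by exact_mod_cast hx
  have hpos : ∀ M : ℕ, 0 ≤ ∏ p ∈ M.primesLE, (1 - 1 / (p : ℝ) ^ t)⁻¹ := by
    intro M
    refine Finset.prod_nonneg fun p hp => inv_nonneg.mpr ?_
    have h3 : (1 : ℝ) ≤ p := by exact_mod_cast (Nat.mem_primesLE.mp hp).2.one_lt.le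
    rw [sub_nonneg, div_le_one (by positivity)]
    exact one_le_pow₀ h3
  induction M, hM using Nat.le_induction with
  | base =>
    rw [div_self (by positivity), mul_one]
  | succ M hM ih =>
    have hM0 : (0 : ℝ) < M := by exact_mod_cast (by omega : 0 < M)
    have hstep : ((M + 1 : ℕ) : ℝ) * (x + 1) / (x * ((M + 1 : ℕ) + 1)) =
        (M * (x + 1) / (x * (M + 1))) * (1 - 1 / ((M : ℝ) + 1) ^ 2)⁻¹ := by
      have e : 1 - 1 / ((M : ℝ) + 1) ^ 2 = M * (M + 2) / (M + 1) ^ 2 := by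
        field_simp
        ring
      rw [e]
      push_cast
      field_simp
      ring
    have h1 : 1 ≤ (1 - 1 / ((M : ℝ) + 1) ^ 2)⁻¹ := by
      have h4 : 1 / ((M : ℝ) + 1) ^ 2 < 1 := by
        rw [div_lt_one (by positivity)]
        nlinarith
      refine (one_le_inv₀ (by linarith)).mpr ?_
      have : 0 < 1 / ((M : ℝ) + 1) ^ 2 := by positivity
      linarith
    rw [hstep, ← mul_assoc]
    by_cases hprime : (M + 1).Prime
    · have h5 : (M + 1).primesLE = insert (M + 1) M.primesLE := by
        ext p
        simp only [Nat.mem_primesLE, Finset.mem_insert]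
        constructor
        · rintro ⟨h1, h2⟩
          rcases Nat.le_succ_iff.mp h1 with h | h
          · exact Or.inr ⟨h, h2⟩
          · exact Or.inl h
        · rintro (rfl | ⟨h1, h2⟩)
          · exact ⟨le_rfl, hprime⟩
          · exact ⟨by omega, h2⟩
      have h6 : M + 1 ∉ M.primesLE := fun h => by
        have := (Nat.mem_primesLE.mp h).1
        omega
      rw [h5, Finset.prod_insert h6, mul_comm]
      have h7 : (1 - 1 / ((M + 1 : ℕ) : ℝ) ^ t)⁻¹ ≤ (1 - 1 / ((M : ℝ) + 1) ^ 2)⁻¹ := by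
        have h4 : 1 / ((M : ℝ) + 1) ^ 2 < 1 := by
          rw [div_lt_one (by positivity)]
          nlinarith
        have h5 : 1 / ((M : ℝ) + 1) ^ t ≤ 1 / ((M : ℝ) + 1) ^ 2 :=
          one_div_le_one_div_of_le (by positivity) (pow_le_pow_right₀ (by linarith) ht)
        push_cast
        exact inv_anti₀ (by linarith) (by linarith)
      exact mul_le_mul ih h7 (by
        have : (1 : ℝ) ≤ ((M + 1 : ℕ) : ℝ) ^ t := one_le_pow₀ (by push_cast; linarith)
        rw [inv_nonneg, sub_nonneg, div_le_one (by linarith)]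
        exact this) (mul_nonneg (hpos x) (by positivity))
    · have h5 : (M + 1).primesLE = M.primesLE := by
        ext p
        simp only [Nat.mem_primesLE]
        refine and_congr_left fun h => ⟨fun h1 => ?_, fun h1 => by omega⟩
        rcases Nat.le_succ_iff.mp h1 with h2 | h2
        · exact h2
        · subst h2
          exact absurd h hprime
      rw [h5]
      exact ih.trans (le_mul_of_one_le_right (mul_nonneg (hpos x) (by positivity)) h1)

lemma zetaNat_le {t x : ℕ} (ht : 2 ≤ t) (hx : 1 ≤ x) :
    zetaNat t ≤ (∏ p ∈ x.primesLE, (1 - 1 / (p : ℝ) ^ t)⁻¹) * Real.exp (1 / x) := by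
  have hx0 : (0 : ℝ) < x := by exact_mod_cast hx
  let f : ℕ →*₀ ℝ :=
    { toFun := fun n => 1 / (n : ℝ) ^ t
      map_zero' := by simp [show t ≠ 0 by omega]
      map_one' := by simp
      map_mul' := fun a b => by push_cast; rw [mul_pow]; field_simp }
  have hf : ∀ n : ℕ, f n = 1 / (n : ℝ) ^ t := fun _ => rfl
  have hsum : Summable fun n => f n := by
    simp only [hf]
    exact Real.summable_one_div_nat_pow.mpr (by omega)
  have h1 := EulerProduct.eulerProduct_completely_multiplicative (f := f) hsum.norm
  have h2 : ∑' n, f n = zetaNat t := by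
    rw [hsum.tsum_eq_zero_add, map_zero, zero_add, zetaNat]
    refine tsum_congr fun k => ?_
    rw [hf]
    push_cast
    rfl
  rw [h2] at h1
  refine le_of_tendsto h1 ?_
  filter_upwards [eventually_gt_atTop x] with M hM
  obtain ⟨K, rfl⟩ : ∃ K, M = K + 1 := ⟨M - 1, by omega⟩
  have h3 := prod_primesBelow_le ht hx K (by omega)
  refine h3.trans ?_
  gcongr
  · refine Finset.prod_nonneg fun p hp => inv_nonneg.mpr ?_
    have h3 : (1 : ℝ) ≤ p := by exact_mod_cast (Nat.mem_primesLE.mp hp).2.one_lt.le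
    rw [sub_nonneg, div_le_one (by positivity)]
    exact one_le_pow₀ h3
  · have h4 := Real.add_one_le_exp (1 / (x : ℝ))
    refine le_trans ?_ h4
    have e : 1 / (x : ℝ) + 1 = (x + 1) / x := by field_simp; ring
    rw [e, div_le_div_iff₀ (by positivity) hx0]
    have : (0 : ℝ) ≤ K := by positivity
    nlinarith [mul_pos hx0 hx0]

/-- The claim follows from a bound for the product over primes in Mertens' third theorem. -/
theorem Rt_lt_of_prod_le {t n : ℕ} (ht : 2 ≤ t) (hn : 1 ≤ n) {a : ℝ}
    (h0 : 0 < Real.log (Real.log (primorialAt n)))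
    (h1 : ∏ p ∈ (nthPrime n).primesLE, (1 - 1 / (p : ℝ))⁻¹ ≤
      Real.exp Real.eulerMascheroniConstant * Real.log (Real.log (primorialAt n)) * (1 + a))
    (h2 : Real.exp (2 / (nthPrime n : ℝ)) * (1 + a) < zetaNat t) :
    Rt t (primorialAt n) < Real.exp Real.eulerMascheroniConstant := by
  have hx : 1 ≤ nthPrime n := (prime_nthPrime n).one_lt.le
  have hx0 : (0 : ℝ) < nthPrime n := by exact_mod_cast hx
  have hz := zetaNat_le ht hx
  have hpos : 0 < ∏ p ∈ (nthPrime n).primesLE, (1 - 1 / (p : ℝ) ^ t) := by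
    refine Finset.prod_pos fun p hp => ?_
    have h3 : (1 : ℝ) < p := by exact_mod_cast (Nat.mem_primesLE.mp hp).2.one_lt
    rw [sub_pos, div_lt_one (by positivity)]
    exact one_lt_pow₀ h3 (by omega)
  rw [Finset.prod_inv_distrib] at hz
  rw [Rt_primorialAt hn, div_lt_iff₀ h0]
  set Q := ∏ p ∈ (nthPrime n).primesLE, (1 - 1 / (p : ℝ) ^ t)
  set L := Real.log (Real.log (primorialAt n))
  have h3 : Q * zetaNat t ≤ Real.exp (1 / nthPrime n) := by
    have := mul_le_mul_of_nonneg_left hz hpos.le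
    rwa [mul_inv_cancel_left₀ hpos.ne'] at this
  have h4 : Q * (1 + a) < 1 := by
    have h5 : Q * (Real.exp (2 / (nthPrime n : ℝ)) * (1 + a)) < Real.exp (1 / nthPrime n) :=
      (mul_lt_mul_of_pos_left h2 hpos).trans_le h3
    have h6 : Real.exp (1 / nthPrime n) ≤ Real.exp (2 / (nthPrime n : ℝ)) := by
      gcongr
      norm_num
    have h7 : Real.exp (2 / (nthPrime n : ℝ)) * (Q * (1 + a)) <
        Real.exp (2 / (nthPrime n : ℝ)) * 1 := by linarith
    exact lt_of_mul_lt_mul_left h7 (Real.exp_pos _).le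
  calc _ ≤ Q * (Real.exp Real.eulerMascheroniConstant * L * (1 + a)) := by gcongr
    _ = Real.exp Real.eulerMascheroniConstant * L * (Q * (1 + a)) := by ring
    _ < Real.exp Real.eulerMascheroniConstant * L * 1 := by gcongr
    _ = _ := by ring

end Reduction

section Size

lemma two_mul_succ_le_nth_prime (k : ℕ) : 2 * (k + 1) ≤ Nat.nth Nat.Prime (k + 1) := by
  induction k with
  | zero => exact (Nat.prime_nth_prime 1).two_le
  | succ k ih =>
    have h1 : Nat.nth Nat.Prime (k + 1) < Nat.nth Nat.Prime (k + 2) :=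
      (Nat.nth_lt_nth Nat.infinite_setOfPred_prime).mpr (by omega)
    have h0 : Nat.nth Nat.Prime 0 < Nat.nth Nat.Prime (k + 1) :=
      (Nat.nth_lt_nth Nat.infinite_setOfPred_prime).mpr (by omega)
    have h2 := (Nat.prime_nth_prime 0).two_le
    have h3 := (Nat.prime_nth_prime (k + 1)).eq_two_or_odd
    have h4 := (Nat.prime_nth_prime (k + 2)).eq_two_or_odd
    change 2 * (k + 2) ≤ Nat.nth Nat.Prime (k + 2)
    omega

lemma two_pow_mul_factorial_le_primorialAt (m : ℕ) :
    2 ^ m * m.factorial ≤ primorialAt (m + 1) := by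
  induction m with
  | zero => simp [primorialAt]
  | succ m ih =>
    rw [primorialAt, Finset.prod_range_succ, ← primorialAt, Nat.factorial_succ, pow_succ]
    calc 2 ^ m * 2 * ((m + 1) * m.factorial) = 2 ^ m * m.factorial * (2 * (m + 1)) := by ring
      _ ≤ _ := Nat.mul_le_mul ih (two_mul_succ_le_nth_prime m)

lemma two_pow_le_log_primorialAt {n : ℕ} (hn : 2263 ≤ n) :
    (2 : ℝ) ^ 14 ≤ Real.log (primorialAt n) := by
  obtain ⟨m, rfl⟩ : ∃ m, n = m + 1 := ⟨n - 1, by omega⟩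
  have hm : (2262 : ℝ) ≤ m := by exact_mod_cast (by omega : 2262 ≤ m)
  have h1 : Real.log ((2 ^ m * m.factorial : ℕ) : ℝ) ≤ Real.log (primorialAt (m + 1)) := by
    refine Real.log_le_log ?_ (by exact_mod_cast two_pow_mul_factorial_le_primorialAt m)
    have := m.factorial_pos
    positivity
  have hl := Real.log_two_gt_d9
  have h2 := Stirling.le_log_factorial_stirling (n := m) (by omega)
  have h3 : 11 * Real.log 2 ≤ Real.log m := by
    rw [← Real.log_rpow (by norm_num)]
    refine Real.log_le_log (by positivity) (le_trans ?_ hm)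
    norm_num
  have h4 : 0 ≤ Real.log (2 * Real.pi) :=
    Real.log_nonneg (by linarith [Real.pi_gt_three])
  push_cast at h1
  rw [Real.log_mul (by positivity) (by exact_mod_cast m.factorial_ne_zero), Real.log_pow] at h1
  have h5 : (m : ℝ) * (11 * Real.log 2) ≤ m * Real.log m := by gcongr
  have h6 : 0 ≤ Real.log m := by linarith
  generalize Real.log (primorialAt (m + 1)) = Y at *
  generalize Real.log m.factorial = F at *
  have h7 : (2262 : ℝ) * (12 * Real.log 2 - 1) ≤ m * (12 * Real.log 2 - 1) := by
    gcongr
    linarith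
  norm_num
  linarith

/-- An elementary form of Chebyshev's lower bound for `∑ log p`. -/
lemma log_le_log_sum_primesLE {x : ℕ}
    (hy : (2 : ℝ) ^ 14 ≤ ∑ p ∈ x.primesLE, Real.log p) :
    Real.log x ≤ Real.log (∑ p ∈ x.primesLE, Real.log p) + Real.log 2 := by
  have h1 := Chebyshev.theta_ge x
  have h2 := Chebyshev.theta_le_log4_mul_x (x := x) (by positivity)
  rw [Chebyshev.theta_eq_sum_primesLE_log] at h1 h2
  set y := ∑ p ∈ x.primesLE, Real.log p
  have hl := Real.log_two_gt_d9
  have hl' := Real.log_two_lt_d9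
  have h4 : Real.log 4 = 2 * Real.log 2 := by
    rw [show (4 : ℝ) = 2 ^ 2 by norm_num, Real.log_pow]
    norm_num
  rw [h4] at h2
  have hx : (10000 : ℝ) ≤ x := by
    by_contra! h
    nlinarith
  have hx0 : (0 : ℝ) < x := by linarith
  have h5 : Real.log x / √x ≤ Real.log 10000 / √10000 := by
    have he : Real.exp 2 ≤ 10000 := by
      have := Real.exp_one_lt_d9
      have e : Real.exp 2 = Real.exp 1 * Real.exp 1 := by rw [← Real.exp_add]; norm_num
      rw [e]
      nlinarith [Real.exp_pos 1]
    exact Real.log_div_sqrt_antitoneOn he (he.trans hx) hx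
  have h6 : √(10000 : ℝ) = 100 := by
    rw [show (10000 : ℝ) = 100 ^ 2 by norm_num, Real.sqrt_sq (by norm_num)]
  have h7 : Real.log (10000 : ℝ) ≤ 9.3 := by
    have := log_le_div_mul_log_two (a := 10000) (by norm_num) 40 3 (by norm_num) (by norm_num)
    norm_num at this
    linarith
  have hs : 100 ≤ √(x : ℝ) := h6 ▸ Real.sqrt_le_sqrt hx
  have hss : √(x : ℝ) * √(x : ℝ) = x := Real.mul_self_sqrt hx0.le
  have h8 : Real.log x ≤ 0.093 * √x := by
    rw [div_le_iff₀ (by linarith), h6] at h5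
    refine h5.trans ?_
    gcongr
    linarith
  have h9 : Real.log (x + 1) ≤ Real.log x + 1 := by
    have e : Real.log ((x : ℝ) + 1) = Real.log x + Real.log (1 + 1 / x) := by
      rw [← Real.log_mul (by positivity) (by positivity)]
      congr 1
      field_simp
    have := Real.log_le_sub_one_of_pos (x := 1 + 1 / (x : ℝ)) (by positivity)
    have : 1 / (x : ℝ) ≤ 1 := by rw [div_le_one hx0]; linarith
    linarith
  have h10 : (x : ℝ) / 2 ≤ y := by
    have : √(x : ℝ) * Real.log x ≤ 0.093 * x := by nlinarith
    nlinarith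
  have hy0 : 0 < y := lt_of_lt_of_le (by norm_num) hy
  rw [← Real.log_mul hy0.ne' (by norm_num)]
  exact Real.log_le_log hx0 (by linarith)

end Size

section PrimePowers

open Topology ArithmeticFunction

lemma neg_log_one_sub_le {x : ℝ} (hx0 : 0 ≤ x) (hx1 : x < 1) (K : ℕ) :
    -Real.log (1 - x) ≤ ∑ k ∈ range K, x ^ (k + 1) / (k + 1) +
      x ^ (K + 1) / ((K + 1) * (1 - x)) := by
  have h := Real.hasSum_pow_div_log_of_abs_lt_one (x := x) (by rwa [abs_of_nonneg hx0])
  rw [← h.tsum_eq, ← h.summable.sum_add_tsum_nat_add K]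
  gcongr
  have hg := (hasSum_geometric_of_lt_one hx0 hx1).mul_left (x ^ (K + 1) / (K + 1))
  have e : x ^ (K + 1) / ((K + 1) * (1 - x)) = x ^ (K + 1) / (K + 1) * (1 - x)⁻¹ := by
    rw [← div_div, div_eq_mul_inv _ (1 - x)]
  rw [e, ← hg.tsum_eq]
  refine Summable.tsum_le_tsum (fun k => ?_) ((summable_nat_add_iff K).mpr h.summable) hg.summable
  push_cast
  rw [show k + K + 1 = (K + 1) + k by ring, pow_add, mul_div_right_comm]
  gcongr
  linarith [(Nat.cast_nonneg k : (0 : ℝ) ≤ k)]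

lemma mertensTerm_prime_pow_ge {p : ℕ} (hp : p.Prime) (k : ℕ) {y : ℝ} (hy : 0 < y) :
    (1 / (p : ℝ)) ^ (k + 1) / (k + 1) - Real.log p / (y * Real.log y) ≤
      mertensTerm (p ^ (k + 1)) (Real.log y) := by
  have h1 : 0 < Real.log p := Real.log_pos (by exact_mod_cast hp.one_lt)
  have h0 : (0 : ℝ) < p := by exact_mod_cast hp.pos
  rw [mertensTerm, vonMangoldt_apply_pow (by omega), vonMangoldt_apply_prime hp, Nat.cast_pow,
    Real.log_pow, Real.exp_neg, Real.exp_log hy]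
  refine le_trans (le_of_eq ?_) (mul_le_mul_of_nonneg_left (le_max_left _ _) h1.le)
  push_cast
  rw [mul_sub, one_div_pow]
  congr 1
  · field_simp
  · rw [inv_eq_one_div, div_div, mul_one_div]

lemma sum_prime_pow_le_mertens {x : ℕ} {y : ℝ} (hy : 0 < y) (K : ℕ → ℕ) :
    ∃ N₀ : ℕ, ∑ p ∈ x.primesLE, ∑ k ∈ range (K p),
      ((1 / (p : ℝ)) ^ (k + 1) / (k + 1) - Real.log p / (y * Real.log y)) ≤
        ∑ n ∈ range N₀, mertensTerm n (Real.log y) := by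
  set S := (x.primesLE.sigma fun p => range (K p)) with hS
  set g : (_ : ℕ) × ℕ → ℕ := fun q => q.1 ^ (q.2 + 1) with hg
  have hinj : Set.InjOn g S := by
    rintro ⟨p, k⟩ h1 ⟨q, l⟩ h2 h
    simp only [hS, Finset.coe_sigma, Set.mem_sigma_iff, Finset.mem_coe, Nat.mem_primesLE] at h1 h2
    have h' : p ^ (k + 1) = q ^ (l + 1) := h
    obtain ⟨rfl, h3⟩ := Nat.Prime.pow_inj h1.1.2 h2.1.2 h'
    obtain rfl : k = l := by omega
    rfl
  refine ⟨(S.image g).sup id + 1, ?_⟩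
  calc _ ≤ ∑ p ∈ x.primesLE, ∑ k ∈ range (K p), mertensTerm (p ^ (k + 1)) (Real.log y) := by
        gcongr with p hp k hk
        exact mertensTerm_prime_pow_ge (Nat.mem_primesLE.mp hp).2 k hy
    _ = ∑ n ∈ S.image g, mertensTerm n (Real.log y) := by
        rw [Finset.sum_image hinj, hS, Finset.sum_sigma]
    _ ≤ _ := by
        refine Finset.sum_le_sum_of_subset_of_nonneg (fun n hn => ?_)
          fun n _ _ => mertensTerm_nonneg n _
        exact Finset.mem_range.mpr (Nat.lt_succ_of_le (Finset.le_sup (f := id) hn))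

lemma log_le_mul_pred {p : ℕ} (hp : 2 ≤ p) : Real.log p ≤ 0.7 * (p - 1) := by
  have h := log_le_tangent (x := p) (a := 2) (by positivity) (by norm_num)
  have := Real.log_two_lt_d9
  have h2 : (2 : ℝ) ≤ p := by exact_mod_cast hp
  linarith

lemma exists_neg_log_le_of_small {p : ℕ} (hp : p.Prime) {y : ℝ} (hy : 1 < y) :
    ∃ K : ℕ, -Real.log (1 - 1 / (p : ℝ)) ≤
      ∑ k ∈ range K, ((1 / (p : ℝ)) ^ (k + 1) / (k + 1) - Real.log p / (y * Real.log y)) +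
        Real.log p / (y * Real.log y) + (Real.log y + 0.7) / (y * Real.log y) := by
  have hU : 0 < Real.log y := Real.log_pos hy
  have h1 : 0 < Real.log p := Real.log_pos (by exact_mod_cast hp.one_lt)
  have h2 : (1 : ℝ) < p := by exact_mod_cast hp.one_lt
  set U := Real.log y with hUdef
  set K := ⌊U / Real.log p⌋₊ with hK
  have h3 : K * Real.log p ≤ U := by
    rw [← le_div_iff₀ h1]
    exact Nat.floor_le (by positivity)
  have h4 : U < (K + 1) * Real.log p := by
    rw [← div_lt_iff₀ h1]
    exact Nat.lt_floor_add_one _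
  have h5 : y ≤ (p : ℝ) ^ (K + 1) := by
    rw [← Real.log_le_log_iff (by linarith) (by positivity), Real.log_pow]
    push_cast
    exact h4.le
  have h6 : (1 / (p : ℝ)) ^ (K + 1) / (K + 1) ≤ Real.log p / (y * U) := by
    rw [one_div_pow, div_div, div_le_div_iff₀ (by positivity) (by positivity)]
    have : y * U ≤ (p : ℝ) ^ (K + 1) * ((K + 1) * Real.log p) := by gcongr
    linarith
  refine ⟨K, (neg_log_one_sub_le (by positivity) ?_ K).trans ?_⟩
  · rwa [div_lt_one (by linarith)]
  rw [Finset.sum_sub_distrib, Finset.sum_const, Finset.card_range, nsmul_eq_mul]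
  have h7 : (1 - 1 / (p : ℝ))⁻¹ = 1 + 1 / (p - 1) := by
    have : (p : ℝ) - 1 ≠ 0 := by linarith
    field_simp
    ring
  have h8 : (1 / (p : ℝ)) ^ (K + 1) / ((K + 1) * (1 - 1 / p)) ≤
      (Real.log p + 0.7) / (y * U) := by
    rw [← div_div, div_eq_mul_inv _ (1 - 1 / (p : ℝ)), h7]
    have h9 : Real.log p * (1 + 1 / (p - 1)) ≤ Real.log p + 0.7 := by
      have : Real.log p * (1 / (p - 1)) ≤ 0.7 := by
        rw [mul_one_div, div_le_iff₀ (by linarith)]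
        exact log_le_mul_pred hp.two_le
      linarith
    have h10 : (0 : ℝ) < p - 1 := by linarith
    calc _ ≤ Real.log p / (y * U) * (1 + 1 / (p - 1)) := by gcongr
      _ = Real.log p * (1 + 1 / (p - 1)) / (y * U) := by ring
      _ ≤ _ := by gcongr
  have h11 : K * (Real.log p / (y * U)) ≤ U / (y * U) := by
    rw [← mul_div_assoc]
    gcongr
  rw [add_div] at h8 ⊢
  linarith

lemma exists_neg_log_le_of_large {p : ℕ} (hp : p.Prime) (c : ℝ) :
    ∃ K : ℕ, -Real.log (1 - 1 / (p : ℝ)) ≤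
      ∑ k ∈ range K, ((1 / (p : ℝ)) ^ (k + 1) / (k + 1) - c) + c + 1 / (2 * p * (p - 1)) := by
  have h2 : (1 : ℝ) < p := by exact_mod_cast hp.one_lt
  refine ⟨1, (neg_log_one_sub_le (by positivity) ?_ 1).trans (le_of_eq ?_)⟩
  · rwa [div_lt_one (by linarith)]
  · have : (p : ℝ) - 1 ≠ 0 := by linarith
    simp
    field_simp
    ring

lemma sum_odd_le (J X : ℕ) (hJ : 1 ≤ J) :
    ∑ j ∈ Ico J X, (1 : ℝ) / (2 * ((2 * j + 1 : ℕ) : ℝ) * (((2 * j + 1 : ℕ) : ℝ) - 1)) ≤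
      1 / (8 * J - 2) := by
  have hJ0 : (1 : ℝ) ≤ J := by exact_mod_cast hJ
  rcases le_or_gt X J with h | h
  · rw [Finset.Ico_eq_empty_of_le h, Finset.sum_empty]
    exact div_nonneg zero_le_one (by linarith)
  suffices H : ∑ j ∈ Ico J X, (1 : ℝ) / (2 * ((2 * j + 1 : ℕ) : ℝ) * (((2 * j + 1 : ℕ) : ℝ) - 1)) ≤
      1 / (8 * J - 2) - 1 / (8 * X - 2) by
    have : (J : ℝ) < X := by exact_mod_cast h
    have : (0 : ℝ) ≤ 1 / (8 * X - 2) := div_nonneg zero_le_one (by linarith)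
    linarith
  induction X, h.le using Nat.le_induction with
  | base => simp
  | succ X hX ih =>
    have hX0 : (1 : ℝ) ≤ X := by exact_mod_cast hJ.trans hX
    rw [Finset.sum_Ico_succ_top hX]
    have hstep : (1 : ℝ) / (2 * ((2 * X + 1 : ℕ) : ℝ) * (((2 * X + 1 : ℕ) : ℝ) - 1)) ≤
        1 / (8 * X - 2) - 1 / (8 * (X + 1 : ℕ) - 2) := by
      push_cast
      have h1 : (0 : ℝ) < 8 * X - 2 := by linarith
      have h2 : (0 : ℝ) < 8 * (X + 1) - 2 := by linarith
      rw [div_sub_div _ _ h1.ne' h2.ne', div_le_div_iff₀ (by nlinarith) (by positivity)]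
      nlinarith
    rcases hX.eq_or_lt with rfl | h'
    · simpa using hstep
    · linarith [ih h']

lemma sum_large_primes_le (x : ℕ) {s : ℝ} (hs : 2 ≤ s) :
    ∑ p ∈ x.primesLE.filter (fun p : ℕ => ¬ (p : ℝ) ≤ s), (1 : ℝ) / (2 * p * (p - 1)) ≤ 1 / (4 * s - 6) := by
  set J := ⌊(s + 1) / 2⌋₊ with hJdef
  have hJ : 1 ≤ J := Nat.le_floor (by push_cast; linarith)
  have hJ1 : (s + 1) / 2 < J + 1 := Nat.lt_floor_add_one _
  have hsub : (x.primesLE.filter fun p : ℕ => ¬ (p : ℝ) ≤ s) ⊆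
      (Ico J (x + 1)).image fun j => 2 * j + 1 := by
    intro p hp
    rw [Finset.mem_filter, Nat.mem_primesLE, not_le] at hp
    obtain ⟨⟨h1, h2⟩, h3⟩ := hp
    have h4 : p ≠ 2 := by
      rintro rfl
      norm_num at h3
      linarith
    have h5 := h2.eq_two_or_odd.resolve_left h4
    refine Finset.mem_image.mpr ⟨p / 2, Finset.mem_Ico.mpr ⟨?_, by omega⟩, by omega⟩
    have h6 : (p : ℝ) = 2 * (p / 2 : ℕ) + 1 := by exact_mod_cast (by omega : p = 2 * (p / 2) + 1)
    rw [hJdef]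
    refine Nat.lt_succ_iff.mp ((Nat.floor_lt (by linarith)).mpr ?_)
    push_cast
    linarith
  have hs6 : 4 * s - 6 ≤ 8 * J - 2 := by linarith
  refine (Finset.sum_le_sum_of_subset_of_nonneg hsub fun p hp _ => ?_).trans ?_
  · obtain ⟨j, -, rfl⟩ := Finset.mem_image.mp hp
    push_cast
    refine div_nonneg zero_le_one (mul_nonneg (by positivity) ?_)
    linarith [(Nat.cast_nonneg j : (0 : ℝ) ≤ j)]
  · rw [Finset.sum_image fun a _ b _ h => by simpa using h]
    exact (sum_odd_le J (x + 1) hJ).trans (one_div_le_one_div_of_le (by linarith) hs6)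

lemma card_small_primes_le (x : ℕ) {s : ℝ} (hs : 6 ≤ s) :
    ((x.primesLE.filter fun p : ℕ => (p : ℝ) ≤ s).card : ℝ) ≤ s / 3 + 3 := by
  obtain ⟨m, hm⟩ : ∃ m, ⌊s⌋₊ = m + 6 :=
    ⟨⌊s⌋₊ - 6, by have : 6 ≤ ⌊s⌋₊ := Nat.le_floor (by exact_mod_cast hs); omega⟩
  have h1 : (x.primesLE.filter fun p : ℕ => (p : ℝ) ≤ s).card ≤ Nat.primeCounting' (7 + m) := by
    rw [Nat.primeCounting', Nat.count_eq_card_filter_range]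
    refine Finset.card_le_card fun p hp => ?_
    rw [Finset.mem_filter, Nat.mem_primesLE] at hp
    rw [Finset.mem_filter, Finset.mem_range]
    have := Nat.le_floor hp.2
    exact ⟨by omega, hp.1.2⟩
  have h2 := Nat.primeCounting'_add_le (a := 6) (k := 7) (by norm_num) (by norm_num) m
  have h3 : Nat.primeCounting' 7 = 3 := by decide
  have h4 : Nat.totient 6 = 2 := by decide
  rw [h3, h4] at h2
  have h5 : 3 * (x.primesLE.filter fun p : ℕ => (p : ℝ) ≤ s).card ≤ (m + 6) + 9 := by omega
  have h6 : ((m + 6 : ℕ) : ℝ) ≤ s := hm ▸ Nat.floor_le (by linarith)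
  have h7 : (3 : ℝ) * ((x.primesLE.filter fun p : ℕ => (p : ℝ) ≤ s).card : ℝ) ≤
      ((m + 6 : ℕ) : ℝ) + 9 := by exact_mod_cast h5
  linarith

end PrimePowers

section Conclusion

lemma sum_neg_log_one_sub_le {x : ℕ} {y : ℝ} (hy : (2 : ℝ) ^ 14 ≤ y)
    (hxy : ∑ p ∈ x.primesLE, Real.log p = y) :
    ∑ p ∈ x.primesLE, -Real.log (1 - 1 / (p : ℝ)) ≤
      Real.log (Real.log y) + Real.eulerMascheroniConstant +
        (errBound (Real.log y) * (1 / Real.log y + 1 / Real.log y ^ 2) +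
          errIntegral (Real.log y)) +
        ((√y / 3 + 3) * ((Real.log y + 0.7) / (y * Real.log y)) + 1 / (4 * √y - 6)) := by
  have hy0 : 0 < y := lt_of_lt_of_le (by norm_num) hy
  have hU : 9.7 ≤ Real.log y := by
    have h1 : Real.log ((2 : ℝ) ^ 14) ≤ Real.log y := Real.log_le_log (by norm_num) hy
    rw [Real.log_pow] at h1
    have := Real.log_two_gt_d9
    norm_num at h1 ⊢
    linarith
  have hs : 128 ≤ √y := by
    rw [show (128 : ℝ) = √(2 ^ 14) by
      rw [show (2 : ℝ) ^ 14 = 128 ^ 2 by norm_num, Real.sqrt_sq (by norm_num)]]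
    exact Real.sqrt_le_sqrt hy
  have hK : ∀ p : ℕ, ∃ K : ℕ, p.Prime → -Real.log (1 - 1 / (p : ℝ)) ≤
      ∑ k ∈ range K, ((1 / (p : ℝ)) ^ (k + 1) / (k + 1) - Real.log p / (y * Real.log y)) +
        Real.log p / (y * Real.log y) + if (p : ℝ) ≤ √y then
          (Real.log y + 0.7) / (y * Real.log y) else 1 / (2 * p * (p - 1)) := by
    intro p
    by_cases hp : p.Prime
    · by_cases h : (p : ℝ) ≤ √y
      · simp only [if_pos h]
        obtain ⟨K, hK⟩ := exists_neg_log_le_of_small hp (y := y) (by linarith)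
        exact ⟨K, fun _ => hK⟩
      · simp only [if_neg h]
        obtain ⟨K, hK⟩ := exists_neg_log_le_of_large hp (Real.log p / (y * Real.log y))
        exact ⟨K, fun _ => hK⟩
    · exact ⟨0, fun h => absurd h hp⟩
  choose K hK using hK
  obtain ⟨N₀, hN⟩ := sum_prime_pow_le_mertens (x := x) hy0 K
  have hT := sum_mertensTerm_le hU N₀
  have h1 := Finset.sum_le_sum fun p (hp : p ∈ x.primesLE) => hK p (Nat.mem_primesLE.mp hp).2
  rw [Finset.sum_add_distrib, Finset.sum_add_distrib, ← Finset.sum_div, hxy, Finset.sum_ite,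
    Finset.sum_const, nsmul_eq_mul] at h1
  have h2 := sum_large_primes_le x (s := √y) (by linarith)
  have h3 := mul_le_mul_of_nonneg_right (card_small_primes_le x (s := √y) (by linarith))
    (show 0 ≤ (Real.log y + 0.7) / (y * Real.log y) from
      div_nonneg (by linarith) (mul_nonneg hy0.le (by linarith)))
  have h4 : y / (y * Real.log y) = 1 / Real.log y := by
    rw [← div_div, div_self hy0.ne']
  linarith

lemma remainder_le {y : ℝ} (hy : (2 : ℝ) ^ 14 ≤ y) :
    (√y / 3 + 3) * ((Real.log y + 0.7) / (y * Real.log y)) + 1 / (4 * √y - 6) ≤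
      0.468 / Real.log y ^ 2 := by
  obtain ⟨s, hs0, rfl⟩ : ∃ s : ℝ, 0 ≤ s ∧ y = s ^ 2 :=
    ⟨√y, Real.sqrt_nonneg y, (Real.sq_sqrt (le_trans (by norm_num) hy)).symm⟩
  have hs : 128 ≤ s := by nlinarith
  rw [Real.sqrt_sq hs0, Real.log_pow]
  push_cast
  have h1 : Real.log 128 = 7 * Real.log 2 := by
    rw [show (128 : ℝ) = 2 ^ 7 by norm_num, Real.log_pow]
    norm_num
  have hl := Real.log_two_lt_d9
  have hl' := Real.log_two_gt_d9
  have hlog : 7 * Real.log 2 ≤ Real.log s := h1 ▸ Real.log_le_log (by norm_num) hs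
  have he : Real.exp 2 ≤ 128 := by
    have := Real.exp_one_lt_d9
    have e : Real.exp 2 = Real.exp 1 * Real.exp 1 := by rw [← Real.exp_add]; norm_num
    rw [e]
    nlinarith [Real.exp_pos 1]
  have h2 : Real.log s / √s ≤ Real.log 128 / √128 :=
    Real.log_div_sqrt_antitoneOn he (he.trans hs) hs
  have h3 : Real.log s ^ 2 / s ≤ (7 * Real.log 2) ^ 2 / 128 := by
    have h4 : 0 ≤ Real.log s / √s := div_nonneg (by linarith) (Real.sqrt_nonneg s)
    have h5 := pow_le_pow_left₀ h4 h2 2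
    rwa [div_pow, div_pow, Real.sq_sqrt hs0, Real.sq_sqrt (by norm_num), h1] at h5
  set L := Real.log s
  have hs1 : 0 < s := by linarith
  have hL : 4.85 ≤ L := by linarith
  have hL0 : 0 < L := by linarith
  have h6 : (2 * L) ^ 2 ≤ 0.7358 * s := by
    rw [div_le_iff₀ hs1] at h3
    have h7 : (7 * Real.log 2) ^ 2 / 128 ≤ 0.18393 := by nlinarith
    nlinarith
  have h8 : (s / 3 + 3) * ((2 * L + 0.7) / (s ^ 2 * (2 * L))) ≤ 0.3826 / s := by
    have h9 : (2 * L + 0.7) / (s ^ 2 * (2 * L)) ≤ 1.0722 / s ^ 2 := by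
      rw [div_le_div_iff₀ (by positivity) (by positivity)]
      have : 2 * L + 0.7 ≤ 1.0722 * (2 * L) := by linarith
      nlinarith [mul_le_mul_of_nonneg_right this (sq_nonneg s)]
    have h10 : s / 3 + 3 ≤ 0.3568 * s := by linarith
    calc _ ≤ 0.3568 * s * (1.0722 / s ^ 2) := by gcongr
      _ = 0.3568 * 1.0722 / s := by field_simp
      _ ≤ _ := by gcongr; norm_num
  have h11 : 1 / (4 * s - 6) ≤ 0.2531 / s := by
    rw [div_le_div_iff₀ (by linarith) hs1]
    linarith
  calc _ ≤ 0.3826 / s + 0.2531 / s := add_le_add h8 h11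
    _ = 0.6357 / s := by rw [← add_div]; norm_num
    _ ≤ _ := by
      rw [div_le_div_iff₀ hs1 (by positivity)]
      linarith

lemma error_le_log {U a : ℝ} (hU : 9.7 ≤ U) (ha : 1.1253 / ((U + Real.log 2) * U) ≤ a) :
    errBound U * (1 / U + 1 / U ^ 2) + errIntegral U + 0.468 / U ^ 2 ≤ Real.log (1 + a) := by
  have hl := Real.log_two_lt_d9
  have hl' := Real.log_two_gt_d9
  have hU0 : 0 < U := by linarith
  obtain ⟨z, hz⟩ : ∃ z, z = 1 / U := ⟨_, rfl⟩
  have hz0 : 0 < z := hz ▸ by positivity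
  have hz1 : z ≤ 0.104 := by
    rw [hz, div_le_iff₀ hU0]
    linarith
  have e1 : errBound U * (1 / U + 1 / U ^ 2) + errIntegral U + 0.468 / U ^ 2 =
      1.113 * z ^ 2 - 1.15 * z ^ 3 - 2.1 * z ^ 4 := by
    rw [errBound, errIntegral, hz]
    field_simp
    ring
  set b := 1.1253 * z ^ 2 * (1 - 0.6932 * z) with hb
  have hb0 : 0 ≤ b := mul_nonneg (by positivity) (by linarith)
  have hb1 : b ≤ 1.1253 * z ^ 2 := mul_le_of_le_one_right (by positivity) (by linarith)
  have hba : b ≤ a := by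
    refine le_trans ?_ ha
    have e2 : b = 1.1253 * (U - 0.6932) / U ^ 3 := by
      rw [hb, hz]
      field_simp
    rw [e2, div_le_div_iff₀ (by positivity) (by positivity)]
    have : (U - 0.6932) * (U + Real.log 2) ≤ U ^ 2 := by nlinarith
    nlinarith [mul_le_mul_of_nonneg_right this hU0.le]
  have h1 : b - b ^ 2 / 2 ≤ Real.log (1 + b) := by
    refine le_trans ?_ (Real.le_log_one_add_of_nonneg hb0)
    rw [le_div_iff₀ (by linarith)]
    nlinarith [pow_nonneg hb0 3]
  have h2 : Real.log (1 + b) ≤ Real.log (1 + a) := Real.log_le_log (by linarith) (by linarith)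
  have h3 : b ^ 2 ≤ (1.1253 * z ^ 2) ^ 2 := pow_le_pow_left₀ hb0 hb1 2
  rw [e1]
  have h4 : b = 1.1253 * z ^ 2 - 0.78005796 * z ^ 3 := by rw [hb]; ring
  have h5 : (1.1253 * z ^ 2) ^ 2 = 1.26630009 * z ^ 4 := by ring
  have := pow_pos hz0 2
  have := pow_pos hz0 3
  have := pow_pos hz0 4
  linarith

lemma prod_inv_one_sub_le {n : ℕ} (hn : 2263 ≤ n) :
    ∏ p ∈ (nthPrime n).primesLE, (1 - 1 / (p : ℝ))⁻¹ ≤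
      Real.exp Real.eulerMascheroniConstant * Real.log (Real.log (primorialAt n)) *
        (1 + 1.1253 / (Real.log (nthPrime n) * Real.log (Real.log (primorialAt n)))) := by
  have hy := two_pow_le_log_primorialAt hn
  have hxy := (log_primorialAt (n := n) (by omega)).symm
  have hlx := log_le_log_sum_primesLE (x := nthPrime n) (hxy ▸ hy)
  have h1 := sum_neg_log_one_sub_le hy hxy
  have h2 := remainder_le hy
  rw [hxy] at hlx
  set y := Real.log (primorialAt n)
  have hU : 9.7 ≤ Real.log y := by
    have h1 : Real.log ((2 : ℝ) ^ 14) ≤ Real.log y := Real.log_le_log (by norm_num) hy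
    rw [Real.log_pow] at h1
    have := Real.log_two_gt_d9
    norm_num at h1 ⊢
    linarith
  have hx0 : 0 < Real.log (nthPrime n) :=
    Real.log_pos (by exact_mod_cast (prime_nthPrime n).one_lt)
  set U := Real.log y
  have hU0 : 0 < U := by linarith
  set a := 1.1253 / (Real.log (nthPrime n) * U) with ha
  have ha0 : 0 < a := by positivity
  have h3 : 1.1253 / ((U + Real.log 2) * U) ≤ a := by
    rw [ha]
    gcongr
  have h4 := error_le_log hU h3
  have h5 : Real.log (∏ p ∈ (nthPrime n).primesLE, (1 - 1 / (p : ℝ))⁻¹) =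
      ∑ p ∈ (nthPrime n).primesLE, -Real.log (1 - 1 / (p : ℝ)) := by
    rw [Real.log_prod]
    · exact Finset.sum_congr rfl fun p _ => Real.log_inv _
    · intro p hp
      have h3 : (1 : ℝ) < p := by exact_mod_cast (Nat.mem_primesLE.mp hp).2.one_lt
      have : 1 / (p : ℝ) < 1 := by rwa [div_lt_one (by linarith)]
      exact inv_ne_zero (by linarith)
  have hpos : 0 < ∏ p ∈ (nthPrime n).primesLE, (1 - 1 / (p : ℝ))⁻¹ := by
    refine Finset.prod_pos fun p hp => ?_
    have h3 : (1 : ℝ) < p := by exact_mod_cast (Nat.mem_primesLE.mp hp).2.one_lt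
    have : 1 / (p : ℝ) < 1 := by rwa [div_lt_one (by linarith)]
    exact inv_pos.mpr (by linarith)
  rw [← Real.log_le_log_iff hpos (by positivity), h5, Real.log_mul (by positivity) (by positivity),
    Real.log_mul (by positivity) hU0.ne', Real.log_exp]
  linarith

end Conclusion

theorem Rt_primorial_lt_exp_gamma (t n : ℕ) (ht : 2 ≤ t) (hn : 2263 ≤ n)
    (h : Real.exp (2 / (nthPrime n : ℝ)) *
        (1 + 1.1253 / (Real.log (nthPrime n) * Real.log (Real.log (primorialAt n)))) <
      zetaNat t) :
    Rt t (primorialAt n) < Real.exp Real.eulerMascheroniConstant := by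
  have hy := two_pow_le_log_primorialAt hn
  exact Rt_lt_of_prod_le ht (by omega) (Real.log_pos (lt_of_lt_of_le (by norm_num) hy))
    (prod_inv_one_sub_le hn) h
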